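/- arXiv:2508.19413 — 6 statements merged into one kernel-verified Lean document; each statement's English description precedes it below -/
import Mathlib

section
/- Let d be a natural number and let K₁, K₂, K₃ ⊆ ℝ^d be convex sets. Let S denote the set of points of ℝ^d encapsulated by K₁, K₂, K₃. Then S is finite and |S| ≤ ⌊3d/2⌋ + 1. -/
open Metric Set

section Encapsulation

variable {V : Type*} [NormedAddCommGroup V] [NormedSpace ℝ V]

/-- `p` lies outside `U`, but every line through `p` lies in `U` near `p`, except at `p`. -/
def RadiallyEncapsulated (U : Set V) (p : V) : Prop :=
  p ∉ U ∧ ∀ v : V, v ≠ 0 → ∃ δ > 0, ∀ t : ℝ, 0 < t → t < δ → p + t • v ∈ U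

theorem RadiallyEncapsulated.of_ball {U : Set V} {p : V} {ε : ℝ} (hε : 0 < ε)
    (h : ball p ε \ U = {p}) : RadiallyEncapsulated U p := by
  refine ⟨(h.symm ▸ mem_singleton p : p ∈ ball p ε \ U).2, fun v hv => ?_⟩
  have hv' : 0 < ‖v‖ := norm_pos_iff.2 hv
  refine ⟨ε / ‖v‖, by positivity, fun t ht htδ => ?_⟩
  by_contra hU
  have hmem : p + t • v ∈ ball p ε \ U := by
    refine ⟨?_, hU⟩
    rw [mem_ball, dist_eq_norm, add_sub_cancel_left, norm_smul, Real.norm_of_nonneg ht.le]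
    exact (lt_div_iff₀ hv').1 htδ
  rw [h, mem_singleton_iff, add_eq_left, smul_eq_zero] at hmem
  exact hmem.elim ht.ne' hv

theorem RadiallyEncapsulated.preimage {U : Set V} {W : Submodule ℝ V} {b : V} {w : W}
    (h : RadiallyEncapsulated U (b + w)) :
    RadiallyEncapsulated {x : W | b + x ∈ U} w := by
  refine ⟨h.1, fun v hv => ?_⟩
  obtain ⟨δ, hδ, H⟩ := h.2 v (by simpa using hv)
  refine ⟨δ, hδ, fun t ht htδ => ?_⟩
  simpa [add_assoc] using H t ht htδ

/-- A set on the far side of a hyperplane does not contribute to encapsulating a point. -/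
theorem RadiallyEncapsulated.of_union_of_lt {A B : Set V} {q : V} {f : V →ₗ[ℝ] ℝ} {c : ℝ}
    (h : RadiallyEncapsulated (A ∪ B) q) (hB : ∀ x ∈ B, c ≤ f x) (hq : f q < c) :
    RadiallyEncapsulated A q := by
  refine ⟨fun hA => h.1 (Or.inl hA), fun v hv => ?_⟩
  obtain ⟨δ, hδ, H⟩ := h.2 v hv
  have hpos : 0 < |f v| + 1 := by positivity
  refine ⟨min δ ((c - f q) / (|f v| + 1)), lt_min hδ (div_pos (by linarith) hpos),
    fun t ht htδ => ?_⟩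
  refine (H t ht (htδ.trans_le (min_le_left _ _))).resolve_right fun hmem => ?_
  have h1 := hB _ hmem
  have h2 := (lt_div_iff₀ hpos).1 (htδ.trans_le (min_le_right _ _))
  rw [map_add, map_smul, smul_eq_mul] at h1
  nlinarith [mul_le_mul_of_nonneg_left (le_abs_self (f v)) ht.le]

/-- Two convex sets encapsulate at most one point. -/
theorem RadiallyEncapsulated.unique {A B : Set V} {p q : V} (hA : Convex ℝ A) (hB : Convex ℝ B)
    (hp : RadiallyEncapsulated (A ∪ B) p) (hq : RadiallyEncapsulated (A ∪ B) q) : p = q := by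
  by_contra hpq
  have hv : q - p ≠ 0 := sub_ne_zero.2 (Ne.symm hpq)
  set v := q - p with hvdef
  obtain ⟨δ₁, h₁, H₁⟩ := hp.2 v hv
  obtain ⟨δ₂, h₂, H₂⟩ := hp.2 (-v) (neg_ne_zero.2 hv)
  obtain ⟨δ₃, h₃, H₃⟩ := hq.2 v hv
  obtain ⟨δ₄, h₄, H₄⟩ := hq.2 (-v) (neg_ne_zero.2 hv)
  obtain ⟨t, ht, htm⟩ := exists_between
    (show 0 < min (min (min δ₁ δ₂) (min δ₃ δ₄)) 1 by positivity)
  simp only [lt_min_iff] at htm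
  obtain ⟨⟨⟨t₁, t₂⟩, t₃, t₄⟩, t₅⟩ := htm
  have line : ∀ {C : Set V}, Convex ℝ C → ∀ r s u : ℝ, r ≤ s → s ≤ u →
      p + r • v ∈ C → p + u • v ∈ C → p + s • v ∈ C := by
    intro C hC r s u hrs hsu hr hu
    have hcv : Convex ℝ {x : ℝ | p + x • v ∈ C} :=
      (hC.translate_preimage_right p).linear_preimage (LinearMap.toSpanSingleton ℝ V v)
    exact hcv.ordConnected.out hr hu ⟨hrs, hsu⟩
  have hq' : q = p + (1 : ℝ) • v := by simp [hvdef]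
  have e₁ := H₁ t ht t₁
  have e₂ : p + (-t) • v ∈ A ∪ B := by simpa using H₂ t ht t₂
  have e₃ : p + (1 + t) • v ∈ A ∪ B := by
    have := H₃ t ht t₃
    rwa [hq', add_assoc, ← add_smul] at this
  have e₄ : p + (1 - t) • v ∈ A ∪ B := by
    have := H₄ t ht t₄
    rwa [hq', add_assoc, smul_neg, ← sub_eq_add_neg, ← sub_smul] at this
  have npA : p + (0 : ℝ) • v ∉ A := by simpa using fun h => hp.1 (Or.inl h)
  have npB : p + (0 : ℝ) • v ∉ B := by simpa using fun h => hp.1 (Or.inr h)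
  have nqA : p + (1 : ℝ) • v ∉ A := hq' ▸ fun h => hq.1 (Or.inl h)
  have nqB : p + (1 : ℝ) • v ∉ B := hq' ▸ fun h => hq.1 (Or.inr h)
  have a₁ := fun h h' => npA (line hA (-t) 0 t (by linarith) ht.le h h')
  have a₂ := fun h h' => npA (line hA (-t) 0 (1 - t) (by linarith) (by linarith) h h')
  have a₃ := fun h h' => npA (line hA (-t) 0 (1 + t) (by linarith) (by linarith) h h')
  have a₄ := fun h h' => nqA (line hA (1 - t) 1 (1 + t) (by linarith) (by linarith) h h')
  have b₁ := fun h h' => npB (line hB (-t) 0 t (by linarith) ht.le h h')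
  have b₂ := fun h h' => npB (line hB (-t) 0 (1 - t) (by linarith) (by linarith) h h')
  have b₃ := fun h h' => npB (line hB (-t) 0 (1 + t) (by linarith) (by linarith) h h')
  have b₄ := fun h h' => nqB (line hB (1 - t) 1 (1 + t) (by linarith) (by linarith) h h')
  rcases e₁ with e₁ | e₁ <;> rcases e₂ with e₂ | e₂ <;> rcases e₃ with e₃ | e₃ <;>
    rcases e₄ with e₄ | e₄ <;>
    first
    | exact a₁ e₂ e₁
    | exact a₂ e₂ e₄
    | exact a₃ e₂ e₃
    | exact a₄ e₄ e₃
    | exact b₁ e₂ e₁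
    | exact b₂ e₂ e₄
    | exact b₃ e₂ e₃
    | exact b₄ e₄ e₃

/-- A point outside a convex set in finite dimension can be weakly separated from it. -/
theorem Convex.exists_ne_zero_forall_le [FiniteDimensional ℝ V] [Nontrivial V] {K : Set V}
    (hK : Convex ℝ K) {p : V} (hp : p ∉ K) :
    ∃ f : V →ₗ[ℝ] ℝ, f ≠ 0 ∧ ∀ x ∈ K, f p ≤ f x := by
  by_cases h : (interior K).Nonempty
  · obtain ⟨f, hf⟩ := geometric_hahn_banach_open_point hK.interior isOpen_interior
      (fun h' => hp (interior_subset h'))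
    refine ⟨-(f : V →ₗ[ℝ] ℝ), fun h0 => ?_, fun x hx => ?_⟩
    · obtain ⟨x, hx⟩ := h
      have h1 := hf x hx
      have h2 : ∀ y, f y = 0 := fun y => by simpa using LinearMap.congr_fun h0 y
      simp [h2] at h1
    · have hx' : x ∈ closure (interior K) := by
        rw [hK.closure_interior_eq_closure_of_nonempty_interior h]
        exact subset_closure hx
      have hcl : IsClosed {y | f y ≤ f p} := isClosed_le f.continuous continuous_const
      have : f x ≤ f p := closure_minimal (fun y hy => (hf y hy).le) hcl hx'
      simpa using this
  · rw [hK.interior_nonempty_iff_affineSpan_eq_top] at h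
    have hs : vectorSpan ℝ K ≠ ⊤ := by
      rcases K.eq_empty_or_nonempty with rfl | hne
      · simp [bot_ne_top]
      · rwa [Ne, ← AffineSubspace.affineSpan_eq_top_iff_vectorSpan_eq_top_of_nonempty ℝ V V hne]
    obtain ⟨f, hf0, hf⟩ := Submodule.exists_le_ker_of_lt_top _ hs.lt_top
    have hc : ∀ x ∈ K, ∀ y ∈ K, f x = f y := fun x hx y hy => by
      have := hf (vsub_mem_vectorSpan ℝ hx hy)
      simpa [sub_eq_zero] using this
    by_cases hall : ∀ x ∈ K, f p ≤ f x
    · exact ⟨f, hf0, hall⟩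
    · push Not at hall
      obtain ⟨y, hy, hyp⟩ := hall
      refine ⟨-f, neg_ne_zero.2 hf0, fun x hx => ?_⟩
      rw [LinearMap.neg_apply, LinearMap.neg_apply, hc x hx y hy]
      linarith

theorem exists_eq_smul_of_ker_le {f g : V →ₗ[ℝ] ℝ} (h : LinearMap.ker f ≤ LinearMap.ker g) :
    ∃ c : ℝ, g = c • f := by
  by_cases hf : f = 0
  · refine ⟨0, ?_⟩
    subst hf
    ext v
    simpa using h (show v ∈ LinearMap.ker (0 : V →ₗ[ℝ] ℝ) by simp)
  · obtain ⟨v, hv⟩ := DFunLike.ne_iff.1 hf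
    rw [LinearMap.zero_apply] at hv
    refine ⟨g v / f v, LinearMap.ext fun x => ?_⟩
    have hx : x - (f x / f v) • v ∈ LinearMap.ker f := by simp [hv]
    have := h hx
    simp only [LinearMap.mem_ker, map_sub, map_smul, smul_eq_mul, sub_eq_zero] at this
    rw [this, LinearMap.smul_apply, smul_eq_mul]
    ring

/-- Two closed half-spaces covering the space are opposite. -/
theorem exists_pos_eq_neg_smul {f g : V →ₗ[ℝ] ℝ} (hf : f ≠ 0) (hg : g ≠ 0)
    (h : ∀ v, 0 ≤ f v ∨ 0 ≤ g v) : ∃ c > (0 : ℝ), g = (-c) • f := by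
  obtain ⟨w, hw⟩ : ∃ w, f w < 0 := by
    obtain ⟨v, hv⟩ := DFunLike.ne_iff.1 hf
    rcases lt_or_gt_of_ne hv with hv | hv
    · exact ⟨v, hv⟩
    · exact ⟨-v, by simpa using hv⟩
  have hker : LinearMap.ker f ≤ LinearMap.ker g := by
    intro v hv
    rw [LinearMap.mem_ker] at hv ⊢
    by_contra hgv
    rcases h (w + ((-1 - g w) / g v) • v) with h' | h'
    · simp [hv] at h'
      linarith
    · simp [hgv] at h'
      linarith
  obtain ⟨c, rfl⟩ := exists_eq_smul_of_ker_le hker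
  refine ⟨-c, ?_, by simp⟩
  have hc : c ≠ 0 := fun h => hg (by simp [h])
  have := (h w).resolve_left (not_le.2 hw)
  rw [LinearMap.smul_apply, smul_eq_mul] at this
  by_contra hcn
  have : 0 < c := lt_of_le_of_ne (by linarith) hc.symm
  nlinarith

theorem RadiallyEncapsulated.exists_mem {U : Set V} {p : V} (h : RadiallyEncapsulated U p)
    {v : V} (hv : v ≠ 0) : ∃ t > (0 : ℝ), p + t • v ∈ U := by
  obtain ⟨δ, hδ, H⟩ := h.2 v hv
  exact ⟨δ / 2, by positivity, H _ (by positivity) (by linarith)⟩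

theorem nonneg_of_forall_le {K : Set V} {f : V →ₗ[ℝ] ℝ} {p v : V} {t : ℝ}
    (hf : ∀ x ∈ K, f p ≤ f x) (ht : 0 < t) (h : p + t • v ∈ K) : 0 ≤ f v := by
  have := hf _ h
  rw [map_add, map_smul, smul_eq_mul] at this
  exact nonneg_of_mul_nonneg_right (by linarith) ht

theorem nonpos_of_forall_nonneg_or {f g h : V →ₗ[ℝ] ℝ} (hcov : ∀ v, 0 ≤ f v ∨ 0 ≤ g v ∨ 0 ≤ h v)
    {u w : V} (hu : g u < 0 ∧ h u < 0) (hg : 0 ≤ g w) (hh : 0 ≤ h w) : f w ≤ 0 := by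
  by_contra! hf
  have hpos : 0 < |f u| + 1 := by positivity
  rcases hcov (-w + (f w / (|f u| + 1)) • u) with H | H | H <;>
    simp only [map_add, map_neg, map_smul, smul_eq_mul] at H
  · have h₁ : f w / (|f u| + 1) * f u ≤ f w / (|f u| + 1) * |f u| := by
      gcongr
      exact le_abs_self _
    have h₂ : f w / (|f u| + 1) * (|f u| + 1) = f w := by field_simp
    have h₃ : 0 < f w / (|f u| + 1) := by positivity
    nlinarith
  · have h₃ : 0 < f w / (|f u| + 1) := by positivity
    nlinarith [hu.1]
  · have h₃ : 0 < f w / (|f u| + 1) := by positivity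
    nlinarith [hu.2]

/-- All but one point of `S` lie on a hyperplane, or all but three lie on a flat of
codimension two. -/
def HasFlatReduction (S : Set V) : Prop :=
  ∃ (b : V) (W : Submodule ℝ V) (T : Set V), S ⊆ {x | x - b ∈ W} ∪ T ∧
    (Module.finrank ℝ W + 1 ≤ Module.finrank ℝ V ∧ T.encard ≤ 1 ∨
      Module.finrank ℝ W + 2 ≤ Module.finrank ℝ V ∧ T.encard ≤ 3)

variable [FiniteDimensional ℝ V]

theorem finrank_ker_lt {f : V →ₗ[ℝ] ℝ} (hf : f ≠ 0) :
    Module.finrank ℝ (LinearMap.ker f) < Module.finrank ℝ V :=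
  Submodule.finrank_lt (fun h => hf (LinearMap.ker_eq_top.1 h))

theorem finrank_ker_inf_ker_add_two_le {f g : V →ₗ[ℝ] ℝ}
    (h : ¬ LinearMap.ker f ≤ LinearMap.ker g) (hf : f ≠ 0) :
    Module.finrank ℝ ↥(LinearMap.ker f ⊓ LinearMap.ker g) + 2 ≤ Module.finrank ℝ V := by
  have h₁ := finrank_ker_lt hf
  have h₂ : Module.finrank ℝ ↥(LinearMap.ker f ⊓ LinearMap.ker g)
      < Module.finrank ℝ (LinearMap.ker f) :=
    Submodule.finrank_lt_finrank_of_lt (lt_of_le_of_ne inf_le_left fun h' => h (inf_eq_left.1 h'))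
  omega

theorem HasFlatReduction.of_hyperplane {S : Set V} {f : V →ₗ[ℝ] ℝ} (hf : f ≠ 0) {b z : V}
    (h : ∀ x ∈ S, f x ≠ f b → x = z) : HasFlatReduction S := by
  refine ⟨b, LinearMap.ker f, {z}, fun x hx => ?_, Or.inl ⟨finrank_ker_lt hf, by simp⟩⟩
  by_cases hxb : f x = f b
  · left
    simp [hxb]
  · exact Or.inr (h x hx hxb)

theorem encard_triple_le {α : Type*} (a b c : α) : ({a, b, c} : Set α).encard ≤ 3 := by
  refine (encard_insert_le _ _).trans ?_
  have := encard_insert_le ({c} : Set α) b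
  rw [encard_singleton] at this
  calc ({b, c} : Set α).encard + 1 ≤ (1 + 1) + 1 := by gcongr
    _ = 3 := by norm_num

theorem HasFlatReduction.of_codim_two {S : Set V} {f g : V →ₗ[ℝ] ℝ} (hf : f ≠ 0)
    (hfg : ¬ LinearMap.ker f ≤ LinearMap.ker g) {α β : ℝ} {x y z : V}
    (h : ∀ u ∈ S, ¬ (f u = α ∧ g u = β) → u ∈ ({x, y, z} : Set V)) : HasFlatReduction S := by
  have hb : ∃ b : V, ∀ u ∈ S, (f u = α ∧ g u = β) → f u = f b ∧ g u = g b := by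
    by_cases hex : ∃ b ∈ S, f b = α ∧ g b = β
    · obtain ⟨b, -, rfl, rfl⟩ := hex
      exact ⟨b, fun u _ hu => hu⟩
    · push Not at hex
      exact ⟨0, fun u hu hu' => absurd hu'.2 (hex u hu hu'.1)⟩
  obtain ⟨b, hb⟩ := hb
  refine ⟨b, LinearMap.ker f ⊓ LinearMap.ker g, {x, y, z}, fun u hu => ?_,
    Or.inr ⟨finrank_ker_inf_ker_add_two_le hfg hf, encard_triple_le x y z⟩⟩
  by_cases hu' : f u = α ∧ g u = β
  · left
    have := hb u hu hu'
    simp [this.1, this.2]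
  · exact Or.inr (h u hu hu')

variable {A B C S : Set V}

/-- The case where two of the three sets are separated by a hyperplane through a point of `S`. -/
theorem HasFlatReduction.of_separated (hA : Convex ℝ A) (hB : Convex ℝ B) (hC : Convex ℝ C)
    (hS : ∀ x ∈ S, RadiallyEncapsulated (A ∪ B ∪ C) x) {p : V} {f : V →ₗ[ℝ] ℝ}
    (hf : f ≠ 0) (hfA : ∀ x ∈ A, f p ≤ f x) (hfB : ∀ x ∈ B, f x ≤ f p) :
    HasFlatReduction S := by
  have : Nontrivial V := by
    obtain ⟨v, hv⟩ := DFunLike.ne_iff.1 hf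
    exact ⟨v, 0, fun h => hv (by simp [h])⟩
  have above : ∀ x ∈ S, f p < f x → RadiallyEncapsulated (A ∪ C) x := fun x hx h => by
    have h' := hS x hx
    rw [union_right_comm] at h'
    exact h'.of_union_of_lt (f := -f) (c := -f p) (by simpa using hfB) (by simpa using h)
  have below : ∀ x ∈ S, f x < f p → RadiallyEncapsulated (B ∪ C) x := fun x hx h => by
    have h' := hS x hx
    rw [union_assoc, union_comm] at h'
    exact h'.of_union_of_lt hfA h
  by_cases hq : ∃ q ∈ S, f p < f q
  swap
  · push Not at hq
    by_cases hr : ∃ r ∈ S, f r < f p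
    · obtain ⟨r, hr, hrp⟩ := hr
      exact .of_hyperplane hf (b := p) (z := r) fun x hx hxp =>
        (below x hx (lt_of_le_of_ne (hq x hx) hxp)).unique hB hC (below r hr hrp)
    · push Not at hr
      exact .of_hyperplane hf (b := p) (z := p) fun x hx hxp =>
        absurd (le_antisymm (hq x hx) (hr x hx)) hxp
  obtain ⟨q, hq, hqp⟩ := hq
  have hqe := above q hq hqp
  have above' : ∀ x ∈ S, f p < f x → x = q := fun x hx h => (above x hx h).unique hA hC hqe
  by_cases hr : ∃ r ∈ S, f r < f p
  swap
  · push Not at hr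
    exact .of_hyperplane hf (b := p) (z := q) fun x hx hxp =>
      above' x hx (lt_of_le_of_ne (hr x hx) (Ne.symm hxp))
  obtain ⟨r, hr, hrp⟩ := hr
  have hre := below r hr hrp
  have below' : ∀ x ∈ S, f x < f p → x = r := fun x hx h => (below x hx h).unique hB hC hre
  obtain ⟨g, hg, hgA⟩ := hA.exists_ne_zero_forall_le (fun h => hqe.1 (Or.inl h))
  obtain ⟨k, hk, hkC⟩ := hC.exists_ne_zero_forall_le (fun h => hqe.1 (Or.inr h))
  obtain ⟨c, hc, rfl⟩ := exists_pos_eq_neg_smul hg hk fun v => by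
    by_cases hv : v = 0
    · simp [hv]
    · obtain ⟨t, ht, h | h⟩ := hqe.exists_mem hv
      · exact Or.inl (nonneg_of_forall_le hgA ht h)
      · exact Or.inr (nonneg_of_forall_le hkC ht h)
  have hgC : ∀ x ∈ C, g x ≤ g q := fun x hx => by
    have := hkC x hx
    simp only [LinearMap.smul_apply, smul_eq_mul] at this
    nlinarith
  have gabove : ∀ x ∈ S, g q < g x → RadiallyEncapsulated (A ∪ B) x := fun x hx h =>
    (hS x hx).of_union_of_lt (f := -g) (c := -g q) (by simpa using hgC) (by simpa using h)
  have gbelow : ∀ x ∈ S, g x < g q → x = r := fun x hx h => by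
    have h' := hS x hx
    rw [union_assoc, union_comm] at h'
    exact (h'.of_union_of_lt hgA h).unique hB hC hre
  by_cases hs : ∃ s ∈ S, g q < g s
  swap
  · push Not at hs
    exact .of_hyperplane hg (b := q) (z := r) fun x hx hxq =>
      gbelow x hx (lt_of_le_of_ne (hs x hx) hxq)
  obtain ⟨s, hs, hsq⟩ := hs
  have gabove' : ∀ x ∈ S, g q < g x → x = s := fun x hx h =>
    (gabove x hx h).unique hA hB (gabove s hs hsq)
  by_cases hrs : r = s
  · subst hrs
    exact .of_hyperplane hg (b := q) (z := r) fun x hx hxq =>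
      (lt_or_gt_of_ne hxq).elim (gbelow x hx) (gabove' x hx)
  have hsp : f s = f p := by
    rcases lt_trichotomy (f s) (f p) with h | h | h
    · exact absurd (below' s hs h).symm hrs
    · exact h
    · exact absurd hsq (by simp [above' s hs h])
  have hker : ¬ LinearMap.ker f ≤ LinearMap.ker g := fun hle => by
    obtain ⟨c, rfl⟩ := exists_eq_smul_of_ker_le hle
    simp only [LinearMap.smul_apply, smul_eq_mul] at hsq gabove'
    refine hrs (gabove' r hr ?_)
    have hc : c < 0 := by
      by_contra hc
      nlinarith
    nlinarith
  refine .of_codim_two hf hker (α := f p) (β := g q) (x := q) (y := r) (z := s) fun u hu hne => ?_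
  simp only [mem_insert_iff, mem_singleton_iff]
  by_cases h : f u = f p
  · rcases lt_or_gt_of_ne (fun h' => hne ⟨h, h'⟩) with h' | h'
    · exact Or.inr (Or.inl (gbelow u hu h'))
    · exact Or.inr (Or.inr (gabove' u hu h'))
  · rcases lt_or_gt_of_ne h with h' | h'
    · exact Or.inr (Or.inl (below' u hu h'))
    · exact Or.inl (above' u hu h')

/-- If no two of the supporting half-spaces at `p` are opposite, then any two of them leave a
common open cone uncovered. -/
theorem HasFlatReduction.or_exists_neg (hA : Convex ℝ A) (hB : Convex ℝ B) (hC : Convex ℝ C)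
    (hS : ∀ x ∈ S, RadiallyEncapsulated (A ∪ B ∪ C) x) {p : V} {f g : V →ₗ[ℝ] ℝ}
    (hf : f ≠ 0) (hg : g ≠ 0) (hfA : ∀ x ∈ A, f p ≤ f x) (hgB : ∀ x ∈ B, g p ≤ g x) :
    HasFlatReduction S ∨ ∃ v, f v < 0 ∧ g v < 0 := by
  by_contra! h
  obtain ⟨c, hc, rfl⟩ := exists_pos_eq_neg_smul hf hg fun v => by
    by_cases hv : 0 ≤ f v
    · exact Or.inl hv
    · exact Or.inr (h.2 v (not_le.1 hv))
  refine h.1 (.of_separated hA hB hC hS hf hfA fun x hx => ?_)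
  have := hgB x hx
  simp only [LinearMap.smul_apply, smul_eq_mul] at this
  nlinarith

theorem HasFlatReduction.of_encapsulated [Nontrivial V] (hA : Convex ℝ A) (hB : Convex ℝ B)
    (hC : Convex ℝ C) (hS : ∀ x ∈ S, RadiallyEncapsulated (A ∪ B ∪ C) x) {p : V} (hp : p ∈ S) :
    HasFlatReduction S := by
  have hpe := hS p hp
  have hS' : ∀ x ∈ S, RadiallyEncapsulated (A ∪ C ∪ B) x := fun x hx => by
    rw [union_right_comm]
    exact hS x hx
  have hS'' : ∀ x ∈ S, RadiallyEncapsulated (B ∪ C ∪ A) x := fun x hx => by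
    rw [union_comm, ← union_assoc]
    exact hS x hx
  obtain ⟨f, hf, hfA⟩ := hA.exists_ne_zero_forall_le (fun h => hpe.1 (Or.inl (Or.inl h)))
  obtain ⟨g, hg, hgB⟩ := hB.exists_ne_zero_forall_le (fun h => hpe.1 (Or.inl (Or.inr h)))
  obtain ⟨k, hk, hkC⟩ := hC.exists_ne_zero_forall_le (fun h => hpe.1 (Or.inr h))
  have hcov : ∀ v, 0 ≤ f v ∨ 0 ≤ g v ∨ 0 ≤ k v := fun v => by
    by_cases hv : v = 0
    · simp [hv]
    · obtain ⟨t, ht, (h | h) | h⟩ := hpe.exists_mem hv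
      · exact Or.inl (nonneg_of_forall_le hfA ht h)
      · exact Or.inr (Or.inl (nonneg_of_forall_le hgB ht h))
      · exact Or.inr (Or.inr (nonneg_of_forall_le hkC ht h))
  rcases HasFlatReduction.or_exists_neg hA hB hC hS hf hg hfA hgB with h | ⟨u, hu⟩
  · exact h
  rcases HasFlatReduction.or_exists_neg hA hC hB hS' hf hk hfA hkC with h | ⟨v, hv⟩
  · exact h
  rcases HasFlatReduction.or_exists_neg hB hC hA hS'' hg hk hgB hkC with h | ⟨w, hw⟩
  · exact h
  have hker : ¬ LinearMap.ker f ≤ LinearMap.ker g := fun hle => by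
    obtain ⟨c, rfl⟩ := exists_eq_smul_of_ker_le hle
    simp only [LinearMap.smul_apply, smul_eq_mul] at hu hcov
    have hc : 0 < c := by
      by_contra hc
      nlinarith
    rcases hcov v with h | h | h <;> nlinarith
  have bound : ∀ {X Y Z : Set V} {l : V →ₗ[ℝ] ℝ}, Convex ℝ X → Convex ℝ Y →
      (∀ x ∈ S, RadiallyEncapsulated (X ∪ Y ∪ Z) x) → (∀ x ∈ Z, l p ≤ l x) →
      ∃ z, ∀ x ∈ S, l x < l p → x = z := by
    intro X Y Z l hX hY hXYZ hl
    by_cases h : ∃ z ∈ S, l z < l p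
    · obtain ⟨z, hz, hzp⟩ := h
      exact ⟨z, fun x hx hxp => ((hXYZ x hx).of_union_of_lt hl hxp).unique hX hY
        ((hXYZ z hz).of_union_of_lt hl hzp)⟩
    · exact ⟨p, fun x hx hxp => absurd ⟨x, hx, hxp⟩ h⟩
  obtain ⟨x, hx⟩ := bound hB hC hS'' hfA
  obtain ⟨y, hy⟩ := bound hA hC hS' hgB
  obtain ⟨z, hz⟩ := bound hA hB hS hkC
  refine .of_codim_two hf hker (α := f p) (β := g p) (x := x) (y := y) (z := z) fun a ha hne => ?_
  simp only [mem_insert_iff, mem_singleton_iff]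
  by_contra! hcon
  have h₁ : f p ≤ f a := not_lt.1 fun h => hcon.1 (hx a ha h)
  have h₂ : g p ≤ g a := not_lt.1 fun h => hcon.2.1 (hy a ha h)
  have h₃ : k p ≤ k a := not_lt.1 fun h => hcon.2.2 (hz a ha h)
  have i₁ : f (a - p) ≤ 0 :=
    nonpos_of_forall_nonneg_or hcov hw (by simpa using h₂) (by simpa using h₃)
  have i₂ : g (a - p) ≤ 0 :=
    nonpos_of_forall_nonneg_or (fun v => by have := hcov v; tauto) hv
      (by simpa using h₁) (by simpa using h₃)
  rw [map_sub] at i₁ i₂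
  exact hne ⟨by linarith, by linarith⟩

end Encapsulation

theorem encard_le_of_radiallyEncapsulated (n : ℕ) {V : Type*} [NormedAddCommGroup V]
    [NormedSpace ℝ V] [FiniteDimensional ℝ V] (hn : Module.finrank ℝ V = n) {A B C S : Set V}
    (hA : Convex ℝ A) (hB : Convex ℝ B) (hC : Convex ℝ C)
    (hS : ∀ x ∈ S, RadiallyEncapsulated (A ∪ B ∪ C) x) :
    S.encard ≤ (3 * n / 2 + 1 : ℕ) := by
  induction n using Nat.strong_induction_on generalizing V with
  | _ n ih =>
    rcases S.eq_empty_or_nonempty with rfl | ⟨p, hp⟩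
    · simp
    rcases subsingleton_or_nontrivial V with hV | hV
    · calc S.encard ≤ 1 := encard_le_one_iff_subsingleton.2 (subsingleton_of_subsingleton)
        _ ≤ (3 * n / 2 + 1 : ℕ) := by
          push_cast
          exact le_add_self
    obtain ⟨b, W, T, hST, hWT⟩ := HasFlatReduction.of_encapsulated hA hB hC hS hp
    have hconv : ∀ {K : Set V}, Convex ℝ K → Convex ℝ {x : W | b + x ∈ K} := fun {K} hK =>
      (hK.translate_preimage_right b).linear_preimage W.subtype
    have hW : ({x : W | b + x ∈ S}).encard ≤ (3 * Module.finrank ℝ W / 2 + 1 : ℕ) :=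
      ih _ (by omega) rfl (hconv hA) (hconv hB) (hconv hC) fun x hx => (hS _ hx).preimage
    have hsub : S ⊆ (fun x : W => b + (x : V)) '' {x : W | b + x ∈ S} ∪ T := fun x hx =>
      (hST hx).imp_left fun h => ⟨⟨x - b, h⟩, by simpa using hx, by simp⟩
    have hcard : ∀ m : ℕ, T.encard ≤ m → 3 * Module.finrank ℝ W / 2 + 1 + m ≤ 3 * n / 2 + 1 →
        S.encard ≤ (3 * n / 2 + 1 : ℕ) := fun m hT hm =>
      calc S.encard ≤ _ := encard_le_encard hsub
        _ ≤ _ := encard_union_le _ _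
        _ ≤ (3 * Module.finrank ℝ W / 2 + 1 : ℕ) + (m : ℕ∞) :=
          add_le_add ((encard_image_le _ _).trans hW) hT
        _ ≤ _ := by exact_mod_cast hm
    rcases hWT with ⟨hW', hT⟩ | ⟨hW', hT⟩
    · exact hcard 1 (by exact_mod_cast hT) (by omega)
    · exact hcard 3 (by exact_mod_cast hT) (by omega)

/-- A point `p` is *encapsulated* by a family of sets if some pointed open ball
around `p` is covered by their union, i.e. `B(p, ε) \ (K₁ ∪ … ∪ Kₙ) = {p}`. -/
theorem three_convex_encapsulated_card_le (d : ℕ)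
    (K₁ K₂ K₃ : Set (EuclideanSpace ℝ (Fin d)))
    (hK₁ : Convex ℝ K₁) (hK₂ : Convex ℝ K₂) (hK₃ : Convex ℝ K₃)
    (S : Set (EuclideanSpace ℝ (Fin d)))
    (hS : S = {p | ∃ ε > 0, ball p ε \ (K₁ ∪ K₂ ∪ K₃) = {p}}) :
    S.Finite ∧ S.ncard ≤ 3 * d / 2 + 1 := by
  subst hS
  have h := encard_le_of_radiallyEncapsulated d (finrank_euclideanSpace_fin (𝕜 := ℝ))
    hK₁ hK₂ hK₃ (S := {p | ∃ ε > 0, ball p ε \ (K₁ ∪ K₂ ∪ K₃) = {p}})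
    fun p ⟨_, hε, hp⟩ => .of_ball hε hp
  exact ⟨finite_of_encard_le_coe h, ENat.toNat_le_of_le_natCast h⟩
end

section
/- Let d be a natural number and let K₁, K₂, K₃ ⊆ ℝ^d be convex sets. Let S denote the set of points of ℝ^d encapsulated by K₁, K₂, K₃. If |S| = ⌊3d/2⌋ + 1, then the sets K₁, K₂, K₃ are pairwise disjoint. -/
open Metric Set

open Filter Topology Module

universe u

section Germs

variable {V : Type u} [NormedAddCommGroup V] [NormedSpace ℝ V]

/-- `p` is encapsulated by the family `K`: it lies in no `K i`, but a punctured neighbourhood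
of `p` is covered by the `K i`. -/
def IsEncapsulated (K : Fin 3 → Set V) (p : V) : Prop :=
  (∀ i, p ∉ K i) ∧ ∀ᶠ x in 𝓝[≠] p, ∃ i, x ∈ K i

theorem Convex.add_smul_mem_of_le {A : Set V} (hA : Convex ℝ A) {x v : V} {a b c : ℝ}
    (ha : x + a • v ∈ A) (hb : x + b • v ∈ A) (hac : a ≤ c) (hcb : c ≤ b) : x + c • v ∈ A := by
  have h : Convex ℝ ((AffineMap.lineMap x (x + v) : ℝ →ᵃ[ℝ] V) ⁻¹' A) := hA.affine_preimage _
  have key : ∀ t : ℝ, (AffineMap.lineMap x (x + v) : ℝ →ᵃ[ℝ] V) t = x + t • v := fun t => by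
    simp [AffineMap.lineMap_apply, add_comm]
  have := h.ordConnected.out (x := a) (y := b) (by simpa [key] using ha)
    (by simpa [key] using hb) ⟨hac, hcb⟩
  simpa [key] using this

theorem tendsto_add_smul_nhdsGT (p v : V) :
    Tendsto (fun t : ℝ => p + t • v) (𝓝[>] 0) (𝓝 p) := by
  have : Tendsto (fun t : ℝ => p + t • v) (𝓝 0) (𝓝 (p + (0 : ℝ) • v)) :=
    (by fun_prop : Continuous fun t : ℝ => p + t • v).tendsto 0
  rw [zero_smul, add_zero] at this
  exact this.mono_left nhdsWithin_le_nhds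

theorem mem_closure_of_eventually_add_smul {A : Set V} {p v : V}
    (h : ∀ᶠ t in 𝓝[>] (0 : ℝ), p + t • v ∈ A) : p ∈ closure A :=
  mem_closure_of_tendsto (tendsto_add_smul_nhdsGT p v) h

theorem eventually_add_smul_of_frequently {A : Set V} (hA : Convex ℝ A) {p v : V}
    (h : ∃ᶠ t in 𝓝[>] (0 : ℝ), p + t • v ∈ A) : ∀ᶠ t in 𝓝[>] (0 : ℝ), p + t • v ∈ A := by
  obtain ⟨b, hb, hb0⟩ := (h.and_eventually self_mem_nhdsWithin).exists
  filter_upwards [Ioo_mem_nhdsGT (show (0 : ℝ) < b from hb0)] with t ht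
  obtain ⟨a, ha, ha0⟩ := (h.and_eventually (Ioo_mem_nhdsGT ht.1)).exists
  exact hA.add_smul_mem_of_le ha hb ha0.2.le ht.2.le

variable {K : Fin 3 → Set V} {p q x v : V}

theorem IsEncapsulated.eventually_exists (hp : IsEncapsulated K p) (hv : v ≠ 0) :
    ∀ᶠ t in 𝓝[>] (0 : ℝ), ∃ i, p + t • v ∈ K i := by
  have : Tendsto (fun t : ℝ => p + t • v) (𝓝[>] 0) (𝓝[≠] p) := by
    refine tendsto_nhdsWithin_iff.2 ⟨tendsto_add_smul_nhdsGT p v, ?_⟩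
    filter_upwards [self_mem_nhdsWithin] with t ht
    have : t ≠ 0 := (ne_of_gt ht)
    simp [this, hv]
  exact this.eventually hp.2

theorem IsEncapsulated.exists_eventually (hK : ∀ i, Convex ℝ (K i)) (hp : IsEncapsulated K p)
    (hv : v ≠ 0) : ∃ i, ∀ᶠ t in 𝓝[>] (0 : ℝ), p + t • v ∈ K i := by
  by_contra h
  have h' : ∀ i, ∀ᶠ t in 𝓝[>] (0 : ℝ), p + t • v ∉ K i := fun i => by
    by_contra h2
    exact h ⟨i, eventually_add_smul_of_frequently (hK i) (by
      simpa only [Filter.not_eventually, not_not] using h2)⟩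
  obtain ⟨t, ht, i, hi⟩ := ((eventually_all.2 h').and (hp.eventually_exists hv)).exists
  exact ht i hi

theorem IsEncapsulated.eventually_beyond (hK : ∀ i, Convex ℝ (K i)) (hp : IsEncapsulated K p)
    {i j k : Fin 3} (hijk : ∀ l, l = i ∨ l = j ∨ l = k) (hi : x ∈ K i) (hj : x ∈ K j) :
    ∀ᶠ t in 𝓝[>] (0 : ℝ), p + t • (p - x) ∈ K k := by
  have hv : p - x ≠ 0 := by
    rw [sub_ne_zero]
    rintro rfl
    exact hp.1 i hi
  have aux : ∀ l, x ∈ K l → ∀ t : ℝ, 0 < t → p + t • (p - x) ∉ K l := fun l hl t ht hmem =>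
    hp.1 l (by
      simpa using (hK l).add_smul_mem_of_le (x := p) (v := p - x) (a := -1) (b := t) (c := 0)
        (by simpa using hl) hmem (by norm_num) ht.le)
  filter_upwards [hp.eventually_exists hv, self_mem_nhdsWithin] with t ⟨l, hl⟩ ht
  rcases hijk l with rfl | rfl | rfl
  · exact absurd hl (aux _ hi t ht)
  · exact absurd hl (aux _ hj t ht)
  · exact hl

theorem IsEncapsulated.notMem_third (hK : ∀ i, Convex ℝ (K i)) (hp : IsEncapsulated K p)
    {i j k : Fin 3} (hijk : ∀ l, l = i ∨ l = j ∨ l = k) (hi : x ∈ K i) (hj : x ∈ K j) :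
    x ∉ K k := fun hk => by
  obtain ⟨t, ht, ht0⟩ :=
    ((hp.eventually_beyond hK hijk hi hj).and self_mem_nhdsWithin).exists
  have ht0 : 0 < t := ht0
  exact hp.1 k (by
    simpa using (hK k).add_smul_mem_of_le (x := p) (v := p - x) (a := -1) (b := t) (c := 0)
      (by simpa using hk) ht (by norm_num) ht0.le)

/-- Along the line through two encapsulated points, the three sets appear one after the other. -/
theorem IsEncapsulated.exists_line_labels (hK : ∀ i, Convex ℝ (K i)) (hp : IsEncapsulated K p)
    (hq : IsEncapsulated K q) (hpq : p ≠ q) :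
    ∃ i j k : Fin 3, i ≠ j ∧ j ≠ k ∧ i ≠ k ∧
      (∀ᶠ t in 𝓝[>] (0 : ℝ), p + t • (p - q) ∈ K i) ∧
      (∀ᶠ t in 𝓝[>] (0 : ℝ), p + t • (q - p) ∈ K j) ∧
      (∀ᶠ t in 𝓝[>] (0 : ℝ), q + t • (p - q) ∈ K j) ∧
      (∀ᶠ t in 𝓝[>] (0 : ℝ), q + t • (q - p) ∈ K k) := by
  have h1 : p - q ≠ 0 := sub_ne_zero.2 hpq
  have h2 : q - p ≠ 0 := sub_ne_zero.2 hpq.symm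
  obtain ⟨i, hi⟩ := hp.exists_eventually hK h1
  obtain ⟨j, hj⟩ := hp.exists_eventually hK h2
  obtain ⟨l, hl⟩ := hq.exists_eventually hK h1
  obtain ⟨k, hk⟩ := hq.exists_eventually hK h2
  obtain ⟨t, ⟨⟨⟨hit, hjt⟩, hlt⟩, hkt⟩, ht⟩ :=
    ((((hi.and hj).and hl).and hk).and (Ioo_mem_nhdsGT (show (0 : ℝ) < 1 by norm_num))).exists
  have e1 : p + t • (p - q) = p + (-t) • (q - p) := by module
  have e2 : q + t • (p - q) = p + (1 - t) • (q - p) := by module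
  have e3 : q + t • (q - p) = p + (1 + t) • (q - p) := by module
  have e4 : q = p + (1 : ℝ) • (q - p) := by module
  have e5 : p = p + (0 : ℝ) • (q - p) := by module
  have sep0 : ∀ m, ∀ a b : ℝ, p + a • (q - p) ∈ K m → p + b • (q - p) ∈ K m → a ≤ 0 → 0 ≤ b → False :=
    fun m a b ha hb ha0 hb0 => hp.1 m (by
      rw [e5]; exact (hK m).add_smul_mem_of_le ha hb ha0 hb0)
  have sep1 : ∀ m, ∀ a b : ℝ, p + a • (q - p) ∈ K m → p + b • (q - p) ∈ K m → a ≤ 1 → 1 ≤ b → False :=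
    fun m a b ha hb ha0 hb0 => hq.1 m (by
      rw [e4]; exact (hK m).add_smul_mem_of_le ha hb ha0 hb0)
  rw [e1] at hit
  rw [e2] at hlt
  rw [e3] at hkt
  obtain ⟨ht0, ht1⟩ := ht
  have hij : i ≠ j := by rintro rfl; exact sep0 i _ _ hit hjt (by linarith) (by linarith)
  have hik : i ≠ k := by rintro rfl; exact sep0 i _ _ hit hkt (by linarith) (by linarith)
  have hil : i ≠ l := by rintro rfl; exact sep0 i _ _ hit hlt (by linarith) (by linarith)
  have hjk : j ≠ k := by rintro rfl; exact sep1 j _ _ hjt hkt (by linarith) (by linarith)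
  have hlk : l ≠ k := by rintro rfl; exact sep1 l _ _ hlt hkt (by linarith) (by linarith)
  obtain rfl : j = l := by omega
  exact ⟨i, j, k, hij, hjk, hik, hi, hj, hl, hk⟩

theorem IsEncapsulated.eq_of_notMem_closure (hK : ∀ i, Convex ℝ (K i))
    (hp : IsEncapsulated K p) (hq : IsEncapsulated K q) {l : Fin 3}
    (hpl : p ∉ closure (K l)) (hql : q ∉ closure (K l)) : p = q := by
  by_contra hpq
  obtain ⟨i, j, k, hij, hjk, hik, h1, h2, h3, h4⟩ := hp.exists_line_labels hK hq hpq
  have := mem_closure_of_eventually_add_smul h1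
  have := mem_closure_of_eventually_add_smul h2
  have := mem_closure_of_eventually_add_smul h4
  have hl : l = i ∨ l = j ∨ l = k := by omega
  rcases hl with rfl | rfl | rfl <;> contradiction

theorem IsEncapsulated.exists_ne_mem_closure [Nontrivial V] (hK : ∀ i, Convex ℝ (K i))
    (hp : IsEncapsulated K p) (i : Fin 3) : ∃ j ≠ i, p ∈ closure (K j) := by
  obtain ⟨v, hv⟩ := exists_ne (0 : V)
  obtain ⟨j, hj⟩ := hp.exists_eventually hK hv
  obtain ⟨k, hk⟩ := hp.exists_eventually hK (neg_ne_zero.2 hv)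
  have hjk : j ≠ k := by
    rintro rfl
    obtain ⟨t, ⟨h1, h2⟩, ht⟩ := ((hj.and hk).and self_mem_nhdsWithin).exists
    have ht : 0 < t := ht
    rw [smul_neg, ← neg_smul] at h2
    exact hp.1 j (by
      simpa using (hK j).add_smul_mem_of_le (c := 0) h2 h1 (by linarith) ht.le)
  by_cases hji : j = i
  · exact ⟨k, by rintro rfl; exact hjk hji, mem_closure_of_eventually_add_smul hk⟩
  · exact ⟨j, hji, mem_closure_of_eventually_add_smul hj⟩

theorem IsEncapsulated.ne_add_smul (hK : ∀ i, Convex ℝ (K i)) (hp : IsEncapsulated K p)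
    (hq : IsEncapsulated K q) (hpq : p ≠ q) {s : ℝ} (hs0 : 0 < s) (hs1 : s < 1) :
    ¬ IsEncapsulated K (p + s • (q - p)) := fun hr => by
  obtain ⟨i, j, k, -, -, -, -, h2, h3, -⟩ := hp.exists_line_labels hK hq hpq
  obtain ⟨t, ⟨h2, h3⟩, -, ht⟩ := ((h2.and h3).and
    (Ioo_mem_nhdsGT (show 0 < min s (1 - s) from lt_min hs0 (by linarith)))).exists
  obtain ⟨ht1, ht2⟩ := lt_min_iff.1 ht
  rw [show q + t • (p - q) = p + (1 - t) • (q - p) by module] at h3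
  exact hr.1 j ((hK j).add_smul_mem_of_le h2 h3 ht1.le (by linarith))

theorem IsEncapsulated.eq_of_smul_eq (hK : ∀ i, Convex ℝ (K i)) (hp : IsEncapsulated K p)
    (hq : IsEncapsulated K q) {i j k : Fin 3} (hijk : ∀ l, l = i ∨ l = j ∨ l = k)
    (hi : x ∈ K i) (hj : x ∈ K j) {s : ℝ} (h : q = x + s • (p - x)) : p = q := by
  wlog hs : s ≤ 0 ∨ 1 ≤ s generalizing p q s
  · have hs0 : s ≠ 0 := fun h0 => hs (Or.inl h0.le)
    push Not at hs
    refine (this hq hp (s := s⁻¹) ?_ (Or.inr ((one_le_inv₀ hs.1).2 hs.2.le))).symm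
    rw [h, add_sub_cancel_left, smul_smul, inv_mul_cancel₀ hs0]
    module
  have h1 := hp.eventually_beyond hK hijk hi hj
  have h2 := hq.eventually_beyond hK hijk hi hj
  rcases hs with hs | hs
  · obtain ⟨t, ⟨h1, h2⟩, ht⟩ := ((h1.and h2).and self_mem_nhdsWithin).exists
    have ht : 0 < t := ht
    rw [show p + t • (p - x) = x + (1 + t) • (p - x) by module] at h1
    rw [h, show x + s • (p - x) + t • (x + s • (p - x) - x) = x + ((1 + t) * s) • (p - x) by
      module] at h2
    refine absurd ?_ (hp.notMem_third hK hijk hi hj)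
    simpa using (hK k).add_smul_mem_of_le (c := 0) h2 h1 (by nlinarith) (by linarith)
  · rcases hs.eq_or_lt with rfl | hs
    · rw [h]; module
    obtain ⟨t, ⟨h1, h2⟩, ht⟩ :=
      ((h1.and h2).and (Ioo_mem_nhdsGT (show 0 < s - 1 by linarith))).exists
    obtain ⟨ht, hts⟩ := ht
    rw [show p + t • (p - x) = x + (1 + t) • (p - x) by module] at h1
    rw [h, show x + s • (p - x) + t • (x + s • (p - x) - x) = x + ((1 + t) * s) • (p - x) by
      module] at h2
    refine absurd ?_ (hq.1 k)
    rw [h]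
    exact (hK k).add_smul_mem_of_le h1 h2 (by linarith) (by nlinarith)

theorem card_le_one_of_notMem_closure {S : Finset V} (hK : ∀ i, Convex ℝ (K i))
    (hS : ∀ p ∈ S, IsEncapsulated K p) (i : Fin 3) [DecidablePred fun p => p ∉ closure (K i)] :
    (S.filter fun p => p ∉ closure (K i)).card ≤ 1 :=
  Finset.card_le_one.2 fun p hp q hq =>
    (hS p (Finset.mem_filter.1 hp).1).eq_of_notMem_closure hK (hS q (Finset.mem_filter.1 hq).1)
      (Finset.mem_filter.1 hp).2 (Finset.mem_filter.1 hq).2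

end Germs

section Bounds

open scoped Pointwise

theorem Convex.exists_submodule_ne_top_of_disjoint {V : Type u} [NormedAddCommGroup V]
    [NormedSpace ℝ V] [FiniteDimensional ℝ V] [Nontrivial V] {B C : Set V} (hB : Convex ℝ B)
    (hC : Convex ℝ C) (hBC : Disjoint B C) :
    ∃ W : Submodule ℝ V, W ≠ ⊤ ∧ ∀ p ∈ closure B ∩ closure C, ∀ q ∈ closure B ∩ closure C,
      p - q ∈ W := by
  have hcl : ∀ p ∈ closure B ∩ closure C, ∀ q ∈ closure B ∩ closure C, p - q ∈ closure (B - C) :=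
    fun p hp q hq => map_mem_closure₂ continuous_sub hp.1 hq.2 fun b hb c hc =>
      Set.sub_mem_sub hb hc
  have h0 : (0 : V) ∉ B - C := by
    rintro ⟨b, hb, c, hc, hbc⟩
    exact Set.disjoint_left.1 hBC hb (sub_eq_zero.1 hbc ▸ hc)
  have hD : Convex ℝ (B - C) := hB.sub hC
  by_cases hspan : affineSpan ℝ (B - C) = ⊤
  · have hint := hD.interior_nonempty_iff_affineSpan_eq_top.2 hspan
    obtain ⟨f, hf⟩ := geometric_hahn_banach_open_point hD.interior isOpen_interior
      (fun h => h0 (interior_subset h))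
    rw [map_zero] at hf
    have hle : ∀ z ∈ closure (B - C), f z ≤ 0 := by
      rw [← hD.closure_interior_eq_closure_of_nonempty_interior hint]
      exact fun z hz => closure_minimal (t := {z | f z ≤ 0}) (fun a ha => (hf a ha).le)
        (isClosed_le f.continuous continuous_const) hz
    refine ⟨LinearMap.ker f.toLinearMap, fun htop => ?_, fun p hp q hq => ?_⟩
    · obtain ⟨a, ha⟩ := hint
      have : a ∈ LinearMap.ker f.toLinearMap := htop ▸ Submodule.mem_top
      exact (hf a ha).ne (by simpa using this)
    · have h1 := hle _ (hcl p hp q hq)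
      have h2 := hle _ (hcl q hq p hp)
      rw [map_sub] at h1 h2
      have : f p = f q := by linarith
      simp [this]
  · have hsub : closure (B - C) ⊆ affineSpan ℝ (B - C) :=
      closure_minimal (subset_affineSpan ℝ _) (AffineSubspace.closed_of_finiteDimensional _)
    refine ⟨(affineSpan ℝ (B - C)).direction, fun htop => ?_, fun p hp q hq => ?_⟩
    · rcases (B - C).eq_empty_or_nonempty with he | hne
      · rw [he] at htop
        simp at htop
      · exact hspan ((AffineSubspace.direction_eq_top_iff_of_nonempty
          ((affineSpan_nonempty ℝ).2 hne)).1 htop)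
    · have h1 := AffineSubspace.vsub_mem_direction (hsub (hcl p hp q hq)) (hsub (hcl q hq p hp))
      have h2 := Submodule.smul_mem _ (2⁻¹ : ℝ) h1
      rwa [vsub_eq_sub, show (2⁻¹ : ℝ) • (p - q - (q - p)) = p - q by module] at h2

/-- In dimension `m`, three convex sets encapsulate at most `⌊3m/2⌋ + 1` points. -/
def EncapsulatedBound (m : ℕ) : Prop :=
  ∀ (V : Type u) [NormedAddCommGroup V] [NormedSpace ℝ V] [FiniteDimensional ℝ V],
    finrank ℝ V = m → ∀ K : Fin 3 → Set V, (∀ i, Convex ℝ (K i)) →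
      ∀ S : Finset V, (∀ p ∈ S, IsEncapsulated K p) → S.card ≤ 3 * m / 2 + 1

variable {V : Type u} [NormedAddCommGroup V] [NormedSpace ℝ V] [FiniteDimensional ℝ V]
  {K : Fin 3 → Set V} {S : Finset V}

theorem EncapsulatedBound.card_le_of_sub_mem {W : Submodule ℝ V}
    (hW : EncapsulatedBound.{u} (finrank ℝ W)) (hK : ∀ i, Convex ℝ (K i))
    (hS : ∀ p ∈ S, IsEncapsulated K p) {o : V} (ho : ∀ p ∈ S, p - o ∈ W) :
    S.card ≤ 3 * finrank ℝ W / 2 + 1 := by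
  classical
  set φ : W →ᵃ[ℝ] V := W.subtype.toAffineMap + AffineMap.const ℝ W o with hφ
  have hφ_apply : ∀ w : W, φ w = w + o := fun w => by simp [hφ]
  have hinj : Function.Injective φ := fun a b hab => by
    simpa [hφ_apply] using hab
  have hcont : Continuous φ := by
    rw [show (φ : W → V) = fun w : W => (w : V) + o from funext hφ_apply]
    fun_prop
  have himage : (S.preimage φ hinj.injOn).image φ = S := by
    rw [Finset.image_preimage, Finset.filter_true_of_mem]
    exact fun p hp => ⟨⟨p - o, ho p hp⟩, by simp [hφ_apply]⟩
  rw [← himage]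
  refine Finset.card_image_le.trans (hW W rfl (fun i => φ ⁻¹' K i)
    (fun i => (hK i).affine_preimage φ) _ fun w hw => ?_)
  obtain ⟨h1, h2⟩ := hS _ (Finset.mem_preimage.1 hw)
  refine ⟨h1, ?_⟩
  have : Tendsto φ (𝓝[≠] w) (𝓝[≠] (φ w)) :=
    hcont.continuousAt.continuousWithinAt.tendsto_nhdsWithin fun z hz => hinj.ne hz
  exact this.eventually h2

theorem card_le_of_sub_mem_ne_top
    (ih : ∀ m < finrank ℝ V, EncapsulatedBound.{u} m) (hK : ∀ i, Convex ℝ (K i))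
    (hS : ∀ p ∈ S, IsEncapsulated K p) {W : Submodule ℝ V} (hW : W ≠ ⊤) {o : V}
    (ho : ∀ p ∈ S, p - o ∈ W) : S.card ≤ 3 * finrank ℝ V / 2 := by
  have h1 : finrank ℝ W < finrank ℝ V := Submodule.finrank_lt hW
  have h2 := (ih _ h1).card_le_of_sub_mem hK hS ho
  omega

theorem card_le_of_sub_mem_inf
    (ih : ∀ m < finrank ℝ V, EncapsulatedBound.{u} m) (hK : ∀ i, Convex ℝ (K i))
    (hS : ∀ p ∈ S, IsEncapsulated K p) {W₁ W₂ : Submodule ℝ V} (h₁ : W₁ ≠ ⊤)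
    (h₁₂ : ¬ W₁ ≤ W₂) {o : V} (ho₁ : ∀ p ∈ S, p - o ∈ W₁) (ho₂ : ∀ p ∈ S, p - o ∈ W₂) :
    2 ≤ finrank ℝ V ∧ S.card + 2 ≤ 3 * finrank ℝ V / 2 := by
  have h1 : finrank ℝ W₁ < finrank ℝ V := Submodule.finrank_lt h₁
  have h2 : finrank ℝ (W₁ ⊓ W₂ : Submodule ℝ V) < finrank ℝ W₁ :=
    Submodule.finrank_lt_finrank_of_lt (inf_lt_left.2 h₁₂)
  have h3 := (ih _ (h2.trans h1)).card_le_of_sub_mem hK hS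
    fun p hp => Submodule.mem_inf.2 ⟨ho₁ p hp, ho₂ p hp⟩
  omega

theorem card_le_of_pairwise_meet (ih : ∀ m < finrank ℝ V, EncapsulatedBound.{u} m)
    (hK : ∀ i, Convex ℝ (K i)) (hS : ∀ p ∈ S, IsEncapsulated K p)
    (h01 : (K 0 ∩ K 1).Nonempty) (h02 : (K 0 ∩ K 2).Nonempty) (h12 : (K 1 ∩ K 2).Nonempty) :
    S.card ≤ 3 * finrank ℝ V / 2 := by
  rcases S.eq_empty_or_nonempty with rfl | ⟨s, hs⟩
  · simp
  by_cases hspan : affineSpan ℝ (S : Set V) = ⊤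
  · exfalso
    obtain ⟨o, ho⟩ := interior_convexHull_nonempty_iff_affineSpan_eq_top.2 hspan
    have key : ∀ i j k : Fin 3, (∀ l, l = i ∨ l = j ∨ l = k) → (K i ∩ K j).Nonempty → o ∈ K k := by
      rintro i j k hijk ⟨x, hi, hj⟩
      have h1 : ∀ᶠ t in 𝓝[>] (0 : ℝ), ∀ p ∈ S, p + t • (p - x) ∈ K k :=
        (Finset.eventually_all S).2 fun p hp => (hS p hp).eventually_beyond hK hijk hi hj
      have h2 : ∀ᶠ t in 𝓝[>] (0 : ℝ), x + (1 + t)⁻¹ • (o - x) ∈ convexHull ℝ (S : Set V) := by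
        have hc : ContinuousAt (fun t : ℝ => x + (1 + t)⁻¹ • (o - x)) 0 := by
          have : (1 + (0 : ℝ)) ≠ 0 := by norm_num
          fun_prop (disch := assumption)
        have := hc.tendsto.eventually
          (show ∀ᶠ z in 𝓝 _, z ∈ convexHull ℝ (S : Set V) by
            simpa using mem_interior_iff_mem_nhds.1 ho)
        exact this.filter_mono nhdsWithin_le_nhds
      obtain ⟨t, ⟨h1, h2⟩, ht⟩ := ((h1.and h2).and self_mem_nhdsWithin).exists
      have ht : 0 < t := ht
      have h3 : convexHull ℝ (S : Set V) ⊆ (AffineMap.homothety x (1 + t) : V →ᵃ[ℝ] V) ⁻¹' K k :=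
        convexHull_min (fun p hp => by
          have := h1 p hp
          rw [mem_preimage, AffineMap.homothety_apply, vsub_eq_sub, vadd_eq_add]
          convert this using 1
          module) ((hK k).affine_preimage _)
      have h4 := h3 h2
      rw [mem_preimage, AffineMap.homothety_apply, vsub_eq_sub, vadd_eq_add, add_sub_cancel_left,
        smul_smul, mul_inv_cancel₀ (by positivity), one_smul, sub_add_cancel] at h4
      exact h4
    exact (hS s hs).notMem_third hK (i := 0) (j := 1) (k := 2) (by decide)
      (key 1 2 0 (by decide) h12) (key 0 2 1 (by decide) h02) (key 0 1 2 (by decide) h01)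
  · refine card_le_of_sub_mem_ne_top ih hK hS (W := (affineSpan ℝ (S : Set V)).direction)
      (fun h => hspan ?_) (o := s) fun p hp => AffineSubspace.vsub_mem_direction
        (subset_affineSpan ℝ _ hp) (subset_affineSpan ℝ _ hs)
    exact (AffineSubspace.direction_eq_top_iff_of_nonempty
      ⟨s, subset_affineSpan ℝ _ hs⟩).1 h

theorem card_le_of_two_meet [Nontrivial V] (ih : ∀ m < finrank ℝ V, EncapsulatedBound.{u} m)
    (hK : ∀ i, Convex ℝ (K i)) (hS : ∀ p ∈ S, IsEncapsulated K p) {i j k : Fin 3}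
    (hijk : ∀ l, l = i ∨ l = j ∨ l = k) (hij : (K i ∩ K j).Nonempty)
    (hik : (K i ∩ K k).Nonempty) (hjk : Disjoint (K j) (K k)) :
    S.card ≤ 3 * finrank ℝ V / 2 := by
  rcases S.eq_empty_or_nonempty with rfl | ⟨s, hs⟩
  · simp
  obtain ⟨x, hxi, hxj⟩ := hij
  obtain ⟨y, hyi, hyk⟩ := hik
  obtain ⟨W, hW, hsub⟩ := (hK j).exists_submodule_ne_top_of_disjoint (hK k) hjk
  have hmem : ∀ p ∈ S, p ∈ closure (K j) ∩ closure (K k) := fun p hp =>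
    ⟨mem_closure_of_eventually_add_smul
      ((hS p hp).eventually_beyond hK (fun l => (hijk l).imp_right Or.symm) hyi hyk),
     mem_closure_of_eventually_add_smul ((hS p hp).eventually_beyond hK hijk hxi hxj)⟩
  exact card_le_of_sub_mem_ne_top ih hK hS hW fun p hp => hsub p (hmem p hp) s (hmem s hs)

theorem card_le_of_one_meet [Nontrivial V] (ih : ∀ m < finrank ℝ V, EncapsulatedBound.{u} m)
    (hK : ∀ i, Convex ℝ (K i)) (hS : ∀ p ∈ S, IsEncapsulated K p) {i j k : Fin 3}
    (hijk : ∀ l, l = i ∨ l = j ∨ l = k) (hij : (K i ∩ K j).Nonempty)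
    (hik : Disjoint (K i) (K k)) (hjk : Disjoint (K j) (K k)) :
    S.card ≤ 3 * finrank ℝ V / 2 := by
  classical
  obtain ⟨x, hxi, hxj⟩ := hij
  have hk : ∀ p ∈ S, p ∈ closure (K k) := fun p hp =>
    mem_closure_of_eventually_add_smul ((hS p hp).eventually_beyond hK hijk hxi hxj)
  have hpos : 0 < finrank ℝ V := finrank_pos
  rcases (show 1 ≤ finrank ℝ V from hpos).eq_or_lt with h1 | h2
  · rw [← h1]
    refine Finset.card_le_one.2 fun p hp q hq => ?_
    have hpx : p - x ≠ 0 := by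
      rw [sub_ne_zero]
      rintro rfl
      exact (hS p hp).1 i hxi
    obtain ⟨s, hs⟩ := (finrank_eq_one_iff_of_nonzero' _ hpx).1 h1.symm (q - x)
    exact (hS p hp).eq_of_smul_eq hK (hS q hq) hijk hxi hxj (s := s) (by rw [hs]; abel)
  have hcard : S.card ≤ (S.filter fun p => p ∈ closure (K i) ∧ p ∈ closure (K j)).card + 2 := by
    have hsub : S ⊆ (S.filter fun p => p ∈ closure (K i) ∧ p ∈ closure (K j)) ∪
        ((S.filter fun p => p ∉ closure (K i)) ∪ S.filter fun p => p ∉ closure (K j)) := by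
      intro p hp
      simp only [Finset.mem_union, Finset.mem_filter, hp, true_and]
      tauto
    have := Finset.card_le_card hsub
    have := Finset.card_union_le (S.filter fun p => p ∈ closure (K i) ∧ p ∈ closure (K j))
      ((S.filter fun p => p ∉ closure (K i)) ∪ S.filter fun p => p ∉ closure (K j))
    have := Finset.card_union_le (S.filter fun p => p ∉ closure (K i))
      (S.filter fun p => p ∉ closure (K j))
    have := card_le_one_of_notMem_closure hK hS i
    have := card_le_one_of_notMem_closure hK hS j
    omega
  set T := S.filter fun p => p ∈ closure (K i) ∧ p ∈ closure (K j)
  rcases T.eq_empty_or_nonempty with hT0 | ⟨o, ho⟩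
  · rw [hT0, Finset.card_empty] at hcard
    omega
  obtain ⟨hoS, hoi, hoj⟩ := Finset.mem_filter.1 ho
  obtain ⟨W₁, hW₁, hsub₁⟩ := (hK i).exists_submodule_ne_top_of_disjoint (hK k) hik
  obtain ⟨W₂, hW₂, hsub₂⟩ := (hK j).exists_submodule_ne_top_of_disjoint (hK k) hjk
  have h₁ : ∀ p ∈ S, p ∈ closure (K i) → p - o ∈ W₁ := fun p hp hpi =>
    hsub₁ p ⟨hpi, hk p hp⟩ o ⟨hoi, hk o hoS⟩
  have h₂ : ∀ p ∈ S, p ∈ closure (K j) → p - o ∈ W₂ := fun p hp hpj =>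
    hsub₂ p ⟨hpj, hk p hp⟩ o ⟨hoj, hk o hoS⟩
  by_cases hle : W₁ ≤ W₂
  · refine card_le_of_sub_mem_ne_top ih hK hS hW₂ (o := o) fun p hp => ?_
    obtain ⟨l, hlk, hl⟩ := (hS p hp).exists_ne_mem_closure hK k
    rcases hijk l with rfl | rfl | rfl
    · exact hle (h₁ p hp hl)
    · exact h₂ p hp hl
    · exact absurd rfl hlk
  · have := card_le_of_sub_mem_inf ih hK (S := T) (fun p hp => hS p (Finset.mem_filter.1 hp).1) hW₁
      hle (o := o) (fun p hp => h₁ p (Finset.mem_filter.1 hp).1 (Finset.mem_filter.1 hp).2.1)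
      fun p hp => h₂ p (Finset.mem_filter.1 hp).1 (Finset.mem_filter.1 hp).2.2
    omega

theorem card_le_two_of_finrank_eq_one (hV : finrank ℝ V = 1) (hK : ∀ i, Convex ℝ (K i))
    (hS : ∀ p ∈ S, IsEncapsulated K p) : S.card ≤ 2 := by
  by_contra! h
  obtain ⟨a, b, c, ha, hb, hc, hab, hac, hbc⟩ := Finset.two_lt_card_iff.1 h
  have hcol : Collinear ℝ ({a, b, c} : Set V) :=
    collinear_iff_finrank_le_one.2 ((Submodule.finrank_le _).trans hV.le)
  have aux : ∀ p ∈ S, ∀ q ∈ S, ∀ r ∈ S, p ≠ q → q ≠ r → p ≠ r → ¬ Wbtw ℝ p q r := by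
    rintro p hp _ hq r hr hpq hqr hpr ⟨s, ⟨hs0, hs1⟩, rfl⟩
    have hs0' : s ≠ 0 := by rintro rfl; simp at hpq
    have hs1' : s ≠ 1 := by rintro rfl; simp at hqr
    refine (hS p hp).ne_add_smul hK (hS r hr) hpr (lt_of_le_of_ne hs0 hs0'.symm)
      (lt_of_le_of_ne hs1 hs1') ?_
    have := hS _ hq
    rwa [AffineMap.lineMap_apply, vsub_eq_sub, vadd_eq_add, add_comm] at this
  rcases hcol.wbtw_or_wbtw_or_wbtw with h | h | h
  · exact aux a ha b hb c hc hab hbc hac h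
  · exact aux b hb c hc a ha hbc hac.symm hab.symm h
  · exact aux c hc a ha b hb hac.symm hab hbc.symm h

theorem card_le_of_pairwise_disjoint [Nontrivial V]
    (ih : ∀ m < finrank ℝ V, EncapsulatedBound.{u} m)
    (hK : ∀ i, Convex ℝ (K i)) (hS : ∀ p ∈ S, IsEncapsulated K p)
    (hdisj : ∀ i j, i ≠ j → Disjoint (K i) (K j)) :
    S.card ≤ 3 * finrank ℝ V / 2 + 1 := by
  classical
  have hpos : 0 < finrank ℝ V := finrank_pos
  rcases (show 1 ≤ finrank ℝ V from hpos).eq_or_lt with h1 | h2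
  · have := card_le_two_of_finrank_eq_one h1.symm hK hS
    omega
  have hcard : S.card ≤ (S.filter fun p => ∀ i, p ∈ closure (K i)).card + 3 := by
    have hsub : S ⊆ (S.filter fun p => ∀ i, p ∈ closure (K i)) ∪
        Finset.univ.biUnion fun i => S.filter fun p => p ∉ closure (K i) := by
      intro p hp
      by_cases h : ∀ i, p ∈ closure (K i)
      · simp [hp, h]
      · push Not at h
        simpa [hp] using Or.inr h
    have h3 := Finset.card_le_card hsub
    have h4 := Finset.card_union_le (S.filter fun p => ∀ i, p ∈ closure (K i))
      (Finset.univ.biUnion fun i => S.filter fun p => p ∉ closure (K i))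
    have h5 := Finset.card_biUnion_le_card_mul Finset.univ
      (fun i => S.filter fun p => p ∉ closure (K i)) 1
      fun i _ => card_le_one_of_notMem_closure hK hS i
    rw [Finset.card_univ, Fintype.card_fin] at h5
    omega
  set T := S.filter fun p => ∀ i, p ∈ closure (K i)
  rcases T.eq_empty_or_nonempty with hT0 | ⟨o, ho⟩
  · rw [hT0, Finset.card_empty] at hcard
    omega
  have hoT := (Finset.mem_filter.1 ho).2
  have hex : ∀ e : {e : Fin 3 × Fin 3 // e.1 ≠ e.2}, ∃ W : Submodule ℝ V, W ≠ ⊤ ∧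
      ∀ p ∈ closure (K e.1.1) ∩ closure (K e.1.2), p - o ∈ W := fun e => by
    obtain ⟨W, hW, hsub⟩ :=
      (hK e.1.1).exists_submodule_ne_top_of_disjoint (hK e.1.2) (hdisj _ _ e.2)
    exact ⟨W, hW, fun p hp => hsub p hp o ⟨hoT _, hoT _⟩⟩
  choose W hW hsub using hex
  by_cases hle : ∀ e f, W e ≤ W f
  · refine (card_le_of_sub_mem_ne_top ih hK hS (hW ⟨(0, 1), by decide⟩) (o := o)
      fun p hp => ?_).trans (Nat.le_succ _)
    obtain ⟨i, -, hi⟩ := (hS p hp).exists_ne_mem_closure hK 0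
    obtain ⟨j, hji, hj⟩ := (hS p hp).exists_ne_mem_closure hK i
    exact hle ⟨(j, i), hji⟩ _ (hsub ⟨(j, i), hji⟩ p ⟨hj, hi⟩)
  · push Not at hle
    obtain ⟨e, f, hef⟩ := hle
    have hmem : ∀ e, ∀ p ∈ T, p - o ∈ W e := fun e p hp =>
      hsub e p ⟨(Finset.mem_filter.1 hp).2 _, (Finset.mem_filter.1 hp).2 _⟩
    have := card_le_of_sub_mem_inf ih hK (S := T) (fun p hp => hS p (Finset.mem_filter.1 hp).1)
      (hW e) hef (hmem e) (hmem f)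
    omega

theorem card_le_of_exists_meet (ih : ∀ m < finrank ℝ V, EncapsulatedBound.{u} m)
    (hK : ∀ i, Convex ℝ (K i)) (hS : ∀ p ∈ S, IsEncapsulated K p)
    (hmeet : ∃ i j, i ≠ j ∧ ¬ Disjoint (K i) (K j)) :
    S.card ≤ 3 * finrank ℝ V / 2 := by
  obtain ⟨i, j, hij, hd⟩ := hmeet
  rw [Set.not_disjoint_iff_nonempty_inter] at hd
  rcases subsingleton_or_nontrivial V with hV | hV
  · obtain ⟨x, hx, -⟩ := hd
    rw [Finset.eq_empty_of_forall_notMem fun p hp =>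
      (hS p hp).1 i (Subsingleton.elim x p ▸ hx)]
    simp
  obtain ⟨k, hki, hkj⟩ : ∃ k, k ≠ i ∧ k ≠ j :=
    (by decide : ∀ i j : Fin 3, ∃ k, k ≠ i ∧ k ≠ j) i j
  have hijk : ∀ l, l = i ∨ l = j ∨ l = k := by omega
  by_cases hik : Disjoint (K i) (K k) <;> by_cases hjk : Disjoint (K j) (K k)
  · exact card_le_of_one_meet ih hK hS hijk hd hik hjk
  · rw [Set.not_disjoint_iff_nonempty_inter] at hjk
    exact card_le_of_two_meet ih hK hS (i := j) (j := i) (k := k) (fun l => by have := hijk l; tauto)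
      (by rwa [Set.inter_comm]) hjk hik
  · rw [Set.not_disjoint_iff_nonempty_inter] at hik
    exact card_le_of_two_meet ih hK hS hijk hd hik hjk
  · have hall : ∀ a b : Fin 3, a ≠ b → (K a ∩ K b).Nonempty := by
      intro a b hab
      rw [Set.not_disjoint_iff_nonempty_inter] at hik hjk
      rcases hijk a with rfl | rfl | rfl <;> rcases hijk b with rfl | rfl | rfl <;>
        first
        | exact absurd rfl hab
        | assumption
        | rwa [Set.inter_comm]
    exact card_le_of_pairwise_meet ih hK hS (hall _ _ (by decide)) (hall _ _ (by decide))
      (hall _ _ (by decide))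

theorem encapsulatedBound (n : ℕ) : EncapsulatedBound.{u} n := by
  induction n using Nat.strong_induction_on with
  | _ n ih =>
    rintro V _ _ _ rfl K hK S hS
    by_cases hdisj : ∀ i j, i ≠ j → Disjoint (K i) (K j)
    · rcases subsingleton_or_nontrivial V with hV | hV
      · exact (Finset.card_le_one_of_subsingleton S).trans (Nat.le_add_left _ _)
      · exact card_le_of_pairwise_disjoint ih hK hS hdisj
    · push Not at hdisj
      exact (card_le_of_exists_meet ih hK hS hdisj).trans (Nat.le_succ _)

end Bounds

/-- If the number of points encapsulated by three convex sets in `ℝ^d` attains the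
maximum `⌊3d/2⌋ + 1`, then the three convex sets are pairwise disjoint. -/
theorem three_convex_encapsulated_card_eq_pairwise_disjoint (d : ℕ)
    (K₁ K₂ K₃ : Set (EuclideanSpace ℝ (Fin d)))
    (hK₁ : Convex ℝ K₁) (hK₂ : Convex ℝ K₂) (hK₃ : Convex ℝ K₃)
    (S : Set (EuclideanSpace ℝ (Fin d)))
    (hS : S = {p | ∃ ε > 0, ball p ε \ (K₁ ∪ K₂ ∪ K₃) = {p}})
    (hfin : S.Finite) (hcard : S.ncard = 3 * d / 2 + 1) :
    Disjoint K₁ K₂ ∧ Disjoint K₁ K₃ ∧ Disjoint K₂ K₃ := by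
  set K : Fin 3 → Set (EuclideanSpace ℝ (Fin d)) := ![K₁, K₂, K₃] with hKdef
  have hK : ∀ i, Convex ℝ (K i) := by
    simp [hKdef, Fin.forall_fin_succ, hK₁, hK₂, hK₃]
  have hunion : ∀ x, (∃ i, x ∈ K i) ↔ x ∈ K₁ ∪ K₂ ∪ K₃ := fun x => by
    simp [hKdef, Fin.exists_fin_succ, or_assoc]
  have henc : ∀ p ∈ hfin.toFinset, IsEncapsulated K p := by
    intro p hp
    rw [Set.Finite.mem_toFinset, hS] at hp
    obtain ⟨ε, hε, h⟩ := hp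
    have hpmem : p ∈ ball p ε \ (K₁ ∪ K₂ ∪ K₃) := by rw [h]; rfl
    refine ⟨fun i hi => hpmem.2 ((hunion p).1 ⟨i, hi⟩), ?_⟩
    filter_upwards [self_mem_nhdsWithin, mem_nhdsWithin_of_mem_nhds (ball_mem_nhds p hε)]
      with x hx hxε
    rw [hunion]
    by_contra hxK
    exact hx (h.subset ⟨hxε, hxK⟩)
  have hdisj : ∀ i j, i ≠ j → Disjoint (K i) (K j) := by
    by_contra! hmeet
    have := card_le_of_exists_meet (fun m _ => encapsulatedBound m) hK henc hmeet
    rw [finrank_euclideanSpace_fin, ← Set.ncard_eq_toFinset_card S hfin] at this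
    omega
  exact ⟨hdisj 0 1 (by decide), hdisj 0 2 (by decide), hdisj 1 2 (by decide)⟩
end

section
/- For every natural number d there exist convex sets K₁, K₂, K₃ ⊆ ℝ^d such that the set S of points encapsulated by K₁, K₂, K₃ satisfies |S| = ⌊3d/2⌋ + 1 and moreover ℝ^d \ (K₁ ∪ K₂ ∪ K₃) = S. -/
open Metric Set

/-- Three convex sets `K i` in a real vector space missing exactly `n` points, together with, for
each pair `i ≠ j`, convex sets `B i j ⊇ K i` and `B j i ⊇ K j` whose union misses exactly the
point `p i j`. -/
structure SeparatedTriple (V : Type*) [AddCommGroup V] [Module ℝ V] (n : ℕ) where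
  K : Fin 3 → Set V
  B : Fin 3 → Fin 3 → Set V
  p : Fin 3 → Fin 3 → V
  convex_K : ∀ i, Convex ℝ (K i)
  finite_compl : (⋃ i, K i)ᶜ.Finite
  ncard_compl : (⋃ i, K i)ᶜ.ncard = n
  subset_B : ∀ i j, i ≠ j → K i ⊆ B i j
  convex_B : ∀ i j, i ≠ j → Convex ℝ (B i j)
  openSegment_subset : ∀ i j, i ≠ j → ∀ x ∈ B i j, openSegment ℝ (p i j) x ⊆ B i j
  p_symm : ∀ i j, p i j = p j i
  union_eq : ∀ i j, i ≠ j → B i j ∪ B j i = {p i j}ᶜ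

namespace SeparatedTriple

section Map

variable {V W : Type*} [AddCommGroup V] [Module ℝ V] [AddCommGroup W] [Module ℝ W] {n : ℕ}

/-- Transport of a separated triple along a linear equivalence. -/
def map (T : SeparatedTriple V n) (e : W ≃ₗ[ℝ] V) : SeparatedTriple W n where
  K i := e ⁻¹' T.K i
  B i j := e ⁻¹' T.B i j
  p i j := e.symm (T.p i j)
  convex_K i := (T.convex_K i).linear_preimage e.toLinearMap
  finite_compl := by
    rw [← preimage_iUnion, ← preimage_compl]
    exact T.finite_compl.preimage e.injective.injOn
  ncard_compl := by
    rw [← preimage_iUnion, ← preimage_compl,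
      ncard_preimage_of_injective_subset_range e.injective (by simp [e.surjective.range_eq]),
      T.ncard_compl]
  subset_B i j h := preimage_mono (T.subset_B i j h)
  convex_B i j h := (T.convex_B i j h).linear_preimage e.toLinearMap
  openSegment_subset i j h x hx := by
    rintro _ ⟨a, b, ha, hb, hab, rfl⟩
    exact T.openSegment_subset i j h (e x) hx ⟨a, b, ha, hb, hab, by simp⟩
  p_symm i j := by rw [T.p_symm]
  union_eq i j h := by
    rw [← preimage_union, T.union_eq i j h]
    ext x
    simp [LinearEquiv.eq_symm_apply]

end Map

/-- Nothing at all is covered in dimension zero. -/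
def zeroDim : SeparatedTriple (Fin 0 → ℝ) 1 where
  K _ := ∅
  B _ _ := ∅
  p _ _ := 0
  convex_K _ := convex_empty
  finite_compl := toFinite _
  ncard_compl := by simp [ncard_univ]
  subset_B _ _ _ := le_rfl
  convex_B _ _ _ := convex_empty
  openSegment_subset _ _ _ _ h := h.elim
  p_symm _ _ := rfl
  union_eq _ _ _ := by
    ext x
    simp [Subsingleton.elim x 0]

/-- The line minus the points `0` and `1`, cut into three intervals. -/
def oneDim : SeparatedTriple ℝ 2 where
  K := ![Iio 0, Ioo 0 1, Ioi 1]
  B i j := if i < j then Iio (if i = 0 then 0 else 1) else Ioi (if j = 0 then 0 else 1)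
  p i j := if i = 0 ∨ j = 0 then 0 else 1
  convex_K i := by
    fin_cases i
    exacts [convex_Iio _, convex_Ioo _ _, convex_Ioi _]
  finite_compl := by
    refine (toFinite ({0, 1} : Set ℝ)).subset fun x hx => ?_
    simp [Fin.forall_fin_succ] at hx ⊢
    grind
  ncard_compl := by
    refine (congrArg ncard (?_ : _ = ({0, 1} : Set ℝ))).trans (ncard_pair zero_ne_one)
    ext x
    simp [Fin.forall_fin_succ]
    grind
  subset_B i j h := by
    intro x hx
    fin_cases i <;> fin_cases j <;> simp at h hx ⊢ <;> grind
  convex_B i j h := by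
    split_ifs
    all_goals first | exact convex_Iio _ | exact convex_Ioi _
  openSegment_subset i j h x hx := by
    rintro _ ⟨a, b, ha, hb, hab, rfl⟩
    fin_cases i <;> fin_cases j <;> simp at h hx ⊢ <;> nlinarith
  p_symm i j := by simp [or_comm]
  union_eq i j h := by
    ext x
    fin_cases i <;> fin_cases j <;> simp at h ⊢

section Step

variable {V : Type*}

/-- Three linear functionals of sum zero on the plane factor of `V × ℝ × ℝ`. -/
def height (i : Fin 3) (z : V × ℝ × ℝ) : ℝ := ![z.2.1, z.2.2, -z.2.1 - z.2.2] i

lemma height_sum {i j k : Fin 3} (hij : i ≠ j) (hik : i ≠ k) (hjk : j ≠ k) (z : V × ℝ × ℝ) :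
    height i z + height j z + height k z = 0 := by
  fin_cases i <;> fin_cases j <;> fin_cases k <;> simp [height] at hij hik hjk ⊢ <;> ring

lemma height_ext {z w : V × ℝ × ℝ} {i j : Fin 3} (hij : i ≠ j) (h : z.1 = w.1)
    (hi : height i z = height i w) (hj : height j z = height j w) : z = w := by
  obtain ⟨v, x, y⟩ := z
  obtain ⟨v', x', y'⟩ := w
  fin_cases i <;> fin_cases j <;> simp [height] at hij h hi hj ⊢ <;>
    refine ⟨h, ?_, ?_⟩ <;> linarith

lemma snd_eq_zero_iff (z : V × ℝ × ℝ) (i : Fin 3) :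
    z.2 = 0 ↔ ∀ j, height i z = height j z := by
  obtain ⟨v, x, y⟩ := z
  simp only [Prod.mk_eq_zero, Fin.forall_fin_succ, height]
  constructor
  · rintro ⟨rfl, rfl⟩
    fin_cases i <;> simp
  · fin_cases i <;> simp <;> intros <;> constructor <;> linarith

lemma exists_antitone (g : Fin 3 → ℝ) :
    ∃ i j k, i ≠ j ∧ i ≠ k ∧ j ≠ k ∧ g j ≤ g i ∧ g k ≤ g j := by
  rcases le_total (g 0) (g 1) with h₁ | h₁ <;> rcases le_total (g 0) (g 2) with h₂ | h₂ <;>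
    rcases le_total (g 1) (g 2) with h₃ | h₃
  · exact ⟨2, 1, 0, by decide, by decide, by decide, h₃, h₁⟩
  · exact ⟨1, 2, 0, by decide, by decide, by decide, h₃, h₂⟩
  · exact ⟨1, 0, 2, by decide, by decide, by decide, h₁, h₂⟩
  · exact ⟨1, 0, 2, by decide, by decide, by decide, h₁, h₂⟩
  · exact ⟨2, 0, 1, by decide, by decide, by decide, h₂, h₁⟩
  · exact ⟨2, 0, 1, by decide, by decide, by decide, h₂, h₁⟩
  · exact ⟨0, 2, 1, by decide, by decide, by decide, h₂, h₃⟩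
  · exact ⟨0, 1, 2, by decide, by decide, by decide, h₁, h₃⟩

variable [AddCommGroup V] [Module ℝ V] {n : ℕ}

lemma height_combo (i : Fin 3) (a b : ℝ) (x y : V × ℝ × ℝ) :
    height i (a • x + b • y) = a * height i x + b * height i y := by
  fin_cases i <;> simp [height]
  ring

variable (T : SeparatedTriple V n)

/-- The half-line on which `i` wins the tie against `j`. -/
def tieBreak (i j : Fin 3) : Set ℝ := if i < j then Iio 1 else Ioi 1

lemma convex_tieBreak (i j : Fin 3) : Convex ℝ (tieBreak i j) := by
  unfold tieBreak
  split_ifs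
  exacts [convex_Iio _, convex_Ioi _]

lemma openSegment_subset_tieBreak (i j : Fin 3) {x : ℝ} (hx : x ∈ tieBreak i j) :
    openSegment ℝ 1 x ⊆ tieBreak i j := by
  rintro _ ⟨a, b, ha, hb, hab, rfl⟩
  unfold tieBreak at *
  split_ifs at * <;> simp at * <;> nlinarith

lemma mem_tieBreak_or {i j : Fin 3} (hij : i ≠ j) (x : ℝ) :
    x ∈ tieBreak i j ∨ x ∈ tieBreak j i ↔ x ≠ 1 := by
  rcases lt_or_gt_of_ne hij with h | h <;> simp [tieBreak, h, h.not_gt, lt_or_lt_iff_ne, eq_comm]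

/-- The part of the hyperplane `height i = height j` given to `i`. -/
def wall (i j : Fin 3) : Set (V × ℝ) :=
  {w | w.1 ∈ T.B i j ∨ w.1 = T.p i j ∧ w.2 ∈ tieBreak i j}

lemma convex_wall {i j : Fin 3} (hij : i ≠ j) : Convex ℝ (T.wall i j) := by
  rw [convex_iff_forall_pos]
  rintro x hx y hy a b ha hb hab
  rcases hx with hx | ⟨hx, hx'⟩ <;> rcases hy with hy | ⟨hy, hy'⟩
  · exact .inl (T.convex_B i j hij hx hy ha.le hb.le hab)
  · exact .inl (T.openSegment_subset i j hij _ hx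
      ⟨b, a, hb, ha, by linarith, by simp [hy, add_comm]⟩)
  · exact .inl (T.openSegment_subset i j hij _ hy ⟨a, b, ha, hb, hab, by simp [hx]⟩)
  · exact .inr ⟨by simp [hx, hy, ← add_smul, hab], convex_tieBreak i j hx' hy' ha.le hb.le hab⟩

lemma openSegment_subset_wall {i j : Fin 3} (hij : i ≠ j) {x : V × ℝ} (hx : x ∈ T.wall i j) :
    openSegment ℝ (T.p i j, 1) x ⊆ T.wall i j := by
  rintro _ ⟨a, b, ha, hb, hab, rfl⟩
  rcases hx with hx | ⟨hx, hx'⟩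
  · exact .inl (T.openSegment_subset i j hij _ hx ⟨a, b, ha, hb, hab, by simp⟩)
  · exact .inr ⟨by simp [hx, ← add_smul, hab],
      openSegment_subset_tieBreak i j hx' ⟨a, b, ha, hb, hab, by simp⟩⟩

lemma mem_wall_or {i j : Fin 3} (hij : i ≠ j) (w : V × ℝ) :
    w ∈ T.wall i j ∨ w ∈ T.wall j i ↔ w ≠ (T.p i j, 1) := by
  have h : w.1 ∈ T.B i j ∨ w.1 ∈ T.B j i ↔ w.1 ≠ T.p i j := by
    rw [← mem_union, T.union_eq i j hij]; rfl
  have h' := mem_tieBreak_or hij w.2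
  simp only [wall, mem_ofPred_eq, T.p_symm j i, ne_eq, Prod.ext_iff]
  tauto

/-- The half of `V × ℝ × ℝ` in which `i` dominates `j`. -/
def half (i j : Fin 3) : Set (V × ℝ × ℝ) :=
  {z | height j z < height i z ∨ height i z = height j z ∧ (z.1, height i z) ∈ T.wall i j}

/-- The point missed by the two halves of index `i` and `j`. -/
def tiePoint (i j : Fin 3) : V × ℝ × ℝ :=
  (T.p i j, if 0 = i ∨ 0 = j then 1 else -2, if 1 = i ∨ 1 = j then 1 else -2)

lemma tiePoint_symm (i j : Fin 3) : T.tiePoint i j = T.tiePoint j i := by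
  simp [tiePoint, T.p_symm i j, or_comm]

lemma height_tiePoint_left {i j : Fin 3} (hij : i ≠ j) : height i (T.tiePoint i j) = 1 := by
  fin_cases i <;> fin_cases j <;> simp [height, tiePoint] at hij ⊢ <;> norm_num

lemma height_tiePoint_right {i j : Fin 3} (hij : i ≠ j) : height j (T.tiePoint i j) = 1 := by
  rw [tiePoint_symm, height_tiePoint_left T hij.symm]

lemma eq_tiePoint_iff {i j : Fin 3} (hij : i ≠ j) (z : V × ℝ × ℝ) :
    z = T.tiePoint i j ↔ z.1 = T.p i j ∧ height i z = 1 ∧ height j z = 1 := by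
  constructor
  · rintro rfl
    exact ⟨rfl, T.height_tiePoint_left hij, T.height_tiePoint_right hij⟩
  · rintro ⟨h, hi, hj⟩
    exact height_ext hij h (hi.trans (T.height_tiePoint_left hij).symm)
      (hj.trans (T.height_tiePoint_right hij).symm)

lemma convex_half {i j : Fin 3} (hij : i ≠ j) : Convex ℝ (T.half i j) := by
  rw [convex_iff_forall_pos]
  rintro x hx y hy a b ha hb hab
  simp only [half, mem_ofPred_eq, height_combo] at *
  rcases hx with hx | ⟨hx, hx'⟩ <;> rcases hy with hy | ⟨hy, hy'⟩
  · left; nlinarith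
  · left; nlinarith
  · left; nlinarith
  · exact .inr ⟨by rw [hx, hy], T.convex_wall hij hx' hy' ha.le hb.le hab⟩

lemma openSegment_subset_half {i j : Fin 3} (hij : i ≠ j) {x : V × ℝ × ℝ} (hx : x ∈ T.half i j) :
    openSegment ℝ (T.tiePoint i j) x ⊆ T.half i j := by
  rintro _ ⟨a, b, ha, hb, hab, rfl⟩
  simp only [half, mem_ofPred_eq, height_combo, T.height_tiePoint_left hij,
    T.height_tiePoint_right hij] at *
  rcases hx with hx | ⟨hx, hx'⟩
  · left; nlinarith
  · exact .inr ⟨by rw [hx], T.openSegment_subset_wall hij hx' ⟨a, b, ha, hb, hab, rfl⟩⟩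

lemma half_union {i j : Fin 3} (hij : i ≠ j) :
    T.half i j ∪ T.half j i = {T.tiePoint i j}ᶜ := by
  ext z
  have h := T.mem_wall_or hij (z.1, height i z)
  simp only [mem_union, half, mem_ofPred_eq, mem_compl_iff, mem_singleton_iff,
    T.eq_tiePoint_iff hij, ne_eq, Prod.ext_iff] at h ⊢
  rcases lt_trichotomy (height i z) (height j z) with h' | h' | h'
  · simp only [h', true_or, or_true, true_iff]
    rintro ⟨-, hi, hj⟩
    linarith
  · simp only [h', lt_irrefl, true_and, false_or, and_self] at h ⊢
    exact h
  · simp only [h', true_or, true_iff]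
    rintro ⟨-, hi, hj⟩
    linarith

/-- The three convex sets in `V × ℝ × ℝ`. -/
def wedge (i : Fin 3) : Set (V × ℝ × ℝ) :=
  {z | (∀ j, i ≠ j → z ∈ T.half i j) ∧ (z.2 = 0 → z.1 ∈ T.K i)}

lemma le_of_mem_half {i j : Fin 3} {z : V × ℝ × ℝ} (hz : z ∈ T.half i j) :
    height j z ≤ height i z := by
  rcases hz with h | h
  exacts [h.le, h.1.ge]

lemma convex_wedge (i : Fin 3) : Convex ℝ (T.wedge i) := by
  rw [convex_iff_forall_pos]
  rintro x hx y hy a b ha hb hab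
  refine ⟨fun j hij => T.convex_half hij (hx.1 j hij) (hy.1 j hij) ha.le hb.le hab, fun h => ?_⟩
  rw [snd_eq_zero_iff _ i] at h
  have key : ∀ j, height i x = height j x ∧ height i y = height j y := by
    intro j
    by_cases hij : i = j
    · simp [hij]
    have h₁ := T.le_of_mem_half (hx.1 j hij)
    have h₂ := T.le_of_mem_half (hy.1 j hij)
    have h₃ := h j
    rw [height_combo, height_combo] at h₃
    constructor <;> nlinarith
  exact T.convex_K i (hx.2 ((snd_eq_zero_iff x i).2 fun j => (key j).1))
    (hy.2 ((snd_eq_zero_iff y i).2 fun j => (key j).2)) ha.le hb.le hab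

lemma mk_zero_mem_wedge_iff (v : V) (i : Fin 3) : (v, 0) ∈ T.wedge i ↔ v ∈ T.K i := by
  refine ⟨fun h => h.2 rfl, fun h => ⟨fun j hij => .inr ⟨?_, .inl (T.subset_B i j hij h)⟩,
    fun _ => h⟩⟩
  exact (snd_eq_zero_iff (v, 0) i).1 rfl j

lemma tiePoint_notMem_half {i j : Fin 3} (hij : i ≠ j) : T.tiePoint i j ∉ T.half i j := by
  intro h
  have : T.tiePoint i j ∈ T.half i j ∪ T.half j i := .inl h
  rw [T.half_union hij] at this
  exact this rfl

lemma tiePoint_notMem_wedge {i j : Fin 3} (hij : i ≠ j) (k : Fin 3) :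
    T.tiePoint i j ∉ T.wedge k := by
  intro h
  rcases eq_or_ne k i with rfl | hki
  · exact T.tiePoint_notMem_half hij (h.1 j hij)
  rcases eq_or_ne k j with rfl | hkj
  · rw [tiePoint_symm] at h
    exact T.tiePoint_notMem_half hij.symm (h.1 i hij.symm)
  have h₁ := T.le_of_mem_half (h.1 i hki)
  have h₂ := height_sum hij hki.symm hkj.symm (T.tiePoint i j)
  rw [T.height_tiePoint_left hij] at h₁ h₂
  rw [T.height_tiePoint_right hij] at h₂
  linarith

lemma compl_iUnion_wedge :
    (⋃ i, T.wedge i)ᶜ = (fun v => (v, 0)) '' (⋃ i, T.K i)ᶜ ∪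
      {T.tiePoint 0 1, T.tiePoint 0 2, T.tiePoint 1 2} := by
  apply Subset.antisymm
  · intro z hz
    simp only [mem_compl_iff, mem_iUnion, not_exists] at hz
    by_cases h0 : z.2 = 0
    · obtain ⟨v, w⟩ := z
      obtain rfl : w = 0 := h0
      refine .inl ⟨v, ?_, rfl⟩
      simpa [T.mk_zero_mem_wedge_iff] using hz
    right
    obtain ⟨i, j, k, hij, hik, hjk, h₁, h₂⟩ := exists_antitone (fun i => height i z)
    have hcover : ∀ l, l = i ∨ l = j ∨ l = k := by
      clear * - hij hik hjk
      decide +revert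
    have hki : height k z < height i z := by
      refine (h₂.trans h₁).lt_of_ne fun h => h0 ((snd_eq_zero_iff z i).2 fun l => ?_)
      rcases hcover l with rfl | rfl | rfl <;> linarith
    rcases h₁.lt_or_eq with h₁ | h₁
    · refine (hz i ⟨fun l hl => ?_, fun h => (h0 h).elim⟩).elim
      rcases hcover l with rfl | rfl | rfl
      exacts [(hl rfl).elim, .inl h₁, .inl hki]
    by_cases hq : z = T.tiePoint i j
    · have hsymm := T.tiePoint_symm
      subst hq
      clear * - hij hsymm
      fin_cases i <;> fin_cases j <;> simp at hij ⊢ <;> simp [hsymm 1 0, hsymm 2 0, hsymm 2 1]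
    have hz' : z ∈ T.half i j ∪ T.half j i := by
      rw [T.half_union hij]
      exact hq
    rcases hz' with h | h
    · refine (hz i ⟨fun l hl => ?_, fun h => (h0 h).elim⟩).elim
      rcases hcover l with rfl | rfl | rfl
      exacts [(hl rfl).elim, h, .inl hki]
    · refine (hz j ⟨fun l hl => ?_, fun h => (h0 h).elim⟩).elim
      rcases hcover l with rfl | rfl | rfl
      exacts [h, (hl rfl).elim, .inl (hki.trans_eq h₁.symm)]
  · rintro z (⟨v, hv, rfl⟩ | hz)
    · simpa [T.mk_zero_mem_wedge_iff] using hv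
    · simp only [mem_compl_iff, mem_iUnion, not_exists]
      rcases hz with rfl | rfl | rfl
      all_goals exact T.tiePoint_notMem_wedge (by decide)

lemma finite_compl_iUnion_wedge : (⋃ i, T.wedge i)ᶜ.Finite := by
  rw [compl_iUnion_wedge]
  exact (T.finite_compl.image _).union (toFinite _)

lemma ncard_compl_iUnion_wedge : (⋃ i, T.wedge i)ᶜ.ncard = n + 3 := by
  have hne : T.tiePoint 0 1 ≠ T.tiePoint 0 2 ∧ T.tiePoint 0 1 ≠ T.tiePoint 1 2 ∧
      T.tiePoint 0 2 ≠ T.tiePoint 1 2 := by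
    refine ⟨?_, ?_, ?_⟩ <;> simp [tiePoint, Fin.ext_iff] <;> norm_num
  rw [compl_iUnion_wedge, ncard_union_eq ?_ (T.finite_compl.image _) (toFinite _),
    ncard_image_of_injective _ (Prod.mk_left_injective _), T.ncard_compl,
    ncard_eq_three.2 ⟨_, _, _, hne.1, hne.2.1, hne.2.2, rfl⟩]
  rw [disjoint_left]
  rintro _ ⟨v, -, rfl⟩ h
  simp [tiePoint, Prod.ext_iff] at h

/-- Adding two dimensions allows for three more missing points. -/
def addTwoDim : SeparatedTriple (V × ℝ × ℝ) (n + 3) where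
  K := T.wedge
  B := T.half
  p := T.tiePoint
  convex_K := T.convex_wedge
  finite_compl := T.finite_compl_iUnion_wedge
  ncard_compl := T.ncard_compl_iUnion_wedge
  subset_B _ j hij _ hz := hz.1 j hij
  convex_B _ _ hij := T.convex_half hij
  openSegment_subset _ _ hij _ hx := T.openSegment_subset_half hij hx
  p_symm := T.tiePoint_symm
  union_eq _ _ hij := T.half_union hij

end Step

theorem nonempty_fin_fun (d : ℕ) : Nonempty (SeparatedTriple (Fin d → ℝ) (3 * d / 2 + 1)) := by
  induction d using Nat.twoStepInduction with
  | zero => exact ⟨zeroDim⟩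
  | one => exact ⟨oneDim.map (LinearEquiv.funUnique (Fin 1) ℝ ℝ)⟩
  | more d ih _ =>
    obtain ⟨T⟩ := ih
    rw [show 3 * (d + 2) / 2 + 1 = 3 * d / 2 + 1 + 3 by lia]
    exact ⟨T.addTwoDim.map (LinearEquiv.ofFinrankEq _ _ (by simp))⟩

end SeparatedTriple

/-- If the complement of a set is finite, it consists exactly of the encapsulated points. -/
theorem setOf_encapsulated_eq_compl {X : Type*} [MetricSpace X] {U : Set X} (hU : Uᶜ.Finite) :
    {p | ∃ ε > 0, ball p ε \ U = {p}} = Uᶜ := by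
  ext p
  constructor
  · rintro ⟨ε, -, h⟩
    exact (h.symm ▸ mem_singleton p : p ∈ ball p ε \ U).2
  · intro hp
    have hmem : (Uᶜ \ {p})ᶜ ∈ nhds p := (hU.sdiff.isClosed.isOpen_compl).mem_nhds (by simp)
    obtain ⟨ε, hε, h⟩ := Metric.mem_nhds_iff.1 hmem
    refine ⟨ε, hε, Subset.antisymm (fun x hx => ?_) ?_⟩
    · by_contra hxp
      exact h hx.1 ⟨hx.2, hxp⟩
    · rintro _ rfl
      exact ⟨mem_ball_self hε, hp⟩

/-- For every `d` there exist three convex sets in `ℝ^d` whose set `S` of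
encapsulated points has exactly `⌊3d/2⌋ + 1` elements, and moreover the whole
complement of their union equals `S`. -/
theorem exists_three_convex_encapsulated_card_eq (d : ℕ) :
    ∃ K₁ K₂ K₃ : Set (EuclideanSpace ℝ (Fin d)),
      Convex ℝ K₁ ∧ Convex ℝ K₂ ∧ Convex ℝ K₃ ∧
      ({p | ∃ ε > 0, ball p ε \ (K₁ ∪ K₂ ∪ K₃) = {p}} :
        Set (EuclideanSpace ℝ (Fin d))).Finite ∧
      ({p | ∃ ε > 0, ball p ε \ (K₁ ∪ K₂ ∪ K₃) = {p}} :
        Set (EuclideanSpace ℝ (Fin d))).ncard = 3 * d / 2 + 1 ∧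
      (K₁ ∪ K₂ ∪ K₃)ᶜ =
        ({p | ∃ ε > 0, ball p ε \ (K₁ ∪ K₂ ∪ K₃) = {p}} :
          Set (EuclideanSpace ℝ (Fin d))) := by
  obtain ⟨T⟩ := SeparatedTriple.nonempty_fin_fun d
  let T' := T.map (WithLp.linearEquiv 2 ℝ (Fin d → ℝ))
  have hU : (⋃ i, T'.K i) = T'.K 0 ∪ T'.K 1 ∪ T'.K 2 := by
    ext x
    simp [Fin.exists_fin_succ, or_assoc]
  have hfin := T'.finite_compl
  have hcard := T'.ncard_compl
  rw [hU] at hfin hcard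
  refine ⟨T'.K 0, T'.K 1, T'.K 2, T'.convex_K 0, T'.convex_K 1, T'.convex_K 2, ?_⟩
  rw [setOf_encapsulated_eq_compl hfin]
  exact ⟨hfin, hcard, rfl⟩
end

section
/- Let d ≥ 2 and n ≥ 4 be natural numbers, and let K₁, …, Kₙ ⊆ ℝ^d be convex sets. Then the set of points of ℝ^d encapsulated by K₁, …, Kₙ has at most 2 · d^{n−2} · n! elements. -/
open Metric Set

open Module Filter Topology

section Encapsulation

variable {ι E : Type*} [NormedAddCommGroup E]

/-- The points encapsulated by the sets `K i`, `i ∈ s`. -/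
def encapsulatedPoints (K : ι → Set E) (s : Finset ι) : Set E :=
  {p | (∀ i ∈ s, p ∉ K i) ∧ ∀ᶠ x in 𝓝[≠] p, ∃ i ∈ s, x ∈ K i}

theorem mem_encapsulatedPoints_iff_ball {K : ι → Set E} {s : Finset ι} {p : E} :
    p ∈ encapsulatedPoints K s ↔ ∃ ε > 0, ball p ε \ (⋃ i ∈ s, K i) = {p} := by
  simp only [encapsulatedPoints, mem_ofPred_eq, eventually_nhdsWithin_iff, eventually_nhds_iff_ball]
  constructor
  · rintro ⟨hp, ε, hε, h⟩
    refine ⟨ε, hε, Set.ext fun x => ?_⟩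
    simp only [Set.mem_sdiff, mem_iUnion, mem_singleton_iff, exists_prop]
    refine ⟨fun hx => by_contra fun hne => hx.2 (h x hx.1 hne), ?_⟩
    rintro rfl
    exact ⟨mem_ball_self hε, fun ⟨i, hi, hx⟩ => hp i hi hx⟩
  · rintro ⟨ε, hε, h⟩
    have hmem : p ∈ ball p ε \ (⋃ i ∈ s, K i) := h ▸ mem_singleton p
    refine ⟨fun i hi hpi => hmem.2 (mem_biUnion hi hpi), ε, hε, fun x hx hne => ?_⟩
    by_contra hcon
    refine hne ((h ▸ ⟨hx, ?_⟩ : x ∈ ({p} : Set E)))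
    simpa using hcon

theorem mem_encapsulatedPoints_erase [DecidableEq ι] {K : ι → Set E} {s : Finset ι} {p : E}
    (hp : p ∈ encapsulatedPoints K s) {i : ι} (hi : p ∉ closure (K i)) :
    p ∈ encapsulatedPoints K (s.erase i) := by
  refine ⟨fun j hj => hp.1 j (Finset.mem_of_mem_erase hj), ?_⟩
  have hnhds : ∀ᶠ x in 𝓝[≠] p, x ∉ closure (K i) :=
    nhdsWithin_le_nhds (isClosed_closure.isOpen_compl.mem_nhds hi)
  filter_upwards [hp.2, hnhds] with x ⟨j, hj, hx⟩ hxi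
  refine ⟨j, Finset.mem_erase.2 ⟨?_, hj⟩, hx⟩
  rintro rfl
  exact hxi (subset_closure hx)

variable [NormedSpace ℝ E]

theorem tendsto_add_smul_punctured_nhds (p : E) {v : E} (hv : v ≠ 0) :
    Tendsto (fun t : ℝ => p + t • v) (𝓝[>] 0) (𝓝[≠] p) := by
  refine tendsto_nhdsWithin_iff.2 ⟨?_, ?_⟩
  · have : Tendsto (fun t : ℝ => p + t • v) (𝓝 0) (𝓝 (p + (0 : ℝ) • v)) :=
      Continuous.tendsto (by fun_prop) 0
    simpa using this.mono_left nhdsWithin_le_nhds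
  · filter_upwards [self_mem_nhdsWithin] with t ht
    simpa [hv] using (ne_of_gt ht : t ≠ 0)

theorem encapsulatedPoints_eq_empty_of_card_le_one [Nontrivial E] {K : ι → Set E} {s : Finset ι}
    (hK : ∀ i ∈ s, Convex ℝ (K i)) (hs : s.card ≤ 1) : encapsulatedPoints K s = ∅ := by
  refine eq_empty_of_forall_notMem fun p ⟨hp, h⟩ => ?_
  obtain ⟨v, hv⟩ := exists_ne (0 : E)
  obtain ⟨t, ⟨i, hi, hti⟩, j, hj, htj⟩ :=
    (((tendsto_add_smul_punctured_nhds p hv).eventually h).and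
      ((tendsto_add_smul_punctured_nhds p (neg_ne_zero.2 hv)).eventually h)).exists
  obtain rfl := Finset.card_le_one.1 hs i hi j hj
  refine hp i hi ?_
  convert (hK i hi) hti htj (by norm_num : (0 : ℝ) ≤ 1 / 2) (by norm_num : (0 : ℝ) ≤ 1 / 2)
    (by norm_num) using 1
  module

theorem Convex.exists_dual_ne_zero_forall_le [FiniteDimensional ℝ E] [Nontrivial E] {A : Set E}
    (hA : Convex ℝ A) {x : E} (hx : x ∉ A) :
    ∃ f : StrongDual ℝ E, f ≠ 0 ∧ ∀ a ∈ A, f a ≤ f x := by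
  by_cases hint : (interior A).Nonempty
  · exact geometric_hahn_banach_of_nonempty_interior_point hA (fun h => hx (interior_subset h)) hint
  obtain rfl | ⟨a, ha⟩ := A.eq_empty_or_nonempty
  · obtain ⟨v, hv⟩ := exists_ne (0 : E)
    obtain ⟨f, -, hf⟩ := exists_dual_vector ℝ v (norm_ne_zero_iff.2 hv)
    refine ⟨f, ?_, by simp⟩
    rintro rfl
    simp [eq_comm, hv] at hf
  have hlt : vectorSpan ℝ A < ⊤ := by
    rw [lt_top_iff_ne_top]
    rwa [hA.interior_nonempty_iff_affineSpan_eq_top,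
      AffineSubspace.affineSpan_eq_top_iff_vectorSpan_eq_top_of_nonempty _ _ _ ⟨a, ha⟩] at hint
  obtain ⟨f, hf, hker⟩ := Submodule.exists_le_ker_of_lt_top _ hlt
  have hconst : ∀ b ∈ A, f b = f a := fun b hb => by
    have := hker (vsub_mem_vectorSpan ℝ hb ha)
    simpa [sub_eq_zero] using this
  have hf' : LinearMap.toContinuousLinearMap f ≠ 0 := by simpa using hf
  rcases le_total (f a) (f x) with h | h
  · exact ⟨LinearMap.toContinuousLinearMap f, hf', fun b hb => by simpa [hconst b hb] using h⟩
  · exact ⟨-LinearMap.toContinuousLinearMap f, neg_ne_zero.2 hf',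
      fun b hb => by simpa [hconst b hb] using h⟩

/-- The encapsulated points that are adherent to every one of the sets lie on a common
hyperplane. -/
theorem exists_dual_ne_zero_forall_apply_eq [FiniteDimensional ℝ E] [Nontrivial E]
    {K : ι → Set E} {s : Finset ι} (hs : s.Nonempty) (hK : ∀ i ∈ s, Convex ℝ (K i)) {p : E}
    (hp : p ∈ encapsulatedPoints K s) :
    ∃ f : StrongDual ℝ E, f ≠ 0 ∧ ∀ q, (∀ i ∈ s, q ∈ closure (K i)) → f q = f p := by
  have hsep : ∀ i, ∃ f : StrongDual ℝ E, i ∈ s → f ≠ 0 ∧ ∀ a ∈ K i, f a ≤ f p := fun i => by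
    by_cases hi : i ∈ s
    · obtain ⟨f, hf⟩ := (hK i hi).exists_dual_ne_zero_forall_le (hp.1 i hi)
      exact ⟨f, fun _ => hf⟩
    · exact ⟨0, fun h => absurd h hi⟩
  choose f hf using hsep
  have hcl : ∀ q, (∀ i ∈ s, q ∈ closure (K i)) → ∀ i ∈ s, f i q ≤ f i p := fun q hq i hi =>
    closure_minimal (hf i hi).2 (isClosed_le (f i).continuous continuous_const) (hq i hi)
  by_contra! hcon
  have hex : ∀ i, ∃ q, i ∈ s → (∀ j ∈ s, q ∈ closure (K j)) ∧ f i q ≠ f i p := fun i => by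
    by_cases hi : i ∈ s
    · obtain ⟨q, hq⟩ := hcon (f i) (hf i hi).1
      exact ⟨q, fun _ => hq⟩
    · exact ⟨0, fun h => absurd h hi⟩
  choose q hq using hex
  set v : E := ∑ j ∈ s, (p - q j) with hv
  have hpos : ∀ i ∈ s, 0 < f i v := fun i hi => by
    rw [hv, map_sum]
    refine Finset.sum_pos' (fun j hj => ?_) ⟨i, hi, ?_⟩
    · simpa using hcl _ (hq j hj).1 i hi
    · simpa using lt_of_le_of_ne (hcl _ (hq i hi).1 i hi) (hq i hi).2
  obtain ⟨i₀, hi₀⟩ := hs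
  have hv0 : v ≠ 0 := fun h => by simpa [h] using hpos i₀ hi₀
  obtain ⟨t, ⟨i, hi, hti⟩, ht⟩ :=
    (((tendsto_add_smul_punctured_nhds p hv0).eventually hp.2).and self_mem_nhdsWithin).exists
  have := (hf i hi).2 _ hti
  have := mul_pos (mem_Ioi.1 ht) (hpos i hi)
  simp only [map_add, map_smul, smul_eq_mul] at *
  linarith

theorem mem_encapsulatedPoints_preimage_add {K : ι → Set E} {s : Finset ι} (W : Submodule ℝ E)
    (p : E) {w : W} (hw : p + (w : E) ∈ encapsulatedPoints K s) :
    w ∈ encapsulatedPoints (fun i => (fun w : W => p + (w : E)) ⁻¹' K i) s := by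
  refine ⟨hw.1, ?_⟩
  have : Tendsto (fun w : W => p + (w : E)) (𝓝[≠] w) (𝓝[≠] (p + (w : E))) := by
    refine tendsto_nhdsWithin_iff.2 ⟨?_, ?_⟩
    · exact (Continuous.tendsto (by fun_prop) w).mono_left nhdsWithin_le_nhds
    · filter_upwards [self_mem_nhdsWithin] with x hx
      simpa using hx
  exact this.eventually hw.2

/-- The recursive bound on the number of points of a `d`-dimensional space encapsulated by
`n` convex sets. -/
def encapsulationBound : ℕ → ℕ → ℕ
  | 0, _ => 1
  | _ + 1, 0 => 0
  | _ + 1, 1 => 0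
  | d + 1, n + 2 => (n + 2) * encapsulationBound (d + 1) (n + 1) + encapsulationBound d (n + 2)

theorem encapsulationBound_one_add_one_le (n : ℕ) :
    encapsulationBound 1 (n + 1) + 1 ≤ (n + 1).factorial := by
  induction n with
  | zero => simp [encapsulationBound]
  | succ n ih =>
    rw [Nat.factorial_succ]
    simp only [encapsulationBound]
    nlinarith

theorem encapsulationBound_le (d n : ℕ) :
    encapsulationBound (d + 1) (n + 2) ≤ 2 * (d + 1) ^ n * (n + 2).factorial := by
  induction d generalizing n with
  | zero =>
    have := encapsulationBound_one_add_one_le (n + 1)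
    simp only [zero_add, one_pow]
    lia
  | succ d ihd =>
    induction n with
    | zero =>
      have := ihd 0
      simpa [encapsulationBound] using this
    | succ n ihn =>
      have h := ihd (n + 1)
      have hpow : (d + 1) ^ n ≤ (d + 2) ^ n := Nat.pow_le_pow_left (by lia) n
      calc encapsulationBound (d + 2) (n + 3)
          = (n + 3) * encapsulationBound (d + 2) (n + 2) + encapsulationBound (d + 1) (n + 3) := by
            rw [encapsulationBound]
        _ ≤ (n + 3) * (2 * (d + 2) ^ n * (n + 2).factorial)
            + 2 * ((d + 2) ^ n * (d + 1)) * (n + 3).factorial := by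
            refine Nat.add_le_add (Nat.mul_le_mul_left _ ihn) (h.trans ?_)
            rw [pow_succ]
            gcongr
        _ = 2 * (d + 2) ^ (n + 1) * (n + 3).factorial := by
            rw [Nat.factorial_succ (n + 2)]
            ring

end Encapsulation

theorem encard_encapsulatedPoints_le (d : ℕ) {ι E : Type*} [NormedAddCommGroup E]
    [NormedSpace ℝ E] [FiniteDimensional ℝ E] (hE : finrank ℝ E = d) (K : ι → Set E)
    (hK : ∀ i, Convex ℝ (K i)) (s : Finset ι) :
    (encapsulatedPoints K s).encard ≤ encapsulationBound d s.card := by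
  classical
  induction d generalizing E s with
  | zero =>
    have := finrank_zero_iff.1 hE
    simpa [encapsulationBound] using encard_le_one_iff_subsingleton.2 subsingleton_of_subsingleton
  | succ d ihd =>
    have : Nontrivial E := nontrivial_of_finrank_eq_succ hE
    induction hn : s.card using Nat.strong_induction_on generalizing s with
    | _ n ihn =>
    match n, hn with
    | 0, hn | 1, hn =>
      simp [encapsulatedPoints_eq_empty_of_card_le_one (fun i _ => hK i) (by lia : s.card ≤ 1)]
    | n + 2, hn =>
      let T : Set E := {p ∈ encapsulatedPoints K s | ∀ i ∈ s, p ∈ closure (K i)}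
      have hsub : encapsulatedPoints K s ⊆ (⋃ i ∈ s, encapsulatedPoints K (s.erase i)) ∪ T := by
        intro p hp
        by_cases h : ∀ i ∈ s, p ∈ closure (K i)
        · exact Or.inr ⟨hp, h⟩
        · push Not at h
          obtain ⟨i, hi, hpi⟩ := h
          exact Or.inl (mem_biUnion hi (mem_encapsulatedPoints_erase hp hpi))
      have hTcard : T.encard ≤ encapsulationBound d (n + 2) := by
        obtain hempty | ⟨p, hp⟩ := T.eq_empty_or_nonempty
        · simp [hempty]
        obtain ⟨f, hf, hfp⟩ := exists_dual_ne_zero_forall_apply_eq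
          (Finset.card_pos.1 (by lia)) (fun i _ => hK i) hp.1
        let W : Submodule ℝ E := LinearMap.ker (f : E →ₗ[ℝ] ℝ)
        have hW : finrank ℝ W = d := by
          have hf' : (f : E →ₗ[ℝ] ℝ) ≠ 0 :=
            fun h => hf (ContinuousLinearMap.coe_injective h)
          have := Module.Dual.finrank_ker_add_one_of_ne_zero hf'
          exact Nat.succ_injective (this.trans hE)
        have hTimage : T ⊆ (fun w : W => p + (w : E)) ''
            encapsulatedPoints (fun i => (fun w : W => p + (w : E)) ⁻¹' K i) s := by
          intro q hq
          have hqW : q - p ∈ W := by simp [W, hfp q hq.2]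
          exact ⟨⟨q - p, hqW⟩, mem_encapsulatedPoints_preimage_add W p (by simpa using hq.1),
            by simp⟩
        have hconv (i : ι) : Convex ℝ ((fun w : W => p + (w : E)) ⁻¹' K i) :=
          ((hK i).translate_preimage_right p).linear_preimage W.subtype
        rw [← hn]
        exact (encard_le_encard hTimage).trans ((encard_image_le _ _).trans (ihd hW _ hconv s))
      have hsum : (⋃ i ∈ s, encapsulatedPoints K (s.erase i)).encard ≤
          ((n + 2) * encapsulationBound (d + 1) (n + 1) : ℕ) := by
        refine (Finset.set_encard_biUnion_le s _).trans ?_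
        refine (Finset.sum_le_card_nsmul s _ (encapsulationBound (d + 1) (n + 1) : ℕ∞)
          fun i hi => ?_).trans ?_
        · exact ihn (n + 1) (by lia) _ (by rw [Finset.card_erase_of_mem hi, hn]; rfl)
        · simp [hn]
      calc (encapsulatedPoints K s).encard
          ≤ _ := (encard_le_encard hsub).trans (encard_union_le _ _)
        _ ≤ _ := add_le_add hsum hTcard
        _ = _ := by simp [encapsulationBound]

/-- For `d ≥ 2`, `n ≥ 4`, the set of points of `ℝ^d` encapsulated by `n` convex
sets has at most `2 · d^(n-2) · n!` elements. -/
theorem encapsulated_card_le (d n : ℕ) (hd : 2 ≤ d) (hn : 4 ≤ n)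
    (K : Fin n → Set (EuclideanSpace ℝ (Fin d))) (hK : ∀ i, Convex ℝ (K i)) :
    ({p | ∃ ε > 0, ball p ε \ (⋃ i, K i) = {p}} :
      Set (EuclideanSpace ℝ (Fin d))).Finite ∧
    ({p | ∃ ε > 0, ball p ε \ (⋃ i, K i) = {p}} :
      Set (EuclideanSpace ℝ (Fin d))).ncard ≤ 2 * d ^ (n - 2) * n.factorial := by
  have heq : {p | ∃ ε > 0, ball p ε \ (⋃ i, K i) = {p}} =
      encapsulatedPoints K Finset.univ := by
    ext p
    simp [mem_encapsulatedPoints_iff_ball]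
  have hcard := encard_encapsulatedPoints_le d (by simp) K hK Finset.univ
  rw [Finset.card_univ, Fintype.card_fin] at hcard
  have hle : encapsulationBound d n ≤ 2 * d ^ (n - 2) * n.factorial := by
    obtain ⟨d, rfl⟩ := Nat.exists_eq_add_of_le' (one_le_two.trans hd)
    obtain ⟨n, rfl⟩ := Nat.exists_eq_add_of_le' (le_trans (by norm_num : 2 ≤ 4) hn)
    exact encapsulationBound_le d n
  rw [heq]
  exact ⟨finite_of_encard_le_coe hcard,
    (ENat.toNat_le_of_le_natCast hcard).trans hle⟩
end

section
/- For natural numbers d and n, let f(d, n) denote the supremum, over all choices of n convex sets K₁, …, Kₙ ⊆ ℝ^d, of the cardinality of the set of points encapsulated by K₁, …, Kₙ (this supremum is finite). Then for every n > 3 and d ≥ 2: f(d, n) ≤ Σ_{i=2}^{n−1} ( C(n, i) · f(d, i) ) + f(d−2, n), where C(n, i) denotes the binomial coefficient. -/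
open Metric Set

/-- `encapSup d n` is the supremum, over all choices of `n` convex sets
`K₁, …, Kₙ ⊆ ℝ^d`, of the (extended natural number) cardinality of the set of
points encapsulated by `K₁, …, Kₙ`. -/
noncomputable def encapSup (d n : ℕ) : ℕ∞ :=
  ⨆ K : {K : Fin n → Set (EuclideanSpace ℝ (Fin d)) // ∀ i, Convex ℝ (K i)},
    ({p | ∃ ε > 0, ball p ε \ (⋃ i, K.1 i) = {p}} :
      Set (EuclideanSpace ℝ (Fin d))).encard

open scoped Topology

/-- The family `K` encapsulates `p`: no member contains `p`, but together they cover a punctured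
neighbourhood of `p`. -/
def Encapsulates {V ι : Type*} [TopologicalSpace V] (K : ι → Set V) (p : V) : Prop :=
  (∀ i, p ∉ K i) ∧ ∀ᶠ x in 𝓝[≠] p, ∃ i, x ∈ K i

theorem encapsulates_iff_exists_ball {V ι : Type*} [PseudoMetricSpace V] {K : ι → Set V} {p : V} :
    Encapsulates K p ↔ ∃ ε > 0, ball p ε \ (⋃ i, K i) = {p} := by
  rw [Encapsulates, eventually_nhdsWithin_iff, Metric.eventually_nhds_iff_ball]
  constructor
  · rintro ⟨hp, ε, hε, h⟩
    refine ⟨ε, hε, Subset.antisymm (fun x hx => ?_) ?_⟩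
    · by_contra hne
      exact hx.2 (mem_iUnion.2 (h x hx.1 hne))
    · rintro x rfl
      exact ⟨mem_ball_self hε, by simpa using hp⟩
  · rintro ⟨ε, hε, h⟩
    have hp : p ∈ ball p ε \ (⋃ i, K i) := h ▸ mem_singleton p
    refine ⟨by simpa using hp.2, ε, hε, fun x hx hne => ?_⟩
    by_contra hc
    have : x ∈ ball p ε \ (⋃ i, K i) := ⟨hx, by simpa using hc⟩
    rw [h] at this
    exact hne this

theorem Encapsulates.preimage {V W ι : Type*} [TopologicalSpace V] [TopologicalSpace W]
    {K : ι → Set V} {f : W → V} (hf : Continuous f) (hinj : Function.Injective f) {w : W}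
    (h : Encapsulates K (f w)) : Encapsulates (fun i => f ⁻¹' K i) w :=
  ⟨h.1, (tendsto_nhdsWithin_of_tendsto_nhds_of_eventually_within f
    (hf.continuousAt.tendsto.mono_left nhdsWithin_le_nhds)
    (eventually_nhdsWithin_of_forall fun _ hx => hinj.ne hx)).eventually h.2⟩

theorem encard_le_encapSup {d : ℕ} {ι : Type*} [Fintype ι]
    {K : ι → Set (EuclideanSpace ℝ (Fin d))} (hK : ∀ i, Convex ℝ (K i)) :
    {p | Encapsulates K p}.encard ≤ encapSup d (Fintype.card ι) := by
  let e := (Fintype.equivFin ι).symm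
  refine le_trans (encard_le_encard fun p hp => ?_)
    (le_iSup (fun K : {K : Fin (Fintype.card ι) → Set (EuclideanSpace ℝ (Fin d)) //
      ∀ i, Convex ℝ (K i)} => ({p | ∃ ε > 0, ball p ε \ (⋃ i, K.1 i) = {p}} :
      Set (EuclideanSpace ℝ (Fin d))).encard) ⟨fun i => K (e i), fun i => hK (e i)⟩)
  rw [mem_ofPred_eq, ← encapsulates_iff_exists_ball]
  exact ⟨fun i => hp.1 (e i), hp.2.mono fun x ⟨i, hi⟩ => ⟨e.symm i, by simpa using hi⟩⟩

theorem mem_closure_of_not_eventually {V ι : Type*} [TopologicalSpace V] {K : ι → Set V}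
    {I : Set ι} {p : V} {m : ι} (h : ∀ᶠ x in 𝓝[≠] p, ∃ i ∈ I, x ∈ K i)
    (hmin : ¬ ∀ᶠ x in 𝓝[≠] p, ∃ i ∈ I \ {m}, x ∈ K i) : p ∈ closure (K m) := by
  by_contra hp
  have hev : ∀ᶠ x in 𝓝[≠] p, x ∉ closure (K m) :=
    nhdsWithin_le_nhds (isClosed_closure.isOpen_compl.mem_nhds hp)
  refine hmin ((h.and hev).mono ?_)
  rintro x ⟨⟨i, hi, hx⟩, hxm⟩
  exact ⟨i, ⟨hi, fun him => hxm (subset_closure (him ▸ hx))⟩, hx⟩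

theorem Encapsulates.restrict {V ι : Type*} [TopologicalSpace V] {K : ι → Set V} {p : V}
    (h : Encapsulates K p) {I : Set ι} (hI : ∀ᶠ x in 𝓝[≠] p, ∃ i ∈ I, x ∈ K i) :
    Encapsulates (fun i : I => K i) p :=
  ⟨fun i => h.1 i, hI.mono fun _ ⟨i, hi, hx⟩ => ⟨⟨i, hi⟩, hx⟩⟩

theorem Encapsulates.exists_notMem {V ι : Type*} [NormedAddCommGroup V] [NormedSpace ℝ V]
    [Nontrivial V] {K : ι → Set V} (hK : ∀ i, Convex ℝ (K i)) {p : V}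
    (h : Encapsulates K p) (c : V) : ∃ i, c ∉ K i := by
  by_contra! hc
  have hcp : c ≠ p := by
    rintro rfl
    obtain ⟨x, i, -⟩ := h.2.exists
    exact h.1 i (hc i)
  let f : ℝ → V := fun t => AffineMap.lineMap p c t
  have hf : Filter.Tendsto f (𝓝[<] 0) (𝓝[≠] p) := by
    apply tendsto_nhdsWithin_of_tendsto_nhds_of_eventually_within
    · have hcont : Continuous f := AffineMap.lineMap_continuous
      have := hcont.tendsto 0
      simp only [f, AffineMap.lineMap_apply_zero] at this
      exact this.mono_left nhdsWithin_le_nhds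
    · refine eventually_nhdsWithin_of_forall fun t ht => ?_
      simp only [f, mem_compl_iff, mem_singleton_iff, AffineMap.lineMap_eq_left_iff, not_or]
      exact ⟨hcp.symm, ne_of_lt ht⟩
  obtain ⟨t, ⟨i, hi⟩, ht⟩ := ((hf.eventually h.2).and self_mem_nhdsWithin).exists
  have ht0 : t < 0 := ht
  refine h.1 i ?_
  have hpos : 0 < 1 - t := by linarith
  have key := hK i hi (hc i) (a := 1 / (1 - t)) (b := -t / (1 - t)) (by positivity)
    (div_nonneg (by linarith) hpos.le) (by field_simp; ring)
  convert key using 1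
  simp only [f, AffineMap.lineMap_apply_module, smul_add, smul_smul, add_assoc, ← add_smul]
  rw [one_div_mul_cancel hpos.ne', show 1 / (1 - t) * t + -t / (1 - t) = 0 by ring]
  simp

section NormedSpace

variable {V ι : Type*} [NormedAddCommGroup V] [NormedSpace ℝ V] [FiniteDimensional ℝ V]
  {K : ι → Set V}

theorem encard_le_encapSup_of_subset_affineSubspace [Fintype ι] (hK : ∀ i, Convex ℝ (K i))
    {X : Set V} (hX : ∀ p ∈ X, Encapsulates K p) {A : AffineSubspace ℝ V} (hXA : X ⊆ A)
    (hA : (A : Set V).Nonempty) :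
    X.encard ≤ encapSup (Module.finrank ℝ A.direction) (Fintype.card ι) := by
  obtain ⟨p₀, hp₀⟩ := hA
  have e : EuclideanSpace ℝ (Fin (Module.finrank ℝ A.direction)) ≃L[ℝ] A.direction :=
    ContinuousLinearEquiv.ofFinrankEq (by simp)
  let L := A.direction.subtype.comp e.toLinearEquiv.toLinearMap
  let φ : EuclideanSpace ℝ (Fin (Module.finrank ℝ A.direction)) →ᵃ[ℝ] V :=
    L.toAffineMap + AffineMap.const ℝ _ p₀
  have hφ : ∀ w, φ w = (e w : V) + p₀ := fun w => rfl
  have hcont : Continuous φ := φ.continuous_of_finiteDimensional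
  have hinj : Function.Injective φ := fun v w h => by
    rw [hφ, hφ] at h
    exact e.injective (Subtype.ext (add_right_cancel h))
  have hsub : X ⊆ φ '' {w | Encapsulates (fun i => φ ⁻¹' K i) w} := fun p hp => by
    have hv : p -ᵥ p₀ ∈ A.direction := AffineSubspace.vsub_mem_direction (hXA hp) hp₀
    have hw : φ (e.symm ⟨p -ᵥ p₀, hv⟩) = p := by simp [hφ]
    exact ⟨_, Encapsulates.preimage hcont hinj (hw.symm ▸ hX p hp :), hw⟩
  calc X.encard ≤ _ := encard_le_encard hsub
    _ = _ := hinj.encard_image _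
    _ ≤ _ := encard_le_encapSup fun i => (hK i).affine_preimage φ

theorem encard_setOf_encapsulates_le [Fintype ι] (hK : ∀ i, Convex ℝ (K i)) :
    {p | Encapsulates K p}.encard ≤ encapSup (Module.finrank ℝ V) (Fintype.card ι) := by
  have := encard_le_encapSup_of_subset_affineSubspace hK (X := {p | Encapsulates K p})
    (fun _ h => h) (A := ⊤) (by simp) ⟨0, trivial⟩
  rwa [AffineSubspace.direction_top, finrank_top] at this

theorem mem_of_mem_interior_closure {s : Set V} (hs : Convex ℝ s) {c : V}
    (hc : c ∈ interior (closure s)) : c ∈ s := by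
  have hne : (interior s).Nonempty := by
    rw [hs.interior_nonempty_iff_affineSpan_eq_top]
    have htop := (hs.closure.interior_nonempty_iff_affineSpan_eq_top).1 ⟨c, hc⟩
    rw [eq_top_iff, ← htop, affineSpan_le]
    exact closure_minimal (subset_affineSpan ℝ s)
      (AffineSubspace.closed_of_finiteDimensional _)
  rw [hs.interior_closure_eq_interior_of_nonempty_interior hne] at hc
  exact interior_subset hc

/-- The closures of convex sets that jointly encapsulate a point have a common part that lies in a
proper flat. -/
theorem Encapsulates.affineSpan_ne_top [Nontrivial V] (hK : ∀ i, Convex ℝ (K i)) {p : V}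
    (h : Encapsulates K p) {D : Set V} (hD : ∀ i, D ⊆ closure (K i)) :
    affineSpan ℝ D ≠ ⊤ := by
  intro htop
  have hne : (interior (⋂ i, closure (K i))).Nonempty := by
    rw [(convex_iInter fun i => (hK i).closure).interior_nonempty_iff_affineSpan_eq_top,
      eq_top_iff, ← htop]
    exact affineSpan_mono ℝ (subset_iInter hD)
  obtain ⟨c, hc⟩ := hne
  obtain ⟨i, hi⟩ := h.exists_notMem hK c
  exact hi (mem_of_mem_interior_closure (hK i) (interior_mono (iInter_subset _ i) hc))

end NormedSpace

theorem encapSup_le_succ {n : ℕ} (hn : 2 ≤ n) (d : ℕ) : encapSup d n ≤ encapSup (d + 1) n := by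
  refine iSup_le fun ⟨K, hK⟩ => ?_
  let i₀ : Fin n := ⟨0, by omega⟩
  let i₁ : Fin n := ⟨1, by omega⟩
  have hi : i₀ ≠ i₁ := by simp [i₀, i₁]
  let K' : Fin n → Set (EuclideanSpace ℝ (Fin d) × ℝ) := fun i =>
    {x | (x.2 = 0 ∧ x.1 ∈ K i) ∨ (i = i₀ ∧ 0 < x.2) ∨ (i = i₁ ∧ x.2 < 0)}
  have hK' : ∀ i, Convex ℝ (K' i) := by
    intro i
    rw [convex_iff_forall_pos]
    rintro x (⟨hx, hxK⟩ | ⟨hxi, hx⟩ | ⟨hxi, hx⟩) y (⟨hy, hyK⟩ | ⟨hyi, hy⟩ | ⟨hyi, hy⟩) a b ha hb hab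
    · exact Or.inl ⟨by simp [hx, hy], hK i hxK hyK ha.le hb.le hab⟩
    · exact Or.inr (Or.inl ⟨hyi, by simp [hx]; positivity⟩)
    · exact Or.inr (Or.inr ⟨hyi, by simpa [hx] using mul_neg_of_pos_of_neg hb hy⟩)
    · exact Or.inr (Or.inl ⟨hxi, by simp [hy]; positivity⟩)
    · exact Or.inr (Or.inl ⟨hxi, by simp; positivity⟩)
    · exact absurd (hxi.symm.trans hyi) hi
    · exact Or.inr (Or.inr ⟨hxi, by simpa [hy] using mul_neg_of_pos_of_neg ha hx⟩)
    · exact absurd (hyi.symm.trans hxi) hi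
    · refine Or.inr (Or.inr ⟨hxi, ?_⟩)
      simpa using add_neg (mul_neg_of_pos_of_neg ha hx) (mul_neg_of_pos_of_neg hb hy)
  have hsub : (fun p : EuclideanSpace ℝ (Fin d) => (p, (0 : ℝ))) ''
      {p | ∃ ε > 0, ball p ε \ (⋃ i, K i) = {p}} ⊆ {p | Encapsulates K' p} := by
    rintro _ ⟨p, hp, rfl⟩
    rw [mem_ofPred_eq, ← encapsulates_iff_exists_ball] at hp
    refine ⟨fun i hpi => ?_, ?_⟩
    · simp only [K', mem_ofPred_eq, lt_irrefl, and_false, or_false, true_and] at hpi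
      exact hp.1 i hpi
    · have h := eventually_nhdsWithin_iff.1 hp.2
      rw [eventually_nhdsWithin_iff]
      filter_upwards [(continuous_fst.tendsto (p, (0 : ℝ))).eventually h] with x hx hxp
      rcases lt_trichotomy x.2 0 with h0 | h0 | h0
      · exact ⟨i₁, Or.inr (Or.inr ⟨rfl, h0⟩)⟩
      · obtain ⟨i, hi⟩ := hx fun hx1 => hxp (Prod.ext hx1 h0)
        exact ⟨i, Or.inl ⟨h0, hi⟩⟩
      · exact ⟨i₀, Or.inr (Or.inl ⟨rfl, h0⟩)⟩
  calc _ = _ := ((Prod.mk_left_injective (0 : ℝ)).encard_image _).symm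
    _ ≤ _ := encard_le_encard hsub
    _ ≤ _ := encard_setOf_encapsulates_le hK'
    _ = _ := by simp

theorem encapSup_mono {n : ℕ} (hn : 2 ≤ n) : Monotone fun d => encapSup d n :=
  monotone_nat_of_le_succ (encapSup_le_succ hn)

theorem encapSup_succ_le_max {n : ℕ} (hn : 2 ≤ n) (d : ℕ) :
    encapSup (d + 1) n ≤
      max (n * encapSup (d + 1) (n - 1) + encapSup (d - 1) n) (encapSup d n) := by
  refine iSup_le fun ⟨K, hK⟩ => ?_
  simp only [← encapsulates_iff_exists_ball]
  set X := {p | Encapsulates K p}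
  let Y : Fin n → Set (EuclideanSpace ℝ (Fin (d + 1))) := fun m =>
    {p | Encapsulates (fun i : ({m}ᶜ : Set (Fin n)) => K i) p}
  set S := X \ ⋃ m, Y m
  have hSX : S ⊆ X := sdiff_subset
  have hScl : ∀ i, S ⊆ closure (K i) := by
    rintro i p ⟨hp, hpY⟩
    refine mem_closure_of_not_eventually (I := univ) (by simpa using hp.2) fun h => hpY ?_
    rw [← compl_eq_univ_sdiff] at h
    exact mem_iUnion.2 ⟨i, hp.restrict h⟩
  have hspan : ∀ q ∈ X, affineSpan ℝ (insert q S) ≠ ⊤ := by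
    intro q hq
    obtain ⟨I, hI⟩ := (toFinite
      {I : Set (Fin n) | ∀ᶠ x in 𝓝[≠] q, ∃ i ∈ I, x ∈ K i}).exists_minimal
      ⟨univ, by simpa using hq.2⟩
    refine Encapsulates.affineSpan_ne_top (K := fun i : I => K i) (fun i => hK i)
      (hq.restrict hI.prop) fun i => ?_
    refine insert_subset (mem_closure_of_not_eventually hI.prop fun h => ?_) (hScl i)
    exact (hI.le_of_le h sdiff_subset i.2).2 rfl
  have hXle : X.encard ≤ n * encapSup (d + 1) (n - 1) + S.encard := by
    have hsub : X ⊆ (⋃ m, Y m) ∪ S := by simp [S]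
    refine (encard_le_encard hsub).trans ((encard_union_le _ _).trans (add_le_add_left ?_ _))
    refine (encard_iUnion_le_of_fintype Y).trans ?_
    refine (Finset.sum_le_card_nsmul _ _ (encapSup (d + 1) (n - 1)) fun m _ => ?_).trans ?_
    · have := encard_le_encapSup (K := fun i : ({m}ᶜ : Set (Fin n)) => K i) fun i => hK i
      rwa [Fintype.card_compl_set, Fintype.card_fin, card_singleton] at this
    · simp
  rcases S.eq_empty_or_nonempty with hSe | ⟨p, hp⟩
  · refine le_max_of_le_left (hXle.trans ?_)
    simp [hSe]
  set A := affineSpan ℝ S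
  have hAne : (A : Set (EuclideanSpace ℝ (Fin (d + 1)))).Nonempty := ⟨p, subset_affineSpan ℝ S hp⟩
  have hlt : ∀ B : AffineSubspace ℝ (EuclideanSpace ℝ (Fin (d + 1))), A ≤ B → B ≠ ⊤ →
      Module.finrank ℝ B.direction ≤ d := by
    intro B hAB hB
    have hne : B.direction ≠ ⊤ := by
      rwa [Ne, AffineSubspace.direction_eq_top_iff_of_nonempty (hAne.mono hAB)]
    have := Submodule.finrank_lt hne
    simpa [Nat.lt_succ_iff] using this
  have hAd : Module.finrank ℝ A.direction ≤ d :=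
    hlt A le_rfl (by simpa [insert_eq_of_mem hp] using hspan p (hSX hp))
  rcases hAd.eq_or_lt with hAd | hAd
  · refine le_max_of_le_right ?_
    have hXA : X ⊆ A := by
      intro q hq
      have hAB : A ≤ affineSpan ℝ (insert q S) := affineSpan_mono ℝ (subset_insert q S)
      have hdir := Submodule.eq_of_le_of_finrank_le (AffineSubspace.direction_le hAB)
        ((hlt _ hAB (hspan q hq)).trans hAd.ge)
      rw [AffineSubspace.eq_of_direction_eq_of_nonempty_of_le hdir hAne hAB]
      exact subset_affineSpan ℝ _ (mem_insert q S)
    have h := encard_le_encapSup_of_subset_affineSubspace hK (X := X) (fun _ h => h) hXA hAne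
    rwa [hAd, Fintype.card_fin] at h
  · refine le_max_of_le_left (hXle.trans (add_le_add_right ?_ _))
    have h := encard_le_encapSup_of_subset_affineSubspace hK (fun _ h => hSX h)
      (subset_affineSpan ℝ S) hAne
    rw [Fintype.card_fin] at h
    exact h.trans (encapSup_mono hn (Nat.le_sub_one_of_lt hAd))

theorem encapSup_le_sum_add {n : ℕ} (hn : 3 ≤ n) (d : ℕ) :
    encapSup d n ≤
      (∑ i ∈ Finset.Icc 2 (n - 1), (n.choose i : ℕ∞) * encapSup d i) + encapSup (d - 2) n := by
  have hn2 : 2 ≤ n := by omega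
  induction d with
  | zero => exact le_add_self
  | succ d ih =>
    refine (encapSup_succ_le_max hn2 d).trans (max_le (add_le_add_left ?_ _) (ih.trans ?_))
    · have h := Finset.single_le_sum (f := fun i => (n.choose i : ℕ∞) * encapSup (d + 1) i)
        (fun _ _ => zero_le) (Finset.mem_Icc.2 ⟨by omega, le_rfl⟩ : n - 1 ∈ Finset.Icc 2 (n - 1))
      have hc : n.choose (n - 1) = n := by
        rw [Nat.choose_symm (by omega : 1 ≤ n), Nat.choose_one_right]
      simpa only [hc] using h
    · refine add_le_add (Finset.sum_le_sum fun i hi => ?_) (encapSup_mono hn2 (by omega))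
      gcongr
      exact encapSup_le_succ (Finset.mem_Icc.1 hi).1 d

/-- The recursive bound
`f(d,n) ≤ ∑_{i=2}^{n-1} C(n,i) · f(d,i) + f(d-2,n)` for `n > 3`, `d ≥ 2`. -/
theorem encapSup_recursive_bound (d n : ℕ) (hn : 3 < n) (hd : 2 ≤ d) :
    encapSup d n ≤
      (∑ i ∈ Finset.Icc 2 (n - 1), (n.choose i : ℕ∞) * encapSup d i) +
        encapSup (d - 2) n := by
  exact encapSup_le_sum_add hn.le d
end

section
/- Let n ≥ 3 and let K₁, …, Kₙ ⊆ ℝ² be pairwise disjoint convex sets such that the set S = ℝ² \ (K₁ ∪ … ∪ Kₙ) is finite. Then |S| ≤ 5n − 11. -/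
open Metric Set

namespace PlanarSweep

open Filter Topology

/-- The projection of a planar set to the horizontal axis. -/
def shadow (A : Set (ℝ × ℝ)) : Set ℝ := {t | ∃ y, (t, y) ∈ A}

/-- `A` lies below `B` on some vertical line. -/
def Below (A B : Set (ℝ × ℝ)) : Prop := ∃ t a b, (t, a) ∈ A ∧ (t, b) ∈ B ∧ a < b

/-- `s` is a leftmost point of the closure of `A`. -/
def StartsAt (A : Set (ℝ × ℝ)) (s : ℝ × ℝ) : Prop := s ∈ closure A ∧ ∀ a ∈ A, s.1 ≤ a.1

/-- `s` is a rightmost point of the closure of `A`. -/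
def EndsAt (A : Set (ℝ × ℝ)) (s : ℝ × ℝ) : Prop := s ∈ closure A ∧ ∀ a ∈ A, a.1 ≤ s.1

section Convex

variable {A B : Set (ℝ × ℝ)}

lemma mem_of_convex_comb (hA : Convex ℝ A) {t u y z : ℝ} (h₁ : (t, y) ∈ A) (h₂ : (u, z) ∈ A)
    {w : ℝ} (h₀ : 0 ≤ w) (hw : w ≤ 1) : (t + w * (u - t), y + w * (z - y)) ∈ A := by
  have h := hA h₁ h₂ (sub_nonneg.2 hw) h₀ (by ring)
  convert h using 1
  ext <;> simp <;> ring

lemma mem_of_le_of_le (hA : Convex ℝ A) {t y z u : ℝ} (h₁ : (t, y) ∈ A) (h₂ : (t, u) ∈ A)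
    (hy : y ≤ z) (hu : z ≤ u) : (t, z) ∈ A := by
  rcases hy.eq_or_lt with rfl | hlt
  · exact h₁
  have hpos : 0 < u - y := by linarith
  have h := mem_of_convex_comb hA h₁ h₂ (w := (z - y) / (u - y)) (by apply div_nonneg <;> linarith)
    ((div_le_one hpos).2 (by linarith))
  convert h using 2
  · ring
  · field_simp
    ring

lemma mem_interpolate (hA : Convex ℝ A) {t u v y z : ℝ} (h₁ : (t, y) ∈ A) (h₂ : (u, z) ∈ A)
    (htu : t < u) (htv : t ≤ v) (hvu : v ≤ u) : (v, y + (v - t) / (u - t) * (z - y)) ∈ A := by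
  have hpos : 0 < u - t := by linarith
  have h := mem_of_convex_comb hA h₁ h₂ (w := (v - t) / (u - t)) (by apply div_nonneg <;> linarith)
    ((div_le_one hpos).2 (by linarith))
  convert h using 2
  field_simp
  ring

lemma mem_shadow_of_le_of_le (hA : Convex ℝ A) {t u v : ℝ} (h₁ : t ∈ shadow A) (h₂ : u ∈ shadow A)
    (htv : t ≤ v) (hvu : v ≤ u) : v ∈ shadow A := by
  obtain ⟨y, hy⟩ := h₁
  obtain ⟨z, hz⟩ := h₂
  rcases htv.eq_or_lt with rfl | hlt
  · exact ⟨y, hy⟩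
  exact ⟨_, mem_interpolate hA hy hz (by linarith) htv hvu⟩

lemma Below.lt (hA : Convex ℝ A) (hB : Convex ℝ B) (hd : Disjoint A B) (h : Below A B)
    {t a b : ℝ} (ha : (t, a) ∈ A) (hb : (t, b) ∈ B) : a < b := by
  obtain ⟨u, c, d, hc, hd', hcd⟩ := h
  by_contra! hle
  have hpos : 0 < (d - c) + (a - b) := by linarith
  have h₁ : (d - c) / ((d - c) + (a - b)) ≤ 1 := (div_le_one hpos).2 (by linarith)
  have h₀ : 0 ≤ (d - c) / ((d - c) + (a - b)) := by apply div_nonneg <;> linarith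
  have h₂ := mem_of_convex_comb hA hc ha h₀ h₁
  have h₃ := mem_of_convex_comb hB hd' hb h₀ h₁
  refine Set.disjoint_left.1 hd h₂ ?_
  convert h₃ using 2
  field_simp
  ring

lemma Below.asymm (hA : Convex ℝ A) (hB : Convex ℝ B) (hd : Disjoint A B) (h : Below A B) :
    ¬ Below B A := by
  rintro ⟨t, b, a, hb, ha, hlt⟩
  exact lt_asymm hlt (h.lt hA hB hd ha hb)

lemma below_or_below (hd : Disjoint A B) {t : ℝ} (hA : t ∈ shadow A) (hB : t ∈ shadow B) :
    Below A B ∨ Below B A := by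
  obtain ⟨a, ha⟩ := hA
  obtain ⟨b, hb⟩ := hB
  rcases lt_trichotomy a b with h | rfl | h
  · exact .inl ⟨t, a, b, ha, hb, h⟩
  · exact (Set.disjoint_left.1 hd ha hb).elim
  · exact .inr ⟨t, b, a, hb, ha, h⟩

lemma Below.trans {C : Set (ℝ × ℝ)} (hA : Convex ℝ A) (hB : Convex ℝ B) (hC : Convex ℝ C)
    (hAB : Disjoint A B) (hBC : Disjoint B C) (h₁ : Below A B) (h₂ : Below B C) {t : ℝ}
    (htA : t ∈ shadow A) (htB : t ∈ shadow B) (htC : t ∈ shadow C) : Below A C := by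
  obtain ⟨a, ha⟩ := htA
  obtain ⟨b, hb⟩ := htB
  obtain ⟨c, hc⟩ := htC
  exact ⟨t, a, c, ha, hc, (h₁.lt hA hB hAB ha hb).trans (h₂.lt hB hC hBC hb hc)⟩

end Convex

lemma ordConnected_line_preimage {A : Set (ℝ × ℝ)} (hA : Convex ℝ A) (s v : ℝ × ℝ) :
    ((fun r : ℝ => s + r • v) ⁻¹' A).OrdConnected := by
  have h : (fun r : ℝ => s + r • v) = AffineMap.lineMap (k := ℝ) s (s + v) := by
    ext <;> simp [AffineMap.lineMap_apply, add_comm]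
  rw [h]
  exact (hA.affine_preimage (AffineMap.lineMap s (s + v))).ordConnected

section Cover

variable {ι : Type*} {K : ι → Set (ℝ × ℝ)}

lemma exists_eventually_nhdsGT_mem [Finite ι] (hK : ∀ i, Convex ℝ (K i))
    (hfin : (⋃ i, K i)ᶜ.Finite) (s : ℝ × ℝ) {v : ℝ × ℝ} (hv : v ≠ 0) :
    ∃ i, ∀ᶠ r in 𝓝[>] (0 : ℝ), s + r • v ∈ K i := by
  have hcov : ∀ᶠ r in 𝓝[>] (0 : ℝ), ∃ i, s + r • v ∈ K i := by
    have hcl : IsClosed ((⋃ i, K i)ᶜ \ {s}) := (hfin.subset sdiff_subset).isClosed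
    have hcont : Continuous fun r : ℝ => s + r • v := by fun_prop
    have hmem : ∀ᶠ r in 𝓝 (0 : ℝ), s + r • v ∈ ((⋃ i, K i)ᶜ \ {s})ᶜ :=
      hcont.continuousAt.eventually (hcl.isOpen_compl.mem_nhds (by simp))
    filter_upwards [nhdsWithin_le_nhds hmem, self_mem_nhdsWithin] with r hr hr0
    by_contra hno
    refine hr ⟨by simpa using hno, ?_⟩
    simp [hv, (show (0 : ℝ) < r from hr0).ne']
  obtain ⟨i, hi⟩ : ∃ i, ∃ᶠ r in 𝓝[>] (0 : ℝ), s + r • v ∈ K i := by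
    by_contra! hno
    obtain ⟨r, hr, i, hi⟩ := ((eventually_all.2 hno).and hcov).exists
    exact hr i hi
  refine ⟨i, ?_⟩
  obtain ⟨r₀, hr₀, hpos⟩ := (hi.and_eventually self_mem_nhdsWithin).exists
  filter_upwards [Ioo_mem_nhdsGT (show (0 : ℝ) < r₀ from hpos)] with r hr
  obtain ⟨r₁, hr₁, hlt⟩ := (hi.and_eventually (Ioo_mem_nhdsGT hr.1)).exists
  exact (ordConnected_line_preimage (hK i) s v).out hr₁ hr₀ ⟨hlt.2.le, hr.2.le⟩

lemma exists_eventually_atTop_mem [Finite ι] (hK : ∀ i, Convex ℝ (K i))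
    (hfin : (⋃ i, K i)ᶜ.Finite) (s : ℝ × ℝ) {v : ℝ × ℝ} (hv : v ≠ 0) :
    ∃ i, ∀ᶠ r : ℝ in atTop, s + r • v ∈ K i := by
  have hcov : ∀ᶠ r : ℝ in atTop, ∃ i, s + r • v ∈ K i := by
    have hinj : Function.Injective fun r : ℝ => s + r • v := fun a b h => by
      simpa [hv] using h
    have hpre : ((fun r : ℝ => s + r • v) ⁻¹' (⋃ i, K i)ᶜ).Finite := hfin.preimage hinj.injOn
    obtain ⟨M, hM⟩ := hpre.bddAbove
    filter_upwards [eventually_gt_atTop M] with r hr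
    by_contra hno
    exact absurd (hM (show r ∈ _ by simpa using hno)) (not_le.2 hr)
  obtain ⟨i, hi⟩ : ∃ i, ∃ᶠ r : ℝ in atTop, s + r • v ∈ K i := by
    by_contra! hno
    obtain ⟨r, hr, i, hi⟩ := ((eventually_all.2 hno).and hcov).exists
    exact hr i hi
  refine ⟨i, ?_⟩
  obtain ⟨r₀, hr₀⟩ := hi.exists
  filter_upwards [eventually_ge_atTop r₀] with r hr
  obtain ⟨r₁, hr₁, hlt⟩ := (hi.and_eventually (eventually_ge_atTop r)).exists
  exact (ordConnected_line_preimage (hK i) s v).out hr₀ hr₁ ⟨hr, hlt⟩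

end Cover

/-- No cell starts or ends at the point `s`, which is not covered by the cells; just below `s` on
its vertical line is the cell `K i`, just above it is the cell `K j`. -/
structure IsCrossing {ι : Type*} (K : ι → Set (ℝ × ℝ)) (s : ℝ × ℝ) (i j : ι) : Prop where
  notMem : ∀ k, s ∉ K k
  not_startsAt : ∀ k, ¬ StartsAt (K k) s
  not_endsAt : ∀ k, ¬ EndsAt (K k) s
  lower : ∀ᶠ r in 𝓝[>] (0 : ℝ), (s.1, s.2 - r) ∈ K i
  upper : ∀ᶠ r in 𝓝[>] (0 : ℝ), (s.1, s.2 + r) ∈ K j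

lemma mem_closure_of_eventually {A : Set (ℝ × ℝ)} {f : ℝ → ℝ × ℝ} (hf : Continuous f)
    (h : ∀ᶠ r in 𝓝[>] (0 : ℝ), f r ∈ A) : f 0 ∈ closure A :=
  mem_closure_of_tendsto (hf.continuousAt.tendsto.mono_left nhdsWithin_le_nhds) h

lemma eventually_interpolate_close {t u : ℝ} (htu : t < u) (y z : ℝ) {ε : ℝ} (hε : 0 < ε) :
    ∀ᶠ v in 𝓝[<] u, |y + (v - t) / (u - t) * (z - y) - z| < ε ∧ t < v := by
  have hc : Tendsto (fun v : ℝ => |y + (v - t) / (u - t) * (z - y) - z|) (𝓝 u)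
      (𝓝 |y + (u - t) / (u - t) * (z - y) - z|) := by
    apply ContinuousAt.tendsto (f := fun v : ℝ => |y + (v - t) / (u - t) * (z - y) - z|)
    fun_prop
  rw [div_self (by linarith), one_mul, add_sub_cancel, sub_self, abs_zero] at hc
  exact Eventually.and (nhdsWithin_le_nhds (hc.eventually (gt_mem_nhds hε)))
    (nhdsWithin_le_nhds (Ioi_mem_nhds htu))

lemma exists_small {p : ℝ → Prop} (h : ∀ᶠ r in 𝓝[>] (0 : ℝ), p r) {ε : ℝ} (hε : 0 < ε) :
    ∃ r, 0 < r ∧ r < ε ∧ p r := by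
  obtain ⟨r, hr, hr'⟩ := (h.and (Ioo_mem_nhdsGT hε)).exists
  exact ⟨r, hr'.1, hr'.2, hr⟩


section Line

variable {A : Set (ℝ × ℝ)} {σ τ t p q y P Q : ℝ}

lemma le_line_of_lt (hA : Convex ℝ A) (σ τ : ℝ) (htp : t < p) (hpq : p < q)
    (h : (σ * t, τ * y) ∈ A) (hq : ∀ᶠ r in 𝓝[>] (0 : ℝ), (σ * q, τ * (Q - r)) ∈ A)
    (hp : ∀ z, (σ * p, τ * z) ∈ A → z ≤ P) : y ≤ P + (Q - P) / (q - p) * (t - p) := by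
  have hqt : 0 < q - t := by linarith
  have hqp : 0 < q - p := by linarith
  have hev : ∀ᶠ r in 𝓝[>] (0 : ℝ), y + (p - t) / (q - t) * (Q - r - y) ≤ P := by
    filter_upwards [hq] with r hr
    apply hp
    have := mem_of_convex_comb hA h hr (w := (p - t) / (q - t))
      (by apply div_nonneg <;> linarith) ((div_le_one hqt).2 (by linarith))
    convert this using 2
    · field_simp
      ring
    · ring
  have hlim : Tendsto (fun r : ℝ => y + (p - t) / (q - t) * (Q - r - y)) (𝓝[>] 0)
      (𝓝 (y + (p - t) / (q - t) * (Q - 0 - y))) :=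
    (ContinuousAt.tendsto (by fun_prop)).mono_left nhdsWithin_le_nhds
  have hle := le_of_tendsto hlim hev
  have e₁ : y + (p - t) / (q - t) * (Q - 0 - y) = (y * (q - p) + (p - t) * Q) / (q - t) := by
    field_simp
    ring
  have e₂ : P + (Q - P) / (q - p) * (t - p) = (P * (q - t) - (p - t) * Q) / (q - p) := by
    field_simp
    ring
  rw [e₁, div_le_iff₀ hqt] at hle
  rw [e₂, le_div_iff₀ hqp]
  linarith

lemma le_line_of_mem_Icc (hA : Convex ℝ A) (τ : ℝ) (hpt : p ≤ t) (htq : t ≤ q) (hpq : p < q)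
    (hp : ∀ᶠ r in 𝓝[>] (0 : ℝ), (p, τ * (P + r)) ∈ A)
    (hq : ∀ᶠ r in 𝓝[>] (0 : ℝ), (q, τ * (Q + r)) ∈ A)
    (hy : ∀ z, (t, τ * z) ∈ A → y ≤ z) : y ≤ P + (Q - P) / (q - p) * (t - p) := by
  have hqp : 0 < q - p := by linarith
  have hev : ∀ᶠ r in 𝓝[>] (0 : ℝ), y ≤ P + r + (t - p) / (q - p) * (Q - P) := by
    filter_upwards [hp, hq] with r hr hr'
    apply hy
    have := mem_interpolate hA hr hr' hpq hpt htq
    convert this using 2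
    ring
  have hlim : Tendsto (fun r : ℝ => P + r + (t - p) / (q - p) * (Q - P)) (𝓝[>] 0)
      (𝓝 (P + 0 + (t - p) / (q - p) * (Q - P))) :=
    (ContinuousAt.tendsto (by fun_prop)).mono_left nhdsWithin_le_nhds
  have hle := ge_of_tendsto hlim hev
  rwa [show P + (Q - P) / (q - p) * (t - p) = P + 0 + (t - p) / (q - p) * (Q - P) by ring]

end Line

namespace IsCrossing

variable {ι : Type*} {K : ι → Set (ℝ × ℝ)} {s s' : ℝ × ℝ} {i j k : ι}

lemma exists_of_not_event [Finite ι] (hK : ∀ i, Convex ℝ (K i))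
    (hfin : (⋃ i, K i)ᶜ.Finite) (hs : s ∈ (⋃ i, K i)ᶜ) (h₁ : ∀ k, ¬ StartsAt (K k) s)
    (h₂ : ∀ k, ¬ EndsAt (K k) s) : ∃ i j, IsCrossing K s i j := by
  obtain ⟨i, hi⟩ := exists_eventually_nhdsGT_mem hK hfin s (v := (0, -1)) (by simp)
  obtain ⟨j, hj⟩ := exists_eventually_nhdsGT_mem hK hfin s (v := (0, 1)) (by simp)
  refine ⟨i, j, by simpa using hs, h₁, h₂, ?_, ?_⟩
  · filter_upwards [hi] with r hr
    convert hr using 1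
    ext <;> simp [sub_eq_add_neg]
  · filter_upwards [hj] with r hr
    convert hr using 1
    ext <;> simp

lemma exists_left (h : IsCrossing K s i j) (hk : s ∈ closure (K k)) : ∃ a ∈ K k, a.1 < s.1 := by
  have := h.not_startsAt k
  unfold StartsAt at this
  push Not at this
  exact this hk

lemma exists_right (h : IsCrossing K s i j) (hk : s ∈ closure (K k)) : ∃ a ∈ K k, s.1 < a.1 := by
  have := h.not_endsAt k
  unfold EndsAt at this
  push Not at this
  exact this hk

lemma mem_closure_lower (h : IsCrossing K s i j) : s ∈ closure (K i) := by
  simpa using mem_closure_of_eventually (f := fun r => (s.1, s.2 - r)) (by fun_prop) h.lower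

lemma mem_closure_upper (h : IsCrossing K s i j) : s ∈ closure (K j) := by
  simpa using mem_closure_of_eventually (f := fun r => (s.1, s.2 + r)) (by fun_prop) h.upper

lemma mem_shadow_lower (h : IsCrossing K s i j) : s.1 ∈ shadow (K i) :=
  let ⟨_, hr⟩ := h.lower.exists
  ⟨_, hr⟩

lemma mem_shadow_upper (h : IsCrossing K s i j) : s.1 ∈ shadow (K j) :=
  let ⟨_, hr⟩ := h.upper.exists
  ⟨_, hr⟩

lemma below (h : IsCrossing K s i j) : Below (K i) (K j) := by
  obtain ⟨r, hr, -, h₁⟩ := exists_small h.lower one_pos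
  obtain ⟨r', hr', -, h₂⟩ := exists_small h.upper one_pos
  exact ⟨_, _, _, h₁, h₂, by linarith⟩

lemma ne (hK : ∀ i, Convex ℝ (K i)) (h : IsCrossing K s i j) : i ≠ j := by
  rintro rfl
  obtain ⟨r, hr, -, h₁⟩ := exists_small h.lower one_pos
  obtain ⟨r', hr', -, h₂⟩ := exists_small h.upper one_pos
  exact h.notMem i (mem_of_le_of_le (hK i) h₁ h₂ (z := s.2) (by linarith) (by linarith))

lemma le_of_mem_lower (hK : ∀ i, Convex ℝ (K i)) (h : IsCrossing K s i j) {y : ℝ}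
    (hy : (s.1, y) ∈ K i) : y ≤ s.2 := by
  by_contra! hlt
  obtain ⟨r, hr, -, h₁⟩ := exists_small h.lower one_pos
  exact h.notMem i (mem_of_le_of_le (hK i) h₁ hy (z := s.2) (by linarith) (by linarith))

lemma le_of_mem_upper (hK : ∀ i, Convex ℝ (K i)) (h : IsCrossing K s i j) {y : ℝ}
    (hy : (s.1, y) ∈ K j) : s.2 ≤ y := by
  by_contra! hlt
  obtain ⟨r, hr, -, h₁⟩ := exists_small h.upper one_pos
  exact h.notMem j (mem_of_le_of_le (hK j) hy h₁ (z := s.2) (by linarith) (by linarith))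

variable (hK : ∀ i, Convex ℝ (K i)) (hd : Pairwise fun i j => Disjoint (K i) (K j))

include hK hd

lemma notMem_shadow_of_between (h : IsCrossing K s i j) (hki : k ≠ i) (hkj : k ≠ j)
    (h₁ : Below (K i) (K k)) (h₂ : Below (K k) (K j)) : s.1 ∉ shadow (K k) := by
  rintro ⟨y, hy⟩
  refine h.notMem k ?_
  suffices y = s.2 by subst this; exact hy
  apply le_antisymm
  · apply le_of_forall_pos_le_add
    intro ε hε
    obtain ⟨r, hr, hrε, hm⟩ := exists_small h.upper hε
    have := h₂.lt (hK k) (hK j) (hd hkj) hy hm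
    linarith
  · apply le_of_forall_pos_le_add
    intro ε hε
    obtain ⟨r, hr, hrε, hm⟩ := exists_small h.lower hε
    have := h₁.lt (hK i) (hK k) (hd hki.symm) hm hy
    linarith

lemma notMem_closure_of_between (h : IsCrossing K s i j) (hki : k ≠ i) (hkj : k ≠ j)
    (h₁ : Below (K i) (K k)) (h₂ : Below (K k) (K j)) : s ∉ closure (K k) := by
  intro hc
  obtain ⟨⟨t, y⟩, ha, hlt⟩ := h.exists_left hc
  obtain ⟨⟨t', y'⟩, ha', hlt'⟩ := h.exists_right hc
  exact h.notMem_shadow_of_between hK hd hki hkj h₁ h₂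
    (mem_shadow_of_le_of_le (hK k) ⟨y, ha⟩ ⟨y', ha'⟩ hlt.le hlt'.le)

/-- A cell between the lower and the upper cell of a crossing, and to its left, keeps away
from it. -/
lemma exists_lt_of_between (h : IsCrossing K s i j) (hki : k ≠ i) (hkj : k ≠ j)
    (h₁ : Below (K i) (K k)) (h₂ : Below (K k) (K j)) {u : ℝ} (hu : u ∈ shadow (K k))
    (hus : u < s.1) : ∃ τ < s.1, ∀ t ∈ shadow (K k), t ≤ τ := by
  by_contra! hno
  have hnot := h.notMem_shadow_of_between hK hd hki hkj h₁ h₂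
  have hleft : ∀ t ∈ shadow (K k), t < s.1 := by
    intro t ht
    by_contra! hle
    exact hnot (mem_shadow_of_le_of_le (hK k) hu ht hus.le hle)
  refine h.notMem_closure_of_between hK hd hki hkj h₁ h₂ ?_
  rw [Metric.mem_closure_iff]
  intro ε hε
  obtain ⟨⟨ta, ya⟩, ha, hlta⟩ := h.exists_left h.mem_closure_lower
  obtain ⟨⟨tb, yb⟩, hb, hltb⟩ := h.exists_left h.mem_closure_upper
  obtain ⟨ra, hra, hraε, hma⟩ := exists_small h.lower (half_pos hε)
  obtain ⟨rb, hrb, hrbε, hmb⟩ := exists_small h.upper (half_pos hε)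
  simp only at hlta hltb
  have hall := ((eventually_interpolate_close hlta ya (s.2 - ra) (half_pos hε)).and
    (eventually_interpolate_close hltb yb (s.2 + rb) (half_pos hε))).and
      (eventually_mem_set.2 (Ioo_mem_nhdsLT (show s.1 - ε < s.1 by linarith)))
  obtain ⟨τ, hτ, hτ'⟩ := mem_nhdsLT_iff_exists_Ioo_subset.1 hall
  obtain ⟨t, ⟨y, hy⟩, hτt⟩ := hno τ hτ
  have hts := hleft t ⟨y, hy⟩
  obtain ⟨⟨⟨hta, hIa⟩, htb, hIb⟩, hIε⟩ := hτ' ⟨hτt, hts⟩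
  have hla := h₁.lt (hK i) (hK k) (hd hki.symm)
    (mem_interpolate (hK i) ha hma hlta hIa.le hts.le) hy
  have hlb := h₂.lt (hK k) (hK j) (hd hkj) hy
    (mem_interpolate (hK j) hb hmb hltb hIb.le hts.le)
  rw [abs_lt] at hta htb
  refine ⟨(t, y), hy, ?_⟩
  rw [Prod.dist_eq, max_lt_iff, Real.dist_eq, Real.dist_eq, abs_lt, abs_lt]
  exact ⟨⟨by linarith, by linarith [hIε.1]⟩, by linarith, by linarith⟩

/-- Near a crossing, a line separating the lower from the upper cell is covered by the two. -/
lemma eventually_mem_or [Finite ι] (hfin : (⋃ i, K i)ᶜ.Finite) (h : IsCrossing K s i j) {m : ℝ}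
    (hlo : ∀ a ∈ K i, a.2 ≤ s.2 + m * (a.1 - s.1)) (hup : ∀ b ∈ K j, s.2 + m * (b.1 - s.1) ≤ b.2)
    {c : ℝ} (hc : c ≠ 0) :
    (∀ᶠ r in 𝓝[>] (0 : ℝ), s + r • (c, c * m) ∈ K i) ∨
      ∀ᶠ r in 𝓝[>] (0 : ℝ), s + r • (c, c * m) ∈ K j := by
  obtain ⟨k, hk⟩ := exists_eventually_nhdsGT_mem hK hfin s (v := (c, c * m)) (by simp [hc])
  by_cases hki : k = i
  · exact .inl (hki ▸ hk)
  by_cases hkj : k = j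
  · exact .inr (hkj ▸ hk)
  exfalso
  have hcl : s ∈ closure (K k) := by
    simpa using mem_closure_of_eventually (f := fun r => s + r • (c, c * m)) (by fun_prop) hk
  have hsh : ∀ l, s ∈ closure (K l) → ∀ᶠ r in 𝓝[>] (0 : ℝ), s.1 + r * c ∈ shadow (K l) := by
    intro l hl
    obtain ⟨⟨t, y⟩, ha, hlt⟩ := h.exists_left hl
    obtain ⟨⟨t', y'⟩, ha', hlt'⟩ := h.exists_right hl
    have hcont : ContinuousAt (fun r : ℝ => s.1 + r * c) 0 := by fun_prop
    have := hcont.eventually (Ioo_mem_nhds (a := t) (b := t') (by simpa using hlt)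
      (by simpa using hlt'))
    filter_upwards [nhdsWithin_le_nhds this] with r hr
    exact mem_shadow_of_le_of_le (hK l) ⟨y, ha⟩ ⟨y', ha'⟩ hr.1.le hr.2.le
  obtain ⟨r, hr, ⟨a, ha⟩, ⟨b, hb⟩⟩ :=
    (hk.and ((hsh i h.mem_closure_lower).and (hsh j h.mem_closure_upper))).exists
  have hr' : (s.1 + r * c, s.2 + r * (c * m)) ∈ K k := hr
  have hla := hlo _ ha
  have hlb := hup _ hb
  simp only at hla hlb
  refine h.notMem_closure_of_between hK hd hki hkj ⟨_, _, _, ha, hr', ?_⟩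
    ⟨_, _, _, hr', hb, ?_⟩ hcl
  · refine lt_of_le_of_ne (by linarith) fun he => ?_
    exact Set.disjoint_left.1 (hd hki) hr' (he ▸ ha)
  · refine lt_of_le_of_ne (by linarith) fun he => ?_
    exact Set.disjoint_left.1 (hd hkj) hr' (he ▸ hb)

lemma lower_le_line (h : IsCrossing K s i j) (h' : IsCrossing K s' i j) (hlt : s.1 < s'.1) :
    ∀ a ∈ K i, a.2 ≤ s.2 + (s'.2 - s.2) / (s'.1 - s.1) * (a.1 - s.1) := by
  rintro ⟨t, y⟩ ha
  have hpos : 0 < s'.1 - s.1 := by linarith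
  rcases lt_or_ge t s.1 with h₁ | h₁
  · exact le_line_of_lt (hK i) 1 1 h₁ hlt (by simpa using ha) (by simpa using h'.lower)
      (by simpa using fun z => h.le_of_mem_lower hK (y := z))
  rcases le_or_gt t s'.1 with h₂ | h₂
  · refine le_line_of_mem_Icc (hK j) 1 h₁ h₂ hlt (by simpa using h.upper)
      (by simpa using h'.upper) ?_
    intro z hz
    exact (h.below.lt (hK i) (hK j) (hd (h.ne hK)) ha (by simpa using hz)).le
  · have := le_line_of_lt (hK i) (-1) 1 (t := -t) (p := -s'.1) (q := -s.1) (y := y) (P := s'.2)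
      (Q := s.2) (by linarith) (by linarith) (by simpa using ha) (by simpa using h.lower)
      (by simpa using fun z => h'.le_of_mem_lower hK (y := z))
    convert this using 1
    have : -s.1 - -s'.1 = s'.1 - s.1 := by ring
    rw [this]
    field_simp
    ring

lemma line_le_upper (h : IsCrossing K s i j) (h' : IsCrossing K s' i j) (hlt : s.1 < s'.1) :
    ∀ b ∈ K j, s.2 + (s'.2 - s.2) / (s'.1 - s.1) * (b.1 - s.1) ≤ b.2 := by
  rintro ⟨t, y⟩ hb
  have hpos : 0 < s'.1 - s.1 := by linarith
  have hup : ∀ᶠ r in 𝓝[>] (0 : ℝ), (s.1, -1 * (-s.2 - r)) ∈ K j := by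
    simpa [add_comm] using h.upper
  have hup' : ∀ᶠ r in 𝓝[>] (0 : ℝ), (s'.1, -1 * (-s'.2 - r)) ∈ K j := by
    simpa [add_comm] using h'.upper
  have hlo : ∀ᶠ r in 𝓝[>] (0 : ℝ), (s.1, -1 * (-s.2 + r)) ∈ K i := by
    simpa [add_comm, sub_eq_add_neg] using h.lower
  have hlo' : ∀ᶠ r in 𝓝[>] (0 : ℝ), (s'.1, -1 * (-s'.2 + r)) ∈ K i := by
    simpa [add_comm, sub_eq_add_neg] using h'.lower
  suffices -y ≤ -s.2 + (-s'.2 - -s.2) / (s'.1 - s.1) * (t - s.1) by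
    rw [show (-s'.2 - -s.2) = -(s'.2 - s.2) by ring, neg_div, neg_mul] at this
    linarith
  rcases lt_or_ge t s.1 with h₁ | h₁
  · refine le_line_of_lt (hK j) 1 (-1) h₁ hlt (by simpa using hb) (by simpa only [one_mul]) ?_
    intro z hz
    have := h.le_of_mem_upper hK (y := -1 * z) (by simpa using hz)
    linarith
  rcases le_or_gt t s'.1 with h₂ | h₂
  · refine le_line_of_mem_Icc (hK i) (-1) h₁ h₂ hlt hlo hlo' ?_
    intro z hz
    linarith [h.below.lt (hK i) (hK j) (hd (h.ne hK)) hz hb]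
  · have := le_line_of_lt (hK j) (-1) (-1) (t := -t) (p := -s'.1) (q := -s.1) (y := -y)
      (P := -s'.2) (Q := -s.2) (by linarith) (by linarith) (by simpa using hb)
      (by simpa only [neg_mul_neg, one_mul] using hup) (fun z hz => by
        have := h'.le_of_mem_upper hK (y := -1 * z) (by simpa using hz)
        linarith)
    convert this using 1
    have : -s.1 - -s'.1 = s'.1 - s.1 := by ring
    rw [this]
    field_simp
    ring

/-- On each side of a crossing, a line separating the two cells is covered by one of them, and the
two sides are covered by different cells. -/
lemma eventually_swap [Finite ι] (hfin : (⋃ i, K i)ᶜ.Finite) (h : IsCrossing K s i j) {m : ℝ}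
    (hlo : ∀ a ∈ K i, a.2 ≤ s.2 + m * (a.1 - s.1))
    (hup : ∀ b ∈ K j, s.2 + m * (b.1 - s.1) ≤ b.2) :
    ∀ᶠ r in 𝓝[>] (0 : ℝ),
      s + (-r) • ((1 : ℝ), m) ∈ K i ∧ s + r • ((1 : ℝ), m) ∈ K j ∨
        s + (-r) • ((1 : ℝ), m) ∈ K j ∧ s + r • ((1 : ℝ), m) ∈ K i := by
  have hno : ∀ (k : ι) (r : ℝ), 0 < r → s + (-r) • ((1 : ℝ), m) ∈ K k →
      s + r • ((1 : ℝ), m) ∉ K k := by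
    intro k r hr h₁ h₂
    apply h.notMem k
    have h₀ : s + (0 : ℝ) • ((1 : ℝ), m) ∈ K k :=
      (ordConnected_line_preimage (hK k) s (1, m)).out h₁ h₂
        (show (0 : ℝ) ∈ Icc (-r) r by constructor <;> linarith)
    rwa [zero_smul, add_zero] at h₀
  have hL := h.eventually_mem_or hK hd hfin hlo hup (c := -1) (by norm_num)
  have hR := h.eventually_mem_or hK hd hfin hlo hup (c := 1) one_ne_zero
  have e₁ : ∀ r : ℝ, s + r • ((-1 : ℝ), -1 * m) = s + (-r) • ((1 : ℝ), m) := by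
    intro r
    ext <;> simp
  simp only [e₁, one_mul] at hL hR
  rcases hL with hL | hL <;> rcases hR with hR | hR <;>
    filter_upwards [hL, hR, self_mem_nhdsWithin] with r h₁ h₂ h₃
  · exact (hno i r h₃ h₁ h₂).elim
  · exact .inl ⟨h₁, h₂⟩
  · exact .inr ⟨h₁, h₂⟩
  · exact (hno j r h₃ h₁ h₂).elim

lemma not_lt_of_same_cells [Finite ι] (hfin : (⋃ i, K i)ᶜ.Finite) (h : IsCrossing K s i j)
    (h' : IsCrossing K s' i j) : ¬ s.1 < s'.1 := by
  intro hlt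
  have hpos : 0 < s'.1 - s.1 := by linarith
  have hlo := h.lower_le_line hK hd h' hlt
  have hup := h.line_le_upper hK hd h' hlt
  set m := (s'.2 - s.2) / (s'.1 - s.1) with hm
  have hmm : m * (s'.1 - s.1) = s'.2 - s.2 := div_mul_cancel₀ _ hpos.ne'
  have hs := h.eventually_swap hK hd hfin hlo hup
  have hs' := h'.eventually_swap hK hd hfin (m := m)
    (fun a ha => by linarith [hlo a ha]) (fun b hb => by linarith [hup b hb])
  obtain ⟨r, hr, hr', hmem⟩ := exists_small hs (half_pos hpos)
  obtain ⟨u, hu, hu', hmem'⟩ := exists_small hs' (half_pos hpos)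
  have e : ∀ v : ℝ, s' + v • ((1 : ℝ), m) = s + (s'.1 - s.1 + v) • ((1 : ℝ), m) := by
    intro v
    ext
    · simp
      ring
    · simp only [Prod.snd_add, Prod.smul_snd, smul_eq_mul]
      linarith
  simp only [e] at hmem'
  have hout : ∀ {k : ι} {x y z : ℝ}, s + x • ((1 : ℝ), m) ∈ K k → s + z • ((1 : ℝ), m) ∈ K k →
      x ≤ y → y ≤ z → s + y • ((1 : ℝ), m) ∈ K k := fun hx hz hxy hyz =>
    (ordConnected_line_preimage (hK _) s (1, m)).out hx hz ⟨hxy, hyz⟩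
  have hdis : ∀ {p : ℝ × ℝ}, p ∈ K i → p ∉ K j := fun hp =>
    Set.disjoint_left.1 (hd (h.ne hK)) hp
  rcases hmem with ⟨h₁, h₂⟩ | ⟨h₁, h₂⟩ <;> rcases hmem' with ⟨h₃, h₄⟩ | ⟨h₃, h₄⟩
  · exact hdis (hout h₁ h₃ (y := r) (by linarith) (by linarith)) h₂
  · exact hdis (hout h₁ h₄ (y := r) (by linarith) (by linarith)) h₂
  · exact hdis h₂ (hout h₁ h₄ (y := r) (by linarith) (by linarith))
  · exact hdis h₂ (hout h₁ h₃ (y := r) (by linarith) (by linarith))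

lemma fst_eq_of_same_cells [Finite ι] (hfin : (⋃ i, K i)ᶜ.Finite) (h : IsCrossing K s i j)
    (h' : IsCrossing K s' i j) : s.1 = s'.1 :=
  le_antisymm (not_lt.1 (h'.not_lt_of_same_cells hK hd hfin h))
    (not_lt.1 (h.not_lt_of_same_cells hK hd hfin h'))

end IsCrossing

section Charge

variable {ι : Type*} {K : ι → Set (ℝ × ℝ)} {s s' : ℝ × ℝ} {i j k : ι}

/-- To the left of `s` there is a vertical line on which `K k` lies between `K i` and `K j`. -/
structure LeftBetween (K : ι → Set (ℝ × ℝ)) (s : ℝ × ℝ) (i j k : ι) : Prop where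
  ne_lower : k ≠ i
  ne_upper : k ≠ j
  lower : Below (K i) (K k)
  upper : Below (K k) (K j)
  exists_lt : ∃ t < s.1, t ∈ shadow (K i) ∧ t ∈ shadow (K k) ∧ t ∈ shadow (K j)

/-- The crossing `s` lies on the boundary between `K i` and the upper neighbour of `K i` at the
place where `K i` starts. -/
def OpensAbove (K : ι → Set (ℝ × ℝ)) (s : ℝ × ℝ) (i : ι) : Prop :=
  ∃ j, IsCrossing K s i j ∧ (∀ k, ¬ LeftBetween K s i j k) ∧
    ∀ t ∈ shadow (K i), ∃ u ∈ shadow (K j), u ≤ t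

/-- The crossing `s` lies on the boundary between `K j` and the lower neighbour of `K j` at the
place where `K j` starts. -/
def OpensBelow (K : ι → Set (ℝ × ℝ)) (s : ℝ × ℝ) (j : ι) : Prop :=
  ∃ i, IsCrossing K s i j ∧ (∀ k, ¬ LeftBetween K s i j k) ∧
    ∃ t ∈ shadow (K i), ∀ u ∈ shadow (K j), t < u

/-- The crossing `s` lies on the boundary between two cells that become neighbours when `K k`
ends. -/
def ClosesAt (K : ι → Set (ℝ × ℝ)) (s : ℝ × ℝ) (k : ι) : Prop :=
  ∃ i j, IsCrossing K s i j ∧ LeftBetween K s i j k ∧ BddAbove (shadow (K k)) ∧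
    sSup (shadow (K k)) < s.1 ∧
      ∀ k', LeftBetween K s i j k' → ∀ t ∈ shadow (K k'), t ≤ sSup (shadow (K k))

lemma StartsAt.fst_le {A : Set (ℝ × ℝ)} (h : StartsAt A s) (h' : StartsAt A s') : s.1 ≤ s'.1 :=
  closure_minimal (t := {p : ℝ × ℝ | s.1 ≤ p.1}) h.2
    (isClosed_le continuous_const continuous_fst) h'.1

lemma EndsAt.fst_le {A : Set (ℝ × ℝ)} (h : EndsAt A s) (h' : EndsAt A s') : s.1 ≤ s'.1 :=
  closure_minimal (t := {p : ℝ × ℝ | p.1 ≤ s'.1}) h'.2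
    (isClosed_le continuous_fst continuous_const) h.1

lemma StartsAt.bddBelow {A : Set (ℝ × ℝ)} (h : StartsAt A s) : BddBelow (shadow A) :=
  ⟨s.1, fun _ ⟨_, hy⟩ => h.2 _ hy⟩

lemma EndsAt.bddAbove {A : Set (ℝ × ℝ)} (h : EndsAt A s) : BddAbove (shadow A) :=
  ⟨s.1, fun _ ⟨_, hy⟩ => h.2 _ hy⟩

variable (hK : ∀ i, Convex ℝ (K i)) (hd : Pairwise fun i j => Disjoint (K i) (K j))

include hK hd

lemma exists_charge [Finite ι] (hfin : (⋃ i, K i)ᶜ.Finite) (hs : s ∈ (⋃ i, K i)ᶜ) :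
    (∃ k, StartsAt (K k) s) ∨ (∃ k, EndsAt (K k) s) ∨ (∃ k, OpensAbove K s k) ∨
      (∃ k, OpensBelow K s k) ∨ ∃ k, ClosesAt K s k := by
  by_cases h₁ : ∃ k, StartsAt (K k) s
  · exact .inl h₁
  by_cases h₂ : ∃ k, EndsAt (K k) s
  · exact .inr (.inl h₂)
  refine .inr (.inr ?_)
  obtain ⟨i, j, h⟩ := IsCrossing.exists_of_not_event hK hfin hs (not_exists.1 h₁) (not_exists.1 h₂)
  by_cases hbet : ∃ k, LeftBetween K s i j k
  · refine .inr (.inr ?_)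
    obtain ⟨k, hk, hmax⟩ := Set.exists_max_image {k | LeftBetween K s i j k}
      (fun k => sSup (shadow (K k))) (Set.toFinite _) hbet
    have key : ∀ l, LeftBetween K s i j l →
        BddAbove (shadow (K l)) ∧ sSup (shadow (K l)) < s.1 := by
      intro l hl
      obtain ⟨t, ht, -, htl, -⟩ := hl.exists_lt
      obtain ⟨τ, hτ, hle⟩ :=
        h.exists_lt_of_between hK hd hl.ne_lower hl.ne_upper hl.lower hl.upper htl ht
      exact ⟨⟨τ, hle⟩, (csSup_le ⟨t, htl⟩ hle).trans_lt hτ⟩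
    exact ⟨k, i, j, h, hk, (key k hk).1, (key k hk).2, fun l hl t ht =>
      (le_csSup (key l hl).1 ht).trans (hmax l hl)⟩
  · by_cases hle : ∀ t ∈ shadow (K i), ∃ u ∈ shadow (K j), u ≤ t
    · exact .inl ⟨i, j, h, not_exists.1 hbet, hle⟩
    · push Not at hle
      exact .inr (.inl ⟨j, i, h, not_exists.1 hbet, hle⟩)

lemma OpensAbove.fst_eq [Finite ι] (hfin : (⋃ i, K i)ᶜ.Finite) (h : OpensAbove K s i)
    (h' : OpensAbove K s' i) : s.1 = s'.1 := by
  obtain ⟨j, hc, hno, hle⟩ := h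
  obtain ⟨j', hc', hno', hle'⟩ := h'
  by_cases hjj : j = j'
  · subst hjj
    exact hc.fst_eq_of_same_cells hK hd hfin hc'
  exfalso
  obtain ⟨t, hts, hts', hti⟩ : ∃ t, t < s.1 ∧ t < s'.1 ∧ t ∈ shadow (K i) := by
    obtain ⟨⟨t, y⟩, ha, hlt⟩ := hc.exists_left hc.mem_closure_lower
    obtain ⟨⟨t', y'⟩, ha', hlt'⟩ := hc'.exists_left hc'.mem_closure_lower
    rcases le_total t t' with h | h
    · exact ⟨t, hlt, h.trans_lt hlt', y, ha⟩
    · exact ⟨t', h.trans_lt hlt, hlt', y', ha'⟩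
  obtain ⟨u, hu, hut⟩ := hle t hti
  obtain ⟨u', hu', hut'⟩ := hle' t hti
  have htj := mem_shadow_of_le_of_le (hK j) hu hc.mem_shadow_upper hut hts.le
  have htj' := mem_shadow_of_le_of_le (hK j') hu' hc'.mem_shadow_upper hut' hts'.le
  rcases below_or_below (hd hjj) htj htj' with hb | hb
  · exact hno' j ⟨(hc.ne hK).symm, hjj, hc.below, hb, t, hts', hti, htj, htj'⟩
  · exact hno j' ⟨(hc'.ne hK).symm, Ne.symm hjj, hc'.below, hb, t, hts, hti, htj', htj⟩

lemma OpensBelow.fst_eq [Finite ι] (hfin : (⋃ i, K i)ᶜ.Finite) (h : OpensBelow K s j)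
    (h' : OpensBelow K s' j) : s.1 = s'.1 := by
  obtain ⟨i, hc, hno, u, hu, hlt⟩ := h
  obtain ⟨i', hc', hno', u', hu', hlt'⟩ := h'
  by_cases hii : i = i'
  · subst hii
    exact hc.fst_eq_of_same_cells hK hd hfin hc'
  exfalso
  obtain ⟨t, hts, hts', htj⟩ : ∃ t, t < s.1 ∧ t < s'.1 ∧ t ∈ shadow (K j) := by
    obtain ⟨⟨t, y⟩, ha, hlt⟩ := hc.exists_left hc.mem_closure_upper
    obtain ⟨⟨t', y'⟩, ha', hlt'⟩ := hc'.exists_left hc'.mem_closure_upper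
    rcases le_total t t' with h | h
    · exact ⟨t, hlt, h.trans_lt hlt', y, ha⟩
    · exact ⟨t', h.trans_lt hlt, hlt', y', ha'⟩
  have hti := mem_shadow_of_le_of_le (hK i) hu hc.mem_shadow_lower (hlt t htj).le hts.le
  have hti' := mem_shadow_of_le_of_le (hK i') hu' hc'.mem_shadow_lower (hlt' t htj).le hts'.le
  rcases below_or_below (hd hii) hti hti' with hb | hb
  · exact hno i' ⟨Ne.symm hii, hc'.ne hK, hb, hc'.below, t, hts, hti, hti', htj⟩
  · exact hno' i ⟨hii, hc.ne hK, hb, hc.below, t, hts', hti', hti, htj⟩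

omit hK hd in
lemma OpensBelow.bddBelow (h : OpensBelow K s j) : BddBelow (shadow (K j)) := by
  obtain ⟨i, -, -, u, -, hlt⟩ := h
  exact ⟨u, fun t ht => (hlt t ht).le⟩

/-- Two different pairs of neighbouring cells cannot enclose the same cell. -/
lemma false_of_leftBetween {i' j' : ι} (hne : j ≠ i') (h : LeftBetween K s i j k)
    (h' : LeftBetween K s' i' j' k) {t : ℝ} (hkt : ∀ u ∈ shadow (K k), u ≤ t)
    (hj : t ∈ shadow (K j)) (hi' : t ∈ shadow (K i')) (hb : Below (K j) (K i')) : False := by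
  obtain ⟨u, -, -, hku, hju⟩ := h.exists_lt
  obtain ⟨u', -, hiu', hku', -⟩ := h'.exists_lt
  rcases le_total u u' with hle | hle
  · have hju' := mem_shadow_of_le_of_le (hK j) hju hj hle (hkt _ hku')
    exact h.upper.asymm (hK k) (hK j) (hd h.ne_upper) (hb.trans (hK j) (hK i') (hK k) (hd hne)
      (hd h'.ne_lower.symm) h'.lower hju' hiu' hku')
  · have hiu := mem_shadow_of_le_of_le (hK i') hiu' hi' hle (hkt _ hku)
    exact h'.lower.asymm (hK i') (hK k) (hd h'.ne_lower.symm) (h.upper.trans (hK k) (hK j) (hK i')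
      (hd h.ne_upper) (hd hne) hb hku hju hiu)

lemma ClosesAt.fst_eq [Finite ι] (hfin : (⋃ i, K i)ᶜ.Finite) (h : ClosesAt K s k)
    (h' : ClosesAt K s' k) : s.1 = s'.1 := by
  obtain ⟨i, j, hc, hbet, hbdd, hlt, hmax⟩ := h
  obtain ⟨i', j', hc', hbet', -, hlt', hmax'⟩ := h'
  set τ := sSup (shadow (K k)) with hτ
  obtain ⟨t, hτt, htm⟩ := exists_between (lt_min hlt hlt')
  obtain ⟨hts, hts'⟩ := lt_min_iff.1 htm
  have hkt : ∀ u ∈ shadow (K k), u ≤ t := fun u hu => (le_csSup hbdd hu).trans hτt.le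
  obtain ⟨u, -, hui, huk, huj⟩ := hbet.exists_lt
  obtain ⟨u', -, hui', huk', huj'⟩ := hbet'.exists_lt
  have hti := mem_shadow_of_le_of_le (hK i) hui hc.mem_shadow_lower (hkt u huk) hts.le
  have htj := mem_shadow_of_le_of_le (hK j) huj hc.mem_shadow_upper (hkt u huk) hts.le
  have hti' := mem_shadow_of_le_of_le (hK i') hui' hc'.mem_shadow_lower (hkt u' huk') hts'.le
  have htj' := mem_shadow_of_le_of_le (hK j') huj' hc'.mem_shadow_upper (hkt u' huk') hts'.le
  have hno : ∀ l, l ≠ i → l ≠ j → t ∈ shadow (K l) → Below (K i) (K l) → ¬ Below (K l) (K j) :=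
    fun l hli hlj htl h₁ h₂ =>
      (hmax l ⟨hli, hlj, h₁, h₂, t, hts, hti, htl, htj⟩ t htl).not_gt hτt
  have hno' : ∀ l, l ≠ i' → l ≠ j' → t ∈ shadow (K l) → Below (K i') (K l) →
      ¬ Below (K l) (K j') :=
    fun l hli hlj htl h₁ h₂ =>
      (hmax' l ⟨hli, hlj, h₁, h₂, t, hts', hti', htl, htj'⟩ t htl).not_gt hτt
  have hji' : ∀ hne : j ≠ i', Below (K i') (K j) := fun hne =>
    (below_or_below (hd hne) htj hti').resolve_left
      (false_of_leftBetween hK hd hne hbet hbet' hkt htj hti')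
  have hj'i : ∀ hne : j' ≠ i, Below (K i) (K j') := fun hne =>
    (below_or_below (hd hne) htj' hti).resolve_left
      (false_of_leftBetween hK hd hne hbet' hbet hkt htj' hti)
  have hne₁ : j ≠ i' := by
    rintro rfl
    exact hbet.upper.asymm (hK k) (hK j) (hd hbet.ne_upper) hbet'.lower
  have hne₂ : j' ≠ i := by
    rintro rfl
    exact hbet'.upper.asymm (hK k) (hK j') (hd hbet'.ne_upper) hbet.lower
  have hii : i = i' := by
    by_contra hne
    rcases below_or_below (hd hne) hti hti' with hb | hb
    · exact hno i' (Ne.symm hne) hne₁.symm hti' hb (hji' hne₁)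
    · exact hno' i hne hne₂.symm hti hb (hj'i hne₂)
  subst hii
  have hjj : j = j' := by
    by_contra hne
    rcases below_or_below (hd hne) htj htj' with hb | hb
    · exact hno' j (hc.ne hK).symm hne htj hc.below hb
    · exact hno j' (hc'.ne hK).symm (Ne.symm hne) htj' hc'.below hb
  subst hjj
  exact hc.fst_eq_of_same_cells hK hd hfin hc'

end Charge

section Count

lemma ncard_add_ncard_le {α ι : Type*} [Fintype ι] {S : Set α} (R : α → ι → Prop) (U : Set ι)
    (hU : ∀ s ∈ S, ∀ i, R s i → i ∉ U)
    (huniq : ∀ s ∈ S, ∀ s' ∈ S, ∀ i, R s i → R s' i → s = s') :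
    {s ∈ S | ∃ i, R s i}.ncard + U.ncard ≤ Fintype.card ι := by
  have hex : ∀ s : {s ∈ S | ∃ i, R s i}, ∃ i, R s i := fun s => s.2.2
  choose f hf using hex
  have hinj : Function.Injective f := fun a b hab =>
    Subtype.ext (huniq a a.2.1 b b.2.1 (f a) (hf a) (hab ▸ hf b))
  have hsub : range f ⊆ Uᶜ := by
    rintro _ ⟨a, rfl⟩
    exact hU a a.2.1 _ (hf a)
  have h₁ : {s ∈ S | ∃ i, R s i}.ncard = (range f).ncard := by
    rw [← Set.image_univ, Set.ncard_image_of_injective _ hinj, Set.ncard_univ]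
    rfl
  have h₂ := Set.ncard_le_ncard hsub
  have h₃ := Set.ncard_add_ncard_compl U
  rw [Nat.card_eq_fintype_card] at h₃
  omega

variable {ι : Type*} [Fintype ι] {K : ι → Set (ℝ × ℝ)} (hK : ∀ i, Convex ℝ (K i))
  (hd : Pairwise fun i j => Disjoint (K i) (K j)) (hfin : (⋃ i, K i)ᶜ.Finite)

include hK hfin

lemma ncard_le_card_of_subset_line {c m : ℝ} (hline : ∀ s ∈ (⋃ i, K i)ᶜ, s.2 = c + m * s.1) :
    (⋃ i, K i)ᶜ.ncard ≤ Fintype.card ι := by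
  have hex : ∀ s : ℝ × ℝ, ∃ i, ∀ᶠ r in 𝓝[>] (0 : ℝ), s + r • ((1 : ℝ), m) ∈ K i := fun s =>
    exists_eventually_nhdsGT_mem hK hfin s (by simp)
  choose f hf using hex
  have key : ∀ s ∈ (⋃ i, K i)ᶜ, ∀ s' ∈ (⋃ i, K i)ᶜ, f s = f s' → ¬ s.1 < s'.1 := by
    intro s hs s' hs' hff hlt
    obtain ⟨r, hr, hr', h₁⟩ := exists_small (hf s) (sub_pos.2 hlt)
    obtain ⟨u, hu, -, h₂⟩ := exists_small (hf s') one_pos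
    rw [← hff] at h₂
    have e : ∀ v : ℝ, s' + v • ((1 : ℝ), m) = s + (s'.1 - s.1 + v) • ((1 : ℝ), m) := by
      intro v
      ext
      · simp
        ring
      · simp only [Prod.snd_add, Prod.smul_snd, smul_eq_mul, hline s hs, hline s' hs']
        ring
    rw [e] at h₂
    have h₃ : s + (s'.1 - s.1 + 0) • ((1 : ℝ), m) ∈ K (f s) :=
      (ordConnected_line_preimage (hK (f s)) s (1, m)).out h₁ h₂
        ⟨by linarith, by linarith⟩
    rw [← e, zero_smul, add_zero] at h₃
    exact hs' (mem_iUnion_of_mem _ h₃)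
  have h := ncard_add_ncard_le (S := (⋃ i, K i)ᶜ) (fun s i => f s = i) ∅ (by simp) (by
    rintro s hs s' hs' i h rfl
    have h₁ : s.1 = s'.1 := le_antisymm (not_lt.1 (key s' hs' s hs h.symm))
      (not_lt.1 (key s hs s' hs' h))
    exact Prod.ext h₁ (by rw [hline s hs, hline s' hs', h₁]))
  rwa [Set.ncard_empty, add_zero,
    show {s ∈ (⋃ i, K i)ᶜ | ∃ i, f s = i} = (⋃ i, K i)ᶜ by ext; simp] at h

omit [Fintype ι] hK hfin in
lemma exists_height {A B : Set (ℝ × ℝ)} (hA : Convex ℝ A) {t : ℝ}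
    (hcov : ∀ y, (t, y) ∈ A ∨ (t, y) ∈ B) (htop : ∀ᶠ y in atTop, (t, y) ∈ A)
    (hbot : ∀ᶠ y in atBot, (t, y) ∈ B) (hAB : Disjoint A B) :
    ∃ p, (∀ y > p, (t, y) ∈ A) ∧ ∀ y < p, (t, y) ∈ B := by
  obtain ⟨z, hz⟩ := htop.exists
  obtain ⟨w, hw⟩ := hbot.exists_forall_of_atBot
  have hbdd : BddBelow {y | (t, y) ∈ A} := ⟨w, fun y hy => by
    by_contra! hlt
    exact Set.disjoint_left.1 hAB hy (hw y hlt.le)⟩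
  refine ⟨sInf {y | (t, y) ∈ A}, fun y hy => ?_, fun y hy => ?_⟩
  · obtain ⟨x, hx, hxy⟩ := exists_lt_of_csInf_lt ⟨z, hz⟩ hy
    obtain ⟨u, hu, hyu⟩ := (htop.and (eventually_ge_atTop y)).exists
    exact mem_of_le_of_le hA hx hu hxy.le hyu
  · exact (hcov y).resolve_left fun h => (csInf_le hbdd h).not_gt hy

include hd

lemma ncard_le_of_two_unbounded {T D : ι} (hT : ∀ t, ∀ᶠ y in atTop, (t, y) ∈ K T)
    (hD : ∀ t, ∀ᶠ y in atBot, (t, y) ∈ K D) (hTD : T ≠ D)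
    (hlow : ∀ i, i ≠ T → i ≠ D → BddBelow (shadow (K i)))
    (hupp : ∀ i, i ≠ T → i ≠ D → BddAbove (shadow (K i))) :
    (⋃ i, K i)ᶜ.ncard ≤ Fintype.card ι := by
  have hfst : (Prod.fst '' (⋃ i, K i)ᶜ).Finite := hfin.image _
  have hheight : ∀ t, t ∉ Prod.fst '' (⋃ i, K i)ᶜ → (∀ i, i ≠ T → i ≠ D → t ∉ shadow (K i)) →
      ∃ p, (∀ y > p, (t, y) ∈ K T) ∧ ∀ y < p, (t, y) ∈ K D := by
    intro t ht ht'
    refine exists_height (hK T) (fun y => ?_) (hT t) (hD t) (hd hTD)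
    have hmem : (t, y) ∈ ⋃ i, K i := by
      by_contra hno
      exact ht ⟨_, hno, rfl⟩
    obtain ⟨i, hi⟩ := mem_iUnion.1 hmem
    by_cases hiT : i = T
    · exact .inl (hiT ▸ hi)
    by_cases hiD : i = D
    · exact .inr (hiD ▸ hi)
    exact (ht' i hiT hiD ⟨y, hi⟩).elim
  obtain ⟨t₁, ⟨h₁S, h₁K⟩, h₁0⟩ : ∃ t, ((∀ s ∈ Prod.fst '' (⋃ i, K i)ᶜ, t < s) ∧
      ∀ i, i ≠ T → i ≠ D → t ∉ shadow (K i)) ∧ t < 0 := by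
    refine (Eventually.and (Eventually.and ?_ ?_) (eventually_lt_atBot (0 : ℝ))).exists
    · exact (eventually_all_finite hfst).2 fun s _ => eventually_lt_atBot s
    · refine eventually_all.2 fun i => ?_
      by_cases hi : i ≠ T ∧ i ≠ D
      · obtain ⟨b, hb⟩ := hlow i hi.1 hi.2
        filter_upwards [eventually_lt_atBot b] with t ht _ _ hmem
        exact (hb hmem).not_gt ht
      · exact Eventually.of_forall fun t h h' => (hi ⟨h, h'⟩).elim
  obtain ⟨t₂, ⟨h₂S, h₂K⟩, h₂0⟩ : ∃ t, ((∀ s ∈ Prod.fst '' (⋃ i, K i)ᶜ, s < t) ∧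
      ∀ i, i ≠ T → i ≠ D → t ∉ shadow (K i)) ∧ 0 < t := by
    refine (Eventually.and (Eventually.and ?_ ?_) (eventually_gt_atTop (0 : ℝ))).exists
    · exact (eventually_all_finite hfst).2 fun s _ => eventually_gt_atTop s
    · refine eventually_all.2 fun i => ?_
      by_cases hi : i ≠ T ∧ i ≠ D
      · obtain ⟨b, hb⟩ := hupp i hi.1 hi.2
        filter_upwards [eventually_gt_atTop b] with t ht _ _ hmem
        exact (hb hmem).not_gt ht
      · exact Eventually.of_forall fun t h h' => (hi ⟨h, h'⟩).elim
  obtain ⟨p, hpT, hpD⟩ := hheight t₁ (fun h => lt_irrefl _ (h₁S _ h)) h₁K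
  obtain ⟨q, hqT, hqD⟩ := hheight t₂ (fun h => lt_irrefl _ (h₂S _ h)) h₂K
  refine ncard_le_card_of_subset_line hK hfin (c := p - (q - p) / (t₂ - t₁) * t₁)
    (m := (q - p) / (t₂ - t₁)) fun s hs => ?_
  have hs₁ := h₁S _ ⟨s, hs, rfl⟩
  have hs₂ := h₂S _ ⟨s, hs, rfl⟩
  have hle : s.2 ≤ p + (q - p) / (t₂ - t₁) * (s.1 - t₁) := by
    refine le_line_of_mem_Icc (hK T) 1 hs₁.le hs₂.le (by linarith) ?_ ?_ ?_
    · filter_upwards [self_mem_nhdsWithin] with r (hr : 0 < r)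
      exact hpT _ (by linarith)
    · filter_upwards [self_mem_nhdsWithin] with r (hr : 0 < r)
      exact hqT _ (by linarith)
    · intro z hz
      by_contra! hlt
      obtain ⟨u, hu, hsu⟩ := ((hT s.1).and (eventually_ge_atTop s.2)).exists
      exact hs (mem_iUnion_of_mem T
        (mem_of_le_of_le (hK T) hz hu (z := s.2) (by linarith) hsu))
  have hge : -s.2 ≤ -p + (-q - -p) / (t₂ - t₁) * (s.1 - t₁) := by
    refine le_line_of_mem_Icc (hK D) (-1) hs₁.le hs₂.le (by linarith) ?_ ?_ ?_
    · filter_upwards [self_mem_nhdsWithin] with r (hr : 0 < r)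
      exact hpD _ (by linarith)
    · filter_upwards [self_mem_nhdsWithin] with r (hr : 0 < r)
      exact hqD _ (by linarith)
    · intro z hz
      by_contra! hlt
      obtain ⟨u, hu, hsu⟩ := ((hD s.1).and (eventually_le_atBot s.2)).exists
      exact hs (mem_iUnion_of_mem D
        (mem_of_le_of_le (hK D) hu hz (z := s.2) hsu (by linarith)))
  rw [show -q - -p = -(q - p) by ring, neg_div, neg_mul] at hge
  linarith

lemma ncard_le_of_generic (hcard : 3 ≤ Fintype.card ι)
    (hgen : ∀ s ∈ (⋃ i, K i)ᶜ, ∀ s' ∈ (⋃ i, K i)ᶜ, s.1 = s'.1 → s = s') {T D : ι}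
    (hT : ∀ t, ∀ᶠ y in atTop, (t, y) ∈ K T) (hD : ∀ t, ∀ᶠ y in atBot, (t, y) ∈ K D) :
    (⋃ i, K i)ᶜ.ncard ≤ 5 * Fintype.card ι - 11 := by
  by_cases hTD : T = D
  · subst hTD
    have hempty : (⋃ i, K i)ᶜ = ∅ := by
      rw [Set.compl_empty_iff, Set.eq_univ_iff_forall]
      rintro ⟨t, y⟩
      obtain ⟨u, hu, hyu⟩ := ((hT t).and (eventually_ge_atTop y)).exists
      obtain ⟨v, hv, hvy⟩ := ((hD t).and (eventually_le_atBot y)).exists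
      exact mem_iUnion_of_mem T (mem_of_le_of_le (hK T) hv hu hvy hyu)
    simp [hempty]
  set L : Set ι := {i | ¬ BddBelow (shadow (K i))} with hL
  set R : Set ι := {i | ¬ BddAbove (shadow (K i))} with hR
  have hTs : shadow (K T) = univ := eq_univ_of_forall fun t => (hT t).exists
  have hDs : shadow (K D) = univ := eq_univ_of_forall fun t => (hD t).exists
  have hTDL : {T, D} ⊆ L := by
    rintro i (rfl | rfl)
    · simp [hL, hTs]
    · simp [hL, hDs]
  have hTDR : {T, D} ⊆ R := by
    rintro i (rfl | rfl)
    · simp [hR, hTs]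
    · simp [hR, hDs]
  have hL₂ := Set.ncard_le_ncard hTDL
  have hR₂ := Set.ncard_le_ncard hTDR
  rw [Set.ncard_pair hTD] at hL₂ hR₂
  by_cases htwo : L.ncard ≤ 2 ∧ R.ncard ≤ 2
  · have hLeq := Set.eq_of_subset_of_ncard_le hTDL (by rw [Set.ncard_pair hTD]; exact htwo.1)
    have hReq := Set.eq_of_subset_of_ncard_le hTDR (by rw [Set.ncard_pair hTD]; exact htwo.2)
    have := ncard_le_of_two_unbounded hK hd hfin hT hD hTD
      (fun i h₁ h₂ => by
        by_contra hno
        have : i ∈ L := hno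
        rw [← hLeq] at this
        simp [h₁, h₂] at this)
      (fun i h₁ h₂ => by
        by_contra hno
        have : i ∈ R := hno
        rw [← hReq] at this
        simp [h₁, h₂] at this)
    omega
  set S := (⋃ i, K i)ᶜ with hS
  have c₁ := ncard_add_ncard_le (S := S) (fun s i => StartsAt (K i) s) L
    (fun s _ i h hi => hi h.bddBelow)
    (fun s hs s' hs' i h h' => hgen s hs s' hs' (le_antisymm (h.fst_le h') (h'.fst_le h)))
  have c₂ := ncard_add_ncard_le (S := S) (fun s i => EndsAt (K i) s) R
    (fun s _ i h hi => hi h.bddAbove)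
    (fun s hs s' hs' i h h' => hgen s hs s' hs' (le_antisymm (h.fst_le h') (h'.fst_le h)))
  have c₃ := ncard_add_ncard_le (S := S) (fun s i => OpensAbove K s i) {T}
    (by
      rintro s - i ⟨j, hc, -⟩ rfl
      obtain ⟨t, a, b, -, hb, -⟩ := hc.below
      obtain ⟨u, hu, hbu⟩ := ((hT t).and (eventually_ge_atTop b)).exists
      exact (hc.below.lt (hK _) (hK j) (hd (hc.ne hK)) hu hb).not_ge hbu)
    (fun s hs s' hs' i h h' => hgen s hs s' hs' (h.fst_eq hK hd hfin h'))
  have c₄ := ncard_add_ncard_le (S := S) (fun s i => OpensBelow K s i) L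
    (fun s _ i h hi => hi h.bddBelow)
    (fun s hs s' hs' i h h' => hgen s hs s' hs' (h.fst_eq hK hd hfin h'))
  have c₅ := ncard_add_ncard_le (S := S) (fun s i => ClosesAt K s i) R
    (fun s _ i ⟨_, _, _, _, hb, _⟩ hi => hi hb)
    (fun s hs s' hs' i h h' => hgen s hs s' hs' (h.fst_eq hK hd hfin h'))
  have hsub : S ⊆ {s ∈ S | ∃ i, StartsAt (K i) s} ∪ ({s ∈ S | ∃ i, EndsAt (K i) s} ∪
      ({s ∈ S | ∃ i, OpensAbove K s i} ∪ ({s ∈ S | ∃ i, OpensBelow K s i} ∪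
        {s ∈ S | ∃ i, ClosesAt K s i}))) := by
    intro s hs
    rcases exists_charge hK hd hfin hs with h | h | h | h | h <;> simp [hs, h]
  have hle := (Set.ncard_le_ncard hsub (hfin.subset (by simp))).trans <|
    (Set.ncard_union_le _ _).trans <| Nat.add_le_add_left
      ((Set.ncard_union_le _ _).trans <| Nat.add_le_add_left
        ((Set.ncard_union_le _ _).trans <| Nat.add_le_add_left (Set.ncard_union_le _ _) _) _) _
  rw [Set.ncard_singleton] at c₃
  omega

end Count

section Shear

/-- The inverse slopes of the upward rays contained in `A`. -/
def upwardSlopes (A : Set (ℝ × ℝ)) : Set ℝ := {e | ∃ p q : ℝ, ∀ r ≥ 0, (p + r * e, q + r) ∈ A}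

lemma eventually_atTop_mem_of_upwardSlopes {A : Set (ℝ × ℝ)} (hA : Convex ℝ A) {e : ℝ}
    (he : e ∈ upwardSlopes A) (hg : ¬ IsGreatest (upwardSlopes A) e)
    (hl : ¬ IsLeast (upwardSlopes A) e) (t : ℝ) : ∀ᶠ y in atTop, (t + e * y, y) ∈ A := by
  obtain ⟨b, ⟨p₂, q₂, hb⟩, heb⟩ : ∃ b ∈ upwardSlopes A, e < b := by
    by_contra! hno
    exact hg ⟨he, hno⟩
  obtain ⟨a, ⟨p₁, q₁, ha⟩, hae⟩ : ∃ a ∈ upwardSlopes A, a < e := by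
    by_contra! hno
    exact hl ⟨he, hno⟩
  filter_upwards [eventually_ge_atTop q₁, eventually_ge_atTop q₂,
    eventually_gt_atTop ((p₁ - q₁ * a - t) / (e - a)),
    eventually_gt_atTop ((t - p₂ + q₂ * b) / (b - e))] with y h₁ h₂ h₃ h₄
  rw [div_lt_iff₀ (by linarith)] at h₃ h₄
  have hL := ha (y - q₁) (by linarith)
  have hR := hb (y - q₂) (by linarith)
  rw [add_sub_cancel] at hL hR
  have hpos : 0 < (p₂ + (y - q₂) * b) - (p₁ + (y - q₁) * a) := by nlinarith
  have := mem_of_convex_comb hA hL hR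
    (w := ((t + e * y) - (p₁ + (y - q₁) * a)) / ((p₂ + (y - q₂) * b) - (p₁ + (y - q₁) * a)))
    (div_nonneg (by nlinarith) hpos.le) ((div_le_one hpos).2 (by nlinarith))
  rw [div_mul_cancel₀ _ hpos.ne'] at this
  simpa using this

variable {ι : Type*} {K : ι → Set (ℝ × ℝ)}

lemma exists_mem_upwardSlopes [Finite ι] (hK : ∀ i, Convex ℝ (K i))
    (hfin : (⋃ i, K i)ᶜ.Finite) (e : ℝ) : ∃ i, e ∈ upwardSlopes (K i) := by
  obtain ⟨i, hi⟩ := exists_eventually_atTop_mem hK hfin 0 (v := (e, 1)) (by simp)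
  obtain ⟨M, hM⟩ := eventually_atTop.1 hi
  refine ⟨i, M * e, M, fun r hr => ?_⟩
  have := hM (M + r) (by linarith)
  convert this using 1
  ext
  · simp
    ring
  · simp

lemma finite_isGreatest_or_isLeast [Finite ι] (E : ι → Set ℝ) :
    {e | ∃ i, IsGreatest (E i) e ∨ IsLeast (E i) e}.Finite := by
  have h : {e | ∃ i, IsGreatest (E i) e ∨ IsLeast (E i) e} =
      ⋃ i, ({e | IsGreatest (E i) e} ∪ {e | IsLeast (E i) e}) := by
    ext
    simp
  rw [h]
  exact Set.finite_iUnion fun i =>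
    (Set.Subsingleton.finite fun a ha b hb => ha.unique hb).union
      (Set.Subsingleton.finite fun a ha b hb => ha.unique hb)

lemma finite_nongeneric_slopes {S : Set (ℝ × ℝ)} (hS : S.Finite) :
    {e : ℝ | ∃ s ∈ S, ∃ s' ∈ S, s ≠ s' ∧ s.1 - e * s.2 = s'.1 - e * s'.2}.Finite := by
  have h : {e : ℝ | ∃ s ∈ S, ∃ s' ∈ S, s ≠ s' ∧ s.1 - e * s.2 = s'.1 - e * s'.2} =
      ⋃ s ∈ S, ⋃ s' ∈ S, {e : ℝ | s ≠ s' ∧ s.1 - e * s.2 = s'.1 - e * s'.2} := by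
    ext
    simp only [mem_ofPred_eq, mem_iUnion, exists_prop]
  rw [h]
  refine hS.biUnion fun s _ => hS.biUnion fun s' _ => Set.Subsingleton.finite ?_
  rintro a ⟨hne, ha⟩ b ⟨-, hb⟩
  by_contra hab
  have h₂ : s.2 = s'.2 := by
    have : (a - b) * (s.2 - s'.2) = 0 := by linarith
    rcases mul_eq_zero.1 this with h | h
    · exact (hab (sub_eq_zero.1 h)).elim
    · exact sub_eq_zero.1 h
  exact hne (Prod.ext (by rw [h₂] at ha; linarith) h₂)

/-- The shear of the plane sending vertical lines to lines of inverse slope `e`. -/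
def shear (e : ℝ) : (ℝ × ℝ) ≃ₗ[ℝ] (ℝ × ℝ) where
  toFun p := (p.1 + e * p.2, p.2)
  invFun p := (p.1 - e * p.2, p.2)
  map_add' p q := by ext <;> simp; ring
  map_smul' c p := by ext <;> simp; ring
  left_inv p := by simp
  right_inv p := by simp

lemma compl_iUnion_preimage {α β : Type*} (f : α → β) (K : ι → Set β) :
    (⋃ i, f ⁻¹' K i)ᶜ = f ⁻¹' (⋃ i, K i)ᶜ := by
  rw [preimage_compl, preimage_iUnion]

theorem ncard_compl_iUnion_le [Fintype ι] (hcard : 3 ≤ Fintype.card ι) (hK : ∀ i, Convex ℝ (K i))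
    (hd : Pairwise fun i j => Disjoint (K i) (K j)) (hfin : (⋃ i, K i)ᶜ.Finite) :
    (⋃ i, K i)ᶜ.ncard ≤ 5 * Fintype.card ι - 11 := by
  let N : (ℝ × ℝ) ≃ₗ[ℝ] (ℝ × ℝ) := LinearEquiv.neg ℝ
  have hKN : ∀ i, Convex ℝ (N ⁻¹' K i) := fun i => (hK i).linear_preimage N.toLinearMap
  have hfinN : (⋃ i, N ⁻¹' K i)ᶜ.Finite := by
    rw [compl_iUnion_preimage]
    exact hfin.preimage N.injective.injOn
  obtain ⟨e, he⟩ := (((finite_isGreatest_or_isLeast fun i => upwardSlopes (K i)).union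
    (finite_isGreatest_or_isLeast fun i => upwardSlopes (N ⁻¹' K i))).union
      (finite_nongeneric_slopes hfin)).exists_notMem
  simp only [mem_union, mem_ofPred_eq, not_or, not_exists, not_and] at he
  obtain ⟨⟨he₁, he₂⟩, he₃⟩ := he
  obtain ⟨T, hT⟩ := exists_mem_upwardSlopes hK hfin e
  obtain ⟨D, hD⟩ := exists_mem_upwardSlopes hKN hfinN e
  have hT' := eventually_atTop_mem_of_upwardSlopes (hK T) hT (he₁ T).1 (he₁ T).2
  have hD' := eventually_atTop_mem_of_upwardSlopes (hKN D) hD (he₂ D).1 (he₂ D).2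
  have h := ncard_le_of_generic (K := fun i => shear e ⁻¹' K i)
    (fun i => (hK i).linear_preimage (shear e).toLinearMap)
    (fun i j hij => (hd hij).preimage _)
    (by
      rw [compl_iUnion_preimage]
      exact hfin.preimage (shear e).injective.injOn)
    hcard
    (by
      rw [compl_iUnion_preimage]
      intro s hs s' hs' heq
      by_contra hne
      refine he₃ _ hs _ hs' ((shear e).injective.ne hne) ?_
      simpa [shear] using heq)
    (T := T) (D := D) hT'
    (by
      intro t
      have := tendsto_neg_atBot_atTop.eventually (hD' (-t))
      filter_upwards [this] with y hy
      have e₁ : N (-t + e * -y, -y) = shear e (t, y) := by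
        ext <;> simp [N, shear]
        ring
      change shear e (t, y) ∈ K D
      rw [← e₁]
      exact hy)
  rwa [compl_iUnion_preimage, Set.ncard_preimage_of_injective_subset_range (shear e).injective
    (by simp [(shear e).surjective.range_eq])] at h

end Shear

end PlanarSweep

/-- If `K₁, …, Kₙ` (`n ≥ 3`) are pairwise disjoint convex subsets of the plane whose
complement `S` is finite, then `|S| ≤ 5n - 11`. -/
theorem complement_disjoint_convex_plane_card_le (n : ℕ) (hn : 3 ≤ n)
    (K : Fin n → Set (EuclideanSpace ℝ (Fin 2))) (hK : ∀ i, Convex ℝ (K i))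
    (hdisj : Pairwise fun i j => Disjoint (K i) (K j))
    (hfin : (⋃ i, K i)ᶜ.Finite) :
    (⋃ i, K i)ᶜ.ncard ≤ 5 * n - 11 := by
  let φ : (ℝ × ℝ) ≃ₗ[ℝ] EuclideanSpace ℝ (Fin 2) :=
    (LinearEquiv.finTwoArrow ℝ ℝ).symm.trans (WithLp.linearEquiv 2 ℝ (Fin 2 → ℝ)).symm
  have h := PlanarSweep.ncard_compl_iUnion_le (K := fun i => φ ⁻¹' K i) (by simpa using hn)
    (fun i => (hK i).linear_preimage φ.toLinearMap) (fun i j hij => (hdisj hij).preimage _)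
    (by
      rw [PlanarSweep.compl_iUnion_preimage]
      exact hfin.preimage φ.injective.injOn)
  rwa [PlanarSweep.compl_iUnion_preimage, Fintype.card_fin,
    Set.ncard_preimage_of_injective_subset_range φ.injective
      (by simp [φ.surjective.range_eq])] at h
end
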